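/- For i ∈ {1,2}, let Q_i be a right Bruck loop of odd order with inversion map J_i, and let A_i = Mlt_ρ(Q_i) ⋊ ⟨J_i⟩. If A_1 ≅ A_2 as groups, then Q_1 ≅ Q_2 as loops. -/

import Mathlib

/-- A right Bol loop. -/
class RightBolLoop (Q : Type*) extends Mul Q, One Q, Inv Q where
  one_mul : ∀ a : Q, 1 * a = a
  mul_one : ∀ a : Q, a * 1 = a
  mulLeft_bij : ∀ a : Q, Function.Bijective (fun x : Q => a * x)
  mulRight_bij : ∀ a : Q, Function.Bijective (fun x : Q => x * a)
  mul_inv : ∀ a : Q, a * a⁻¹ = 1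
  inv_mul : ∀ a : Q, a⁻¹ * a = 1
  rbol : ∀ w u v : Q, ((w * u) * v) * u = w * ((u * v) * u)

/-- A right Bruck loop. -/
class RightBruckLoop (Q : Type*) extends RightBolLoop Q where
  aip : ∀ a b : Q, (a * b)⁻¹ = a⁻¹ * b⁻¹

variable {Q : Type*} [RightBolLoop Q]

/-- The right translation `R_a : x ↦ x·a` as a permutation of `Q`. -/
noncomputable def Rt (a : Q) : Equiv.Perm Q :=
  Equiv.ofBijective _ (RightBolLoop.mulRight_bij a)

theorem inv_invol (a : Q) : a⁻¹⁻¹ = a :=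
  (RightBolLoop.mulLeft_bij a⁻¹).injective
    (show a⁻¹ * a⁻¹⁻¹ = a⁻¹ * a by
      rw [RightBolLoop.mul_inv, RightBolLoop.inv_mul])

/-- The inversion map `J : u ↦ u⁻¹` as a permutation of `Q`. -/
noncomputable def Jmap : Equiv.Perm Q :=
  Function.Involutive.toPerm (fun a : Q => a⁻¹) (fun a => inv_invol a)

/-- The group `A = Mlt_ρ(Q) ⋊ ⟨J⟩`, realized inside `Sym(Q)` as the subgroup
generated by all right translations together with the inversion map `J`
(since `J` normalizes `Mlt_ρ(Q)`, acting by `R_u^J = R_u⁻¹`, this is the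
semidirect product of the paper). -/
noncomputable def Agrp (Q : Type*) [RightBolLoop Q] : Subgroup (Equiv.Perm Q) :=
  Subgroup.closure (insert Jmap (Set.range (Rt : Q → Equiv.Perm Q)))

/-- An element `t` with `t² = 1` all of whose products with conjugates have odd order. -/
def IsIsolated {G : Type*} [Group G] (t : G) : Prop :=
  t * t = 1 ∧ ∀ g, Odd (orderOf (t * (g * t * g⁻¹)))

/-- The subgroup generated by the products of `t` with its conjugates. -/
def isoKernel {G : Type*} [Group G] (t : G) : Subgroup G :=
  Subgroup.closure (Set.range fun g => t * (g * t * g⁻¹))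

theorem Rt_apply (a x : Q) : Rt a x = x * a := rfl

theorem Jmap_apply (x : Q) : Jmap x = x⁻¹ := rfl

theorem Rt_injective : Function.Injective (Rt : Q → Equiv.Perm Q) := fun a b h => by
  have := congrArg (fun f : Equiv.Perm Q => f 1) h
  simpa [Rt_apply, RightBolLoop.one_mul] using this

theorem Rt_one : Rt (1 : Q) = 1 := Equiv.ext fun x => RightBolLoop.mul_one x

theorem Rt_triple (u v : Q) : Rt u * Rt v * Rt u = Rt ((u * v) * u) :=
  Equiv.ext fun w => RightBolLoop.rbol w u v

theorem Rt_inv (u : Q) : (Rt u)⁻¹ = Rt u⁻¹ := by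
  have h := Rt_triple u u⁻¹
  rw [RightBolLoop.mul_inv, RightBolLoop.one_mul] at h
  have h2 : Rt u * Rt u⁻¹ = 1 := by simpa using h
  exact inv_eq_of_mul_eq_one_right h2

theorem Rt_pow_mem (u : Q) (n : ℕ) : ∃ x : Q, Rt u ^ n = Rt x := by
  induction n using Nat.twoStepInduction with
  | zero => exact ⟨1, by simp [Rt_one]⟩
  | one => exact ⟨u, by simp⟩
  | more n ih _ =>
    obtain ⟨x, hx⟩ := ih
    exact ⟨_, by rw [← Rt_triple u x, ← hx, pow_succ, pow_succ']⟩

theorem Rt_fixed {a x : Q} (h : Rt a x = x) : a = 1 := by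
  apply (RightBolLoop.mulLeft_bij x).injective
  simpa [Rt_apply, RightBolLoop.mul_one] using h

theorem odd_orderOf_Rt [Fintype Q] (h : Odd (Fintype.card Q)) (u : Q) :
    Odd (orderOf (Rt u)) := by
  by_contra hodd
  rw [Nat.not_odd_iff_even] at hodd
  have hpos : 0 < orderOf (Rt u) := orderOf_pos _
  obtain ⟨m, hm⟩ := hodd
  obtain ⟨x, hx⟩ := Rt_pow_mem u m
  have hsq : Rt x ^ 2 ^ 1 = 1 := by
    rw [← hx, ← pow_mul, ← pow_orderOf_eq_one (Rt u), hm]; congr 1; omega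
  have : Fact (Nat.Prime 2) := ⟨Nat.prime_two⟩
  obtain ⟨a, ha⟩ := Equiv.Perm.exists_fixed_point_of_prime (p := 2) (n := 1)
    (by rw [← even_iff_two_dvd, Nat.not_even_iff_odd]; exact h) hsq
  rw [Rt_fixed ha, Rt_one] at hx
  have := Nat.le_of_dvd (by omega) (orderOf_dvd_of_pow_eq_one hx)
  omega

theorem Rt_sq_injective [Fintype Q] (h : Odd (Fintype.card Q)) {a b : Q}
    (hab : Rt a * Rt a = Rt b * Rt b) : Rt a = Rt b := by
  obtain ⟨m, hm⟩ := odd_orderOf_Rt h a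
  obtain ⟨n, hn⟩ := odd_orderOf_Rt h b
  have key : ∀ (x : Equiv.Perm Q) (m n : ℕ), x ^ (2 * m + 1) = 1 →
      x = (x * x) ^ ((2 * m + 1) * n + m + 1) := by
    intro x m n hx
    rw [← pow_two, ← pow_mul,
      show 2 * ((2 * m + 1) * n + m + 1) = (2 * m + 1) * (2 * n + 1) + 1 by ring, pow_succ,
      pow_mul, hx, one_pow, one_mul]
  have h1 := key (Rt a) m n (by rw [← hm]; exact pow_orderOf_eq_one _)
  have h2 := key (Rt b) n m (by rw [← hn]; exact pow_orderOf_eq_one _)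
  rw [h1, h2, hab]; congr 1; ring

theorem exists_Rt_sqrt [Fintype Q] (h : Odd (Fintype.card Q)) (u : Q) :
    ∃ w : Q, Rt w * Rt w = Rt u := by
  obtain ⟨m, hm⟩ := odd_orderOf_Rt h u
  obtain ⟨w, hw⟩ := Rt_pow_mem u (m + 1)
  refine ⟨w, ?_⟩
  rw [← hw, ← pow_add, show m + 1 + (m + 1) = (2 * m + 1) + 1 by ring, pow_succ, ← hm,
    pow_orderOf_eq_one, one_mul]

theorem Jmap_sq : (Jmap : Equiv.Perm Q) * Jmap = 1 := Equiv.ext fun x => inv_invol x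

theorem Jmap_inv : (Jmap : Equiv.Perm Q)⁻¹ = Jmap := inv_eq_of_mul_eq_one_left Jmap_sq

theorem Jmap_Rt {Q : Type*} [RightBruckLoop Q] (u : Q) : Jmap * Rt u * Jmap = (Rt u)⁻¹ := by
  rw [Rt_inv]
  refine Equiv.ext fun x => ?_
  change ((x⁻¹ * u)⁻¹ : Q) = x * u⁻¹
  rw [RightBruckLoop.aip, inv_invol]

theorem Jmap_Rt' {Q : Type*} [RightBruckLoop Q] (u : Q) : Jmap * Rt u = (Rt u)⁻¹ * Jmap := by
  rw [← Jmap_Rt, mul_assoc, Jmap_sq, mul_one]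

theorem Agrp_conj {Q : Type*} [RightBruckLoop Q] {g : Equiv.Perm Q} (hg : g ∈ Agrp Q) :
    ∀ u : Q, ∃ x : Q, g * (Jmap * Rt u) * g⁻¹ = Jmap * Rt x := by
  unfold Agrp at hg
  have hR : ∀ v u : Q, ∃ x : Q, Rt v * (Jmap * Rt u) * (Rt v)⁻¹ = Jmap * Rt x := fun v u => by
    refine ⟨(v⁻¹ * u) * v⁻¹, ?_⟩
    rw [← Rt_triple, ← Rt_inv]
    have : Rt v * Jmap = Jmap * (Rt v)⁻¹ := by rw [Rt_inv, Jmap_Rt', ← Rt_inv, inv_inv]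
    simp only [← mul_assoc, this]
  refine Subgroup.closure_induction'' (p := fun g _ => ∀ u : Q, ∃ x : Q,
    g * (Jmap * Rt u) * g⁻¹ = Jmap * Rt x) ?_ ?_ ?_ ?_ hg
  · rintro x (rfl | ⟨v, rfl⟩) u
    · refine ⟨u⁻¹, ?_⟩
      rw [Jmap_inv, ← Rt_inv, ← Jmap_Rt]
      simp only [mul_assoc]
    · exact hR v u
  · rintro x (rfl | ⟨v, rfl⟩) u
    · refine ⟨u⁻¹, ?_⟩
      rw [inv_inv, Jmap_inv, ← Rt_inv, ← Jmap_Rt]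
      simp only [mul_assoc]
    · rw [Rt_inv]; exact hR _ u
  · intro u; exact ⟨u, by simp⟩
  · intro x y _ _ hx hy u
    obtain ⟨a, ha⟩ := hy u
    obtain ⟨b, hb⟩ := hx a
    refine ⟨b, ?_⟩
    rw [← hb, ← ha]; group

theorem Jmap_conj_mem {Q : Type*} [RightBruckLoop Q] {g : Equiv.Perm Q} (hg : g ∈ Agrp Q) :
    ∃ x : Q, Jmap * (g * Jmap * g⁻¹) = Rt x := by
  obtain ⟨x, hx⟩ := Agrp_conj hg 1
  rw [Rt_one, mul_one] at hx
  exact ⟨x, by rw [hx, ← mul_assoc, Jmap_sq, one_mul]⟩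

theorem Rt_mul_sq {Q : Type*} [RightBruckLoop Q] (u v : Q) :
    Rt (u * v) * Rt (u * v) = Rt v * (Rt u * Rt u) * Rt v := by
  have mem : ∀ a : Q, Rt a ∈ Agrp Q := fun a =>
    Subgroup.subset_closure (Set.mem_insert_of_mem _ ⟨a, rfl⟩)
  set h := (Rt (u * v))⁻¹ * (Rt v * Rt u) with hh
  have h1 : h 1 = 1 := by
    rw [hh, Equiv.Perm.mul_apply, Equiv.Perm.inv_eq_iff_eq]
    simp [Rt_apply, RightBolLoop.one_mul]
  have hmem : h ∈ Agrp Q := mul_mem (inv_mem (mem _)) (mul_mem (mem _) (mem _))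
  obtain ⟨w, hw⟩ := Agrp_conj hmem 1
  rw [Rt_one, mul_one] at hw
  have hinv1 : h⁻¹ 1 = 1 := by rw [Equiv.Perm.inv_eq_iff_eq, h1]
  have one_inv : ((1 : Q)⁻¹) = 1 := by
    have := RightBolLoop.mul_inv (1 : Q)
    rwa [RightBolLoop.one_mul] at this
  have hw1 : (w⁻¹ : Q) = 1 := by
    have := congrArg (fun f : Equiv.Perm Q => f 1) hw
    simp only [Equiv.Perm.mul_apply, hinv1, Jmap_apply, one_inv, h1, Rt_apply,
      RightBolLoop.one_mul] at this
    exact this.symm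
  have hw2 : w = 1 := by rw [← inv_invol w, hw1, one_inv]
  rw [hw2, Rt_one, mul_one] at hw
  have e1 : (Rt v * Rt u) * Jmap * (Rt v * Rt u)⁻¹ = Rt (u * v) * Jmap * (Rt (u * v))⁻¹ := by
    have : (Rt v * Rt u) * Jmap * (Rt v * Rt u)⁻¹ =
        Rt (u * v) * (h * Jmap * h⁻¹) * (Rt (u * v))⁻¹ := by rw [hh]; group
    rw [this, hw]
  have comm : ∀ a : Q, Rt a * Jmap = Jmap * (Rt a)⁻¹ := fun a => by
    rw [Rt_inv, Jmap_Rt', ← Rt_inv, inv_inv]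
  have e2 : Jmap * ((Rt v)⁻¹ * (Rt u)⁻¹ * (Rt u)⁻¹ * (Rt v)⁻¹) =
      Jmap * ((Rt (u * v))⁻¹ * (Rt (u * v))⁻¹) := by
    calc _ = (Rt v * Rt u) * Jmap * (Rt v * Rt u)⁻¹ := by
          rw [mul_assoc (Rt v), comm u, ← mul_assoc (Rt v), comm v]; group
      _ = _ := by rw [e1, comm]; group
  have e3 := congrArg (·⁻¹) (mul_left_cancel e2)
  simpa [mul_assoc] using e3.symm

theorem conj_of_odd {A : Type*} [Group A] [Finite A] {s J : A} (hs : s * s = 1) (hJ : J * J = 1)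
    (hodd : Odd (orderOf (J * s))) : ∃ g, g * s * g⁻¹ = J := by
  obtain ⟨m, hm⟩ := hodd
  have hsi : s⁻¹ = s := inv_eq_of_mul_eq_one_left hs
  have hJi : J⁻¹ = J := inv_eq_of_mul_eq_one_left hJ
  have hsd : s * (J * s) * s⁻¹ = (J * s)⁻¹ := by
    rw [mul_inv_rev, hsi, hJi, mul_assoc, mul_assoc, hs, mul_one]
  refine ⟨(J * s) ^ (m + 1), ?_⟩
  have h1 : s * ((J * s) ^ (m + 1))⁻¹ * s⁻¹ = (J * s) ^ (m + 1) := by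
    rw [← inv_pow, ← conj_pow, ← conj_inv, hsd, inv_inv]
  have h2 : s * ((J * s) ^ (m + 1))⁻¹ = (J * s) ^ (m + 1) * s := by
    rwa [mul_inv_eq_iff_eq_mul] at h1
  rw [mul_assoc, h2, ← mul_assoc, ← pow_add, show m + 1 + (m + 1) = (2 * m + 1) + 1 by ring,
    pow_succ, ← hm, pow_orderOf_eq_one, one_mul, mul_assoc, hs, mul_one]

theorem isoKernel_normal {A : Type*} [Group A] {t : A} (ht : t * t = 1) :
    (isoKernel t).Normal := by
  have hti : t⁻¹ = t := inv_eq_of_mul_eq_one_left ht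
  refine ⟨fun n hn g => ?_⟩
  have gen : ∀ g, t * (g * t * g⁻¹) ∈ isoKernel t := fun g => Subgroup.subset_closure ⟨g, rfl⟩
  refine Subgroup.closure_induction (p := fun n _ => g * n * g⁻¹ ∈ isoKernel t)
    ?_ ?_ ?_ ?_ hn
  · rintro _ ⟨h, rfl⟩
    have : g * (t * (h * t * h⁻¹)) * g⁻¹ =
        (t * (g * t * g⁻¹))⁻¹ * (t * ((g * h) * t * (g * h)⁻¹)) := by
      rw [mul_inv_rev, mul_inv_rev, mul_inv_rev, hti]
      simp only [inv_inv, mul_inv_rev, mul_assoc]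
      rw [← mul_assoc t t, ht, one_mul, inv_mul_cancel_left]
    rw [this]
    exact mul_mem (inv_mem (gen _)) (gen _)
  · simp [one_mem]
  · intro x y _ _ hx hy
    have : g * (x * y) * g⁻¹ = (g * x * g⁻¹) * (g * y * g⁻¹) := by group
    rw [this]; exact mul_mem hx hy
  · intro x _ hx
    have : g * x⁻¹ * g⁻¹ = (g * x * g⁻¹)⁻¹ := by group
    rw [this]; exact inv_mem hx

theorem eq_one_of_odd_card {A : Type*} [Group A] {K : Subgroup A} (hK : Odd (Nat.card K)) {x : A}
    (hx : x ∈ K) (hxx : x * x = 1) : x = 1 := by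
  have h3 : orderOf x ∣ 2 := orderOf_dvd_of_pow_eq_one (by rw [pow_two, hxx])
  have h4 : orderOf x ∣ Nat.card K := by
    rw [show orderOf x = orderOf (⟨x, hx⟩ : K) by simp [← Subgroup.orderOf_coe]]
    exact orderOf_dvd_natCard _
  exact orderOf_eq_one_iff.mp (Nat.eq_one_of_dvd_coprimes
    ((Nat.coprime_two_left).mpr hK) h3 h4)

section loops
variable {Q : Type*} [RightBruckLoop Q]

/-- Right translations as elements of the group `Agrp Q`. -/
noncomputable def RtA (a : Q) : Agrp Q :=
  ⟨Rt a, Subgroup.subset_closure (Set.mem_insert_of_mem _ ⟨a, rfl⟩)⟩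

/-- The inversion map as an element of the group `Agrp Q`. -/
noncomputable def JA (Q : Type*) [RightBruckLoop Q] : Agrp Q :=
  ⟨Jmap, Subgroup.subset_closure (Set.mem_insert _ _)⟩

theorem JA_sq : JA Q * JA Q = 1 := Subtype.ext Jmap_sq

theorem JA_conj (g : Agrp Q) : ∃ x : Q, JA Q * (g * JA Q * g⁻¹) = RtA x := by
  obtain ⟨x, hx⟩ := Jmap_conj_mem g.2
  exact ⟨x, Subtype.ext hx⟩

theorem RtA_eq_conj [Fintype Q] (h : Odd (Fintype.card Q)) (u : Q) :
    ∃ g : Agrp Q, RtA u = JA Q * (g * JA Q * g⁻¹) := by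
  obtain ⟨w, hw⟩ := exists_Rt_sqrt h u
  refine ⟨(RtA w)⁻¹, Subtype.ext ?_⟩
  change Rt u = Jmap * ((Rt w)⁻¹ * Jmap * (Rt w)⁻¹⁻¹)
  rw [← Jmap_Rt' w, inv_inv, ← mul_assoc, ← mul_assoc, Jmap_sq, one_mul, hw]

theorem JA_isolated [Fintype Q] (h : Odd (Fintype.card Q)) : IsIsolated (JA Q) := by
  refine ⟨JA_sq, fun g => ?_⟩
  obtain ⟨x, hx⟩ := JA_conj g
  rw [hx, ← Subgroup.orderOf_coe]
  exact odd_orderOf_Rt h x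

theorem mem_isoKernel_or [Fintype Q] (h : Odd (Fintype.card Q)) (a : Agrp Q) :
    a ∈ isoKernel (JA Q) ∨ JA Q * a ∈ isoKernel (JA Q) := by
  have hJi : (JA Q)⁻¹ = JA Q := inv_eq_of_mul_eq_one_left JA_sq
  have hN := isoKernel_normal (JA_sq (Q := Q))
  have hRt : ∀ u : Q, RtA u ∈ isoKernel (JA Q) := fun u => by
    obtain ⟨g, hg⟩ := RtA_eq_conj h u
    rw [hg]; exact Subgroup.subset_closure ⟨g, rfl⟩
  have key : ∀ x : Equiv.Perm Q, ∀ hx : x ∈ Agrp Q, (⟨x, hx⟩ : Agrp Q) ∈ isoKernel (JA Q) ∨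
      JA Q * ⟨x, hx⟩ ∈ isoKernel (JA Q) := by
    intro x hx
    refine Subgroup.closure_induction (p := fun x hx => (⟨x, hx⟩ : Agrp Q) ∈ isoKernel (JA Q) ∨
      JA Q * ⟨x, hx⟩ ∈ isoKernel (JA Q)) ?_ ?_ ?_ ?_ hx
    · rintro x (rfl | ⟨v, rfl⟩)
      · right
        have : JA Q * JA Q ∈ isoKernel (JA Q) := by rw [JA_sq]; exact one_mem _
        exact this
      · left; exact hRt v
    · left; exact one_mem _
    · intro x y hx hy h1 h2
      have hxy : (⟨x * y, mul_mem hx hy⟩ : Agrp Q) = ⟨x, hx⟩ * ⟨y, hy⟩ := rfl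
      rw [hxy]
      generalize (⟨x, hx⟩ : Agrp Q) = a at *
      generalize (⟨y, hy⟩ : Agrp Q) = b at *
      rcases h1 with h1 | h1 <;> rcases h2 with h2 | h2
      · left; exact mul_mem h1 h2
      · right
        have : JA Q * (a * b) = (JA Q * a * (JA Q)⁻¹) * (JA Q * b) := by group
        rw [this]; exact mul_mem (hN.conj_mem _ h1 _) h2
      · right; rw [← mul_assoc]; exact mul_mem h1 h2
      · left
        have : a * b = (JA Q * (JA Q * a) * (JA Q)⁻¹) * (JA Q * b) := by
          rw [← mul_assoc (JA Q) (JA Q), JA_sq]; group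
        rw [this]; exact mul_mem (hN.conj_mem _ h1 _) h2
    · intro x hx h1
      have hxi : (⟨x⁻¹, inv_mem hx⟩ : Agrp Q) = ⟨x, hx⟩⁻¹ := rfl
      rw [hxi]
      generalize (⟨x, hx⟩ : Agrp Q) = a at *
      rcases h1 with h1 | h1
      · left; exact inv_mem h1
      · right
        have : JA Q * a⁻¹ = JA Q * (JA Q * a)⁻¹ * (JA Q)⁻¹ := by
          rw [mul_inv_rev, hJi, mul_assoc, mul_assoc, JA_sq, mul_one]
        rw [this]; exact hN.conj_mem _ (inv_mem h1) _
  exact key a.1 a.2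

theorem Agrp_iso_conj {Q₁ Q₂ : Type*} [RightBruckLoop Q₁] [RightBruckLoop Q₂]
    [Fintype Q₁] [Fintype Q₂]
    (h1 : Odd (Fintype.card Q₁)) (h2 : Odd (Fintype.card Q₂))
    (z1 : Odd (Nat.card (isoKernel (JA Q₁)))) (z2 : Odd (Nat.card (isoKernel (JA Q₂))))
    (φ : Agrp Q₁ ≃* Agrp Q₂) : ∃ ψ : Agrp Q₁ ≃* Agrp Q₂, ψ (JA Q₁) = JA Q₂ := by
  have hs : φ (JA Q₁) * φ (JA Q₁) = 1 := by rw [← map_mul, JA_sq, map_one]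
  obtain ⟨g, hg⟩ : ∃ g, g * φ (JA Q₁) * g⁻¹ = JA Q₂ := by
    by_cases hJ : JA Q₁ = 1
    · have hsq : φ.symm (JA Q₂) * φ.symm (JA Q₂) = 1 := by rw [← map_mul, JA_sq, map_one]
      have := mem_isoKernel_or h1 (φ.symm (JA Q₂))
      rw [hJ, one_mul, or_self, ← hJ] at this
      have h3 := eq_one_of_odd_card z1 this hsq
      rw [map_eq_one_iff _ φ.symm.injective] at h3
      exact ⟨1, by simp [hJ, h3]⟩
    · have h3 : φ (JA Q₁) ∉ isoKernel (JA Q₂) := fun h => hJ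
        ((map_eq_one_iff _ φ.injective).mp (eq_one_of_odd_card z2 h hs))
      have h4 := (mem_isoKernel_or h2 (φ (JA Q₁))).resolve_left h3
      refine conj_of_odd hs JA_sq ?_
      refine Odd.of_dvd_nat z2 ?_
      rw [show orderOf (JA Q₂ * φ (JA Q₁)) =
        orderOf (⟨_, h4⟩ : isoKernel (JA Q₂)) by simp [← Subgroup.orderOf_coe]]
      exact orderOf_dvd_natCard _
  exact ⟨φ.trans (MulAut.conj g), by simpa using hg⟩

theorem loop_iso_of_odd_kernel (Q₁ Q₂ : Type*) [RightBruckLoop Q₁] [RightBruckLoop Q₂]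
    [Fintype Q₁] [Fintype Q₂]
    (h1 : Odd (Fintype.card Q₁)) (h2 : Odd (Fintype.card Q₂))
    (z1 : Odd (Nat.card (isoKernel (JA Q₁)))) (z2 : Odd (Nat.card (isoKernel (JA Q₂))))
    (φ : Agrp Q₁ ≃* Agrp Q₂) : ∃ f : Q₁ ≃ Q₂, ∀ a b : Q₁, f (a * b) = f a * f b := by
  obtain ⟨ψ, hψ⟩ := Agrp_iso_conj h1 h2 z1 z2 φ
  have hψ' : ψ.symm (JA Q₂) = JA Q₁ := by rw [← hψ]; simp
  have ex1 : ∀ u : Q₁, ∃ x : Q₂, ψ (RtA u) = RtA x := fun u => by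
    obtain ⟨g, hg⟩ := RtA_eq_conj h1 u
    obtain ⟨x, hx⟩ := JA_conj (ψ g)
    exact ⟨x, by rw [hg, ← hx]; simp [hψ]⟩
  have ex2 : ∀ u : Q₂, ∃ x : Q₁, ψ.symm (RtA u) = RtA x := fun u => by
    obtain ⟨g, hg⟩ := RtA_eq_conj h2 u
    obtain ⟨x, hx⟩ := JA_conj (ψ.symm g)
    exact ⟨x, by rw [hg, ← hx]; simp [hψ']⟩
  choose f hf using ex1
  have inj1 : Function.Injective (RtA : Q₁ → _) := fun a b h =>
    Rt_injective (congrArg Subtype.val h)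
  have inj2 : Function.Injective (RtA : Q₂ → _) := fun a b h =>
    Rt_injective (congrArg Subtype.val h)
  have bij : Function.Bijective f := by
    constructor
    · intro a b hab
      apply inj1
      apply ψ.injective
      rw [hf, hf, hab]
    · intro b
      obtain ⟨x, hx⟩ := ex2 b
      refine ⟨x, inj2 ?_⟩
      rw [← hf, ← hx]; simp
  refine ⟨Equiv.ofBijective f bij, fun a b => ?_⟩
  change f (a * b) = f a * f b
  have m1 : RtA (a * b) * RtA (a * b) = RtA b * (RtA a * RtA a) * RtA b :=
    Subtype.ext (Rt_mul_sq a b)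
  have m2 := Rt_mul_sq (f a) (f b)
  have m3 := congrArg (fun x => (ψ x : Equiv.Perm Q₂)) m1
  simp only [map_mul, hf, Subgroup.coe_mul] at m3
  change Rt _ * Rt _ = Rt _ * (Rt _ * Rt _) * Rt _ at m3
  exact Rt_injective (Rt_sq_injective h2 (m3.trans m2.symm))
end loops

section characters
open Representation Module
open scoped Classical

variable {G : Type*} [Group G] [Fintype G]
variable {V : Type*} [AddCommGroup V] [Module ℂ V]

/-- The bilinear pairing of complex functions on a finite group. -/
noncomputable def charPair (f h : G → ℂ) : ℂ := (Nat.card G : ℂ)⁻¹ * ∑ x, f x * h x⁻¹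

/-- A function on `G` is a class function. -/
def IsClassFun {G : Type*} [Group G] (f : G → ℂ) : Prop := ∀ g x, f (g * x * g⁻¹) = f x

/-- `χ` is the character of an irreducible complex representation. -/
def IsIrrChar {G : Type*} [Group G] (χ : G → ℂ) : Prop :=
  ∃ (n : ℕ) (ρ : Representation ℂ G (Fin n → ℂ)), ρ.IsIrreducible ∧ ρ.character = χ

theorem cardC_ne_zero (G : Type*) [Group G] [Finite G] : (Nat.card G : ℂ) ≠ 0 := by
  exact_mod_cast Nat.card_pos.ne'

theorem isIrreducible_iff_submodule {G : Type*} [Group G] (ρ : Representation ℂ G V) :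
    ρ.IsIrreducible ↔ Nontrivial V ∧ ∀ W : Submodule ℂ V, (∀ g, ∀ v ∈ W, ρ g v ∈ W) →
      W = ⊥ ∨ W = ⊤ := by
  have hbot : ∀ W : Subrepresentation ρ, W = ⊥ ↔ W.toSubmodule = ⊥ := fun W =>
    ⟨fun h => by rw [h]; rfl, fun h => Subrepresentation.toSubmodule_injective h⟩
  have htop : ∀ W : Subrepresentation ρ, W = ⊤ ↔ W.toSubmodule = ⊤ := fun W =>
    ⟨fun h => by rw [h]; rfl, fun h => Subrepresentation.toSubmodule_injective h⟩
  constructor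
  · intro h
    refine ⟨?_, fun W hW => ?_⟩
    · by_contra hV
      rw [not_nontrivial_iff_subsingleton] at hV
      obtain ⟨a, b, hab⟩ := h.toNontrivial
      exact hab (Subrepresentation.toSubmodule_injective (Subsingleton.elim _ _))
    · have := h.eq_bot_or_eq_top ⟨W, fun g v hv => hW g v hv⟩
      rwa [hbot, htop] at this
  · rintro ⟨hV, h⟩
    have : Nontrivial (Subrepresentation ρ) := ⟨⊥, ⊤, fun h => bot_ne_top
      (α := Submodule ℂ V) (congrArg Subrepresentation.toSubmodule h)⟩
    exact ⟨fun W => by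
      rw [hbot, htop]; exact h W.toSubmodule fun g v hv => W.apply_mem_toSubmodule g hv⟩

/-- Transport of a representation along a linear equivalence. -/
noncomputable def repConj {G : Type*} [Group G] {W : Type*} [AddCommGroup W] [Module ℂ W]
    (ρ : Representation ℂ G V) (e : V ≃ₗ[ℂ] W) : Representation ℂ G W where
  toFun g := e.conj (ρ g)
  map_one' := by ext; simp [LinearEquiv.conj_apply]
  map_mul' x y := by ext; simp [LinearEquiv.conj_apply]

theorem repConj_character {G : Type*} [Group G] {W : Type*} [AddCommGroup W] [Module ℂ W]
    (ρ : Representation ℂ G V) (e : V ≃ₗ[ℂ] W) : (repConj ρ e).character = ρ.character := by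
  ext g
  exact LinearMap.trace_conj' (ρ g) e

theorem repConj_irreducible {G : Type*} [Group G] {W : Type*} [AddCommGroup W] [Module ℂ W]
    (ρ : Representation ℂ G V) (e : V ≃ₗ[ℂ] W) (h : ρ.IsIrreducible) :
    (repConj ρ e).IsIrreducible := by
  rw [isIrreducible_iff_submodule] at h ⊢
  obtain ⟨h1, h2⟩ := h
  refine ⟨e.symm.toEquiv.nontrivial, fun U hU => ?_⟩
  have := h2 (U.comap e.toLinearMap) fun g v hv => by
    have := hU g (e v) hv
    simpa [repConj, LinearEquiv.conj_apply] using this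
  rcases this with h | h
  · left
    rw [eq_bot_iff]
    intro x hx
    have : e.symm x ∈ U.comap e.toLinearMap := by simpa using hx
    rw [h, Submodule.mem_bot] at this
    simpa using this
  · right
    rw [eq_top_iff]
    intro x _
    have : e.symm x ∈ U.comap e.toLinearMap := by rw [h]; trivial
    simpa using this

variable [FiniteDimensional ℂ V]

theorem isIrrChar_character {G : Type*} [Group G] (ρ : Representation ℂ G V)
    (h : ρ.IsIrreducible) : IsIrrChar ρ.character :=
  ⟨_, repConj ρ (finBasis ℂ V).equivFun, repConj_irreducible _ _ h, repConj_character _ _⟩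

theorem character_isClassFun {G : Type*} [Group G] (ρ : Representation ℂ G V) :
    IsClassFun ρ.character := fun g x => ρ.char_conj x g

theorem IsIrrChar.isClassFun {G : Type*} [Group G] {χ : G → ℂ} (h : IsIrrChar χ) :
    IsClassFun χ := by
  obtain ⟨n, ρ, -, rfl⟩ := h
  exact character_isClassFun ρ

theorem charPair_comm (f h : G → ℂ) : charPair f h = charPair h f := by
  unfold charPair
  congr 1
  rw [← Equiv.sum_comp (Equiv.inv G)]
  simp [mul_comm]

theorem charPair_character {W : Type*} [AddCommGroup W] [Module ℂ W] [FiniteDimensional ℂ W]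
    (ρ : Representation ℂ G V) (σ : Representation ℂ G W) :
    charPair σ.character ρ.character = finrank ℂ (IntertwiningMap ρ σ) := by
  have := invertibleOfNonzero (cardC_ne_zero G)
  exact card_inv_mul_sum_char_mul_char_eq_finrank ρ σ

theorem card_inv_sum_character (ρ : Representation ℂ G V) :
    (Nat.card G : ℂ)⁻¹ * ∑ g, ρ.character g = finrank ℂ (invariants ρ) := by
  have := invertibleOfNonzero (cardC_ne_zero G)
  exact card_inv_mul_sum_char_eq_finrank ρ

theorem charPair_irr {χ ψ : G → ℂ} (hχ : IsIrrChar χ) (hψ : IsIrrChar ψ) :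
    charPair χ ψ = if χ = ψ then 1 else 0 := by
  obtain ⟨n, ρ, hρ, rfl⟩ := hχ
  obtain ⟨m, σ, hσ, rfl⟩ := hψ
  have := invertibleOfNonzero (cardC_ne_zero G)
  have key : charPair ρ.character σ.character = if Nonempty (Representation.Equiv σ ρ) then 1 else 0 :=
    char_orthonormal ρ σ
  have key2 : charPair ρ.character ρ.character = if Nonempty (Representation.Equiv ρ ρ) then 1 else 0 :=
    char_orthonormal ρ ρ
  rw [if_pos ⟨Representation.Equiv.refl ρ⟩] at key2
  by_cases h : Nonempty (Representation.Equiv σ ρ)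
  · rw [key, if_pos h, if_pos (char_iso h.some).symm]
  · rw [if_neg h] at key
    rw [key, if_neg]
    intro heq
    rw [← heq, key2] at key
    exact one_ne_zero key

theorem charPair_sum_left {ι : Type*} (s : Finset ι) (c : ι → ℂ) (f : ι → G → ℂ) (h : G → ℂ) :
    charPair (fun x => ∑ i ∈ s, c i * f i x) h = ∑ i ∈ s, c i * charPair (f i) h := by
  unfold charPair
  simp only [Finset.sum_mul, Finset.mul_sum]
  rw [Finset.sum_comm]
  refine Finset.sum_congr rfl fun i _ => Finset.sum_congr rfl fun x _ => by ring

theorem irrChar_finite (G : Type*) [Group G] [Fintype G] : {χ : G → ℂ | IsIrrChar χ}.Finite := by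
  classical
  have hli : LinearIndependent ℂ (fun χ : {χ : G → ℂ | IsIrrChar χ} => (χ : G → ℂ)) := by
    rw [linearIndependent_iff']
    intro s c hc i hi
    have h1 : charPair (fun x => ∑ j ∈ s, c j * (j : G → ℂ) x) i.1 = 0 := by
      have : (fun x => ∑ j ∈ s, c j * (j : G → ℂ) x) = 0 := by
        rw [← hc]; ext x; simp
      rw [this]; simp [charPair]
    rw [charPair_sum_left] at h1
    rw [← h1]
    rw [Finset.sum_eq_single i]
    · rw [charPair_irr i.2 i.2, if_pos rfl, mul_one]
    · intro j _ hj
      rw [charPair_irr j.2 i.2, if_neg, mul_zero]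
      exact fun h => hj (Subtype.ext h)
    · exact fun h => (h hi).elim
  have := hli.finite
  exact Set.toFinite _

/-- The irreducible complex characters of a finite group. -/
noncomputable def irr (G : Type*) [Group G] [Fintype G] : Finset (G → ℂ) :=
  (irrChar_finite G).toFinset

theorem mem_irr {χ : G → ℂ} : χ ∈ irr G ↔ IsIrrChar χ := by simp [irr]

theorem schur {G : Type*} [Group G] (ρ : Representation ℂ G V) (h : ρ.IsIrreducible)
    (f : End ℂ V) (hf : ∀ g, f * ρ g = ρ g * f) : ∃ c : ℂ, f = c • 1 := by
  obtain ⟨c, hc⟩ := (IsIrreducible.algebraMap_intertwiningMap_bijective_of_isAlgClosed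
    (ρ := ρ)).surjective ⟨f, fun g => hf g⟩
  refine ⟨c, ?_⟩
  have := congrArg IntertwiningMap.toLinearMap hc
  have h2 : f = ((algebraMap ℂ (ρ.IntertwiningMap ρ)) c).toLinearMap := this.symm
  rw [h2, Algebra.algebraMap_eq_smul_one]
  rfl

theorem sum_classFun_comm (ρ : Representation ℂ G V) {a : G → ℂ} (ha : IsClassFun a) (g : G) :
    (∑ x, a x • ρ x) * ρ g = ρ g * ∑ x, a x • ρ x := by
  rw [Finset.sum_mul, Finset.mul_sum]
  rw [← Equiv.sum_comp (MulAut.conj g).toEquiv]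
  refine Finset.sum_congr rfl fun x _ => ?_
  have : (MulAut.conj g).toEquiv x = g * x * g⁻¹ := rfl
  rw [this, ha, smul_mul_assoc, mul_smul_comm, ← map_mul, ← map_mul]
  simp

theorem sum_classFun_scalar (ρ : Representation ℂ G V) (h : ρ.IsIrreducible)
    {a : G → ℂ} (ha : IsClassFun a) :
    ∃ c : ℂ, ∑ x, a x • ρ x = c • 1 ∧ c * finrank ℂ V = ∑ x, a x * ρ.character x := by
  obtain ⟨c, hc⟩ := schur ρ h _ (sum_classFun_comm ρ ha)
  refine ⟨c, hc, ?_⟩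
  have := congrArg (LinearMap.trace ℂ V) hc
  rw [map_sum, map_smul, LinearMap.trace_one] at this
  simpa [character] using this.symm

/-- Central elements of the group algebra act on irreducible characters by scalars. -/
theorem irr_central_mul {χ : G → ℂ} (hχ : IsIrrChar χ) {a : G → ℂ} (ha : IsClassFun a) (h : G) :
    χ 1 * ∑ g, a g * χ (g * h) = (∑ g, a g * χ g) * χ h := by
  obtain ⟨n, ρ, hρ, rfl⟩ := hχ
  obtain ⟨c, h1, h2⟩ := sum_classFun_scalar ρ hρ ha
  have h3 : ∑ g, a g * ρ.character (g * h) = c * ρ.character h := by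
    have := congrArg (fun f => LinearMap.trace ℂ _ (f * ρ h)) h1
    simpa [character, Finset.sum_mul, map_sum] using this
  rw [h3, ← h2, char_one]; ring

theorem finrank_pos_of_irr {G : Type*} [Group G] (ρ : Representation ℂ G V)
    (h : ρ.IsIrreducible) : 0 < finrank ℂ V := by
  have := ((isIrreducible_iff_submodule ρ).mp h).1
  exact finrank_pos

theorem irr_one_pos {G : Type*} [Group G] {χ : G → ℂ} (hχ : IsIrrChar χ) :
    ∃ n : ℕ, 0 < n ∧ χ 1 = n := by
  obtain ⟨n, ρ, hρ, rfl⟩ := hχ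
  exact ⟨_, finrank_pos_of_irr ρ hρ, char_one ρ⟩

theorem irr_one_ne_zero {G : Type*} [Group G] {χ : G → ℂ} (hχ : IsIrrChar χ) : χ 1 ≠ 0 := by
  obtain ⟨n, hn, h⟩ := irr_one_pos hχ
  rw [h]; exact_mod_cast hn.ne'

/-- Complete reducibility as an induction principle for vanishing operators. -/
theorem sum_smul_eq_zero_of_irr {G : Type*} [Group G] [Fintype G] (a : G → ℂ)
    (hirr : ∀ (n : ℕ) (ρ : Representation ℂ G (Fin n → ℂ)), ρ.IsIrreducible →
      ∑ x, a x • ρ x = 0) (n : ℕ) :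
    ∀ ρ : Representation ℂ G (Fin n → ℂ), ∑ x, a x • ρ x = 0 := by
  induction n using Nat.strong_induction_on with
  | _ n ih =>
  intro ρ
  by_cases hρ : ρ.IsIrreducible
  · exact hirr n ρ hρ
  rw [isIrreducible_iff_submodule] at hρ
  rcases subsingleton_or_nontrivial (Fin n → ℂ) with hs | hn
  · exact Subsingleton.elim _ _
  simp only [hn, true_and, not_forall, not_or] at hρ
  obtain ⟨W, hW, hWb, hWt⟩ := hρ
  have := NeZero.mk (cardC_ne_zero G)
  obtain ⟨U, hU⟩ := exists_isCompl (⟨W, fun g v hv => hW g v hv⟩ : Subrepresentation ρ)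
  have hsup : W ⊔ U.toSubmodule = ⊤ := congrArg Subrepresentation.toSubmodule hU.sup_eq_top
  have hinf : W ⊓ U.toSubmodule = ⊥ := congrArg Subrepresentation.toSubmodule hU.inf_eq_bot
  have hUt : U.toSubmodule ≠ ⊤ := fun h => hWb (by rwa [h, inf_top_eq] at hinf)
  have main : ∀ S : Subrepresentation ρ, S.toSubmodule ≠ ⊤ → ∀ v ∈ S.toSubmodule,
      (∑ x, a x • ρ x) v = 0 := by
    intro S hS v hv
    have hlt : finrank ℂ S.toSubmodule < n := by
      have := Submodule.finrank_lt hS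
      simpa using this
    have e := (finBasis ℂ S.toSubmodule).equivFun
    have h1 := ih _ hlt (repConj S.toRepresentation e)
    have h2 := congrArg (fun f => e.symm (f (e ⟨v, hv⟩))) h1
    simp only [LinearMap.sum_apply, LinearMap.smul_apply, map_sum, map_smul,
      LinearMap.zero_apply, map_zero] at h2
    have h3 : ∀ x, e.symm ((repConj S.toRepresentation e) x (e ⟨v, hv⟩)) =
        ⟨ρ x v, S.apply_mem_toSubmodule x hv⟩ := fun x => by
      simp [repConj, LinearEquiv.conj_apply]; rfl
    simp only [h3] at h2
    have h4 := congrArg Subtype.val h2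
    simpa using h4
  refine LinearMap.ext fun v => ?_
  have hv : v ∈ W ⊔ U.toSubmodule := by rw [hsup]; trivial
  obtain ⟨w, hw, u, hu, rfl⟩ := Submodule.mem_sup.mp hv
  rw [map_add, main ⟨W, fun g v hv => hW g v hv⟩ hWt w hw, main U hUt u hu]
  simp

theorem classFun_eq_zero {f : G → ℂ} (hf : IsClassFun f)
    (h : ∀ χ ∈ irr G, charPair f χ = 0) : f = 0 := by
  have ha : IsClassFun fun x => f x⁻¹ := fun g x => by
    change f _ = f _
    rw [← hf g x⁻¹]; congr 1; group
  have hirr : ∀ (n : ℕ) (ρ : Representation ℂ G (Fin n → ℂ)), ρ.IsIrreducible →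
      ∑ x, f x⁻¹ • ρ x = 0 := by
    intro n ρ hρ
    obtain ⟨c, h1, h2⟩ := sum_classFun_scalar ρ hρ ha
    have h3 := h _ (mem_irr.mpr (isIrrChar_character ρ hρ))
    rw [charPair_comm] at h3
    simp only [charPair, mul_eq_zero, inv_eq_zero, cardC_ne_zero, false_or] at h3
    have h4 : ∑ x, f x⁻¹ * ρ.character x = 0 := by rw [← h3]; simp only [mul_comm]
    rw [h4] at h2
    have h5 : (finrank ℂ (Fin n → ℂ) : ℂ) ≠ 0 := by
      exact_mod_cast (finrank_pos_of_irr ρ hρ).ne'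
    rw [h1, (mul_eq_zero.mp h2).resolve_right h5, zero_smul]
  have hreg := sum_smul_eq_zero_of_irr _ hirr _
    (repConj (ofMulAction ℂ G G) (finBasis ℂ (MonoidAlgebra ℂ G)).equivFun)
  ext y
  have h2 := congrArg (fun F => (finBasis ℂ (MonoidAlgebra ℂ G)).equivFun.symm
    (F ((finBasis ℂ (MonoidAlgebra ℂ G)).equivFun (MonoidAlgebra.single 1 1)))) hreg
  simp only [LinearMap.sum_apply, LinearMap.smul_apply, map_sum, map_smul,
    LinearMap.zero_apply, map_zero, repConj, MonoidHom.coe_mk, OneHom.coe_mk,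
    LinearEquiv.conj_apply, LinearMap.comp_apply, LinearEquiv.coe_coe,
    LinearEquiv.symm_apply_apply] at h2
  have h3 := congrArg (fun F : MonoidAlgebra ℂ G => F.coeff y⁻¹) h2
  simp only [ofMulAction_single, smul_eq_mul, mul_one, MonoidAlgebra.coeff_sum,
    Finsupp.coe_finsetSum, Finset.sum_apply] at h3
  rw [Finset.sum_eq_single y⁻¹] at h3
  · simpa using h3
  · intro b _ hb
    simp [hb]
  · simp

theorem classFun_expand {f : G → ℂ} (hf : IsClassFun f) (x : G) :
    f x = ∑ χ ∈ irr G, charPair f χ * χ x := by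
  classical
  have h0 : (fun x => f x - ∑ χ ∈ irr G, charPair f χ * χ x) = 0 := by
    apply classFun_eq_zero
    · intro g x
      simp only
      rw [hf]
      congr 1
      refine Finset.sum_congr rfl fun χ hχ => ?_
      rw [(mem_irr.mp hχ).isClassFun]
    · intro χ hχ
      have h1 := charPair_sum_left (irr G) (fun ψ => charPair f ψ) (fun ψ => ψ) χ
      have h2 : charPair (fun x => f x - ∑ ψ ∈ irr G, charPair f ψ * ψ x) χ =
          charPair f χ - charPair (fun x => ∑ ψ ∈ irr G, charPair f ψ * ψ x) χ := by
        simp only [charPair, sub_mul, Finset.sum_sub_distrib, mul_sub]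
      rw [h2, h1, Finset.sum_eq_single χ]
      · rw [charPair_irr (mem_irr.mp hχ) (mem_irr.mp hχ)]; simp
      · intro ψ hψ hne
        rw [charPair_irr (mem_irr.mp hψ) (mem_irr.mp hχ), if_neg hne, mul_zero]
      · exact fun h => (h hχ).elim
  have := congrFun h0 x
  exact sub_eq_zero.mp this

theorem parseval {f : G → ℂ} (hf : IsClassFun f) (h : G → ℂ) :
    charPair f h = ∑ χ ∈ irr G, charPair f χ * charPair h χ := by
  have h1 : f = fun x => ∑ χ ∈ irr G, charPair f χ * χ x := funext (classFun_expand hf)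
  conv_lhs => rw [h1]
  rw [charPair_sum_left]
  exact Finset.sum_congr rfl fun χ _ => by rw [charPair_comm χ h]

end characters

section integrality
open Representation Module
open scoped Classical

variable {G : Type*} [Group G]
variable {V : Type*} [AddCommGroup V] [Module ℂ V]

/-- The action of the integral group ring on a complex representation. -/
noncomputable def zact (ρ : Representation ℂ G V) : MonoidAlgebra ℤ G →ₐ[ℤ] End ℂ V :=
  MonoidAlgebra.lift ℤ (End ℂ V) G ρ

theorem zact_of (ρ : Representation ℂ G V) (g : G) : zact ρ (MonoidAlgebra.of ℤ G g) = ρ g := by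
  simp [zact]

theorem isIntegral_zact [Finite G] (ρ : Representation ℂ G V) (x : MonoidAlgebra ℤ G) :
    IsIntegral ℤ (zact ρ x) := (IsIntegral.of_finite ℤ x).map _

theorem isIntegral_of_eigenvalue [FiniteDimensional ℂ V] {X : End ℂ V} (hX : IsIntegral ℤ X)
    {μ : ℂ} {v : V} (hv : v ≠ 0) (h : X v = μ • v) : IsIntegral ℤ μ := by
  obtain ⟨p, hp, hpx⟩ := hX
  refine ⟨p, hp, ?_⟩
  have h1 : X.HasEigenvector μ v := ⟨Module.End.mem_eigenspace_iff.mpr h, hv⟩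
  have h2 := Module.End.aeval_apply_of_hasEigenvector (p := p.map (Int.castRingHom ℂ)) h1
  have h3 : Polynomial.aeval X (p.map (Int.castRingHom ℂ)) = 0 := by
    rw [← hpx, Polynomial.aeval_def, Polynomial.eval₂_map]
    congr 1
    exact RingHom.ext_int _ _
  rw [h3, LinearMap.zero_apply] at h2
  have h4 := (smul_eq_zero.mp h2.symm).resolve_right hv
  rw [Polynomial.eval_map] at h4
  rw [← h4]; congr 1

theorem exists_int_of_isIntegral {c : ℂ} (hc : IsIntegral ℤ c) {n : ℕ} (hn : n ≠ 0) {m : ℤ}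
    (h : c * n = m) : ∃ k : ℤ, c = k := by
  have hn' : (n : ℂ) ≠ 0 := by exact_mod_cast hn
  have h1 : c = algebraMap ℚ ℂ (m / n) := by
    rw [map_div₀, map_intCast, map_natCast, eq_div_iff hn', h]
  rw [h1, isIntegral_algebraMap_iff (algebraMap ℚ ℂ).injective,
    IsIntegrallyClosed.isIntegral_iff] at hc
  obtain ⟨k, hk⟩ := hc
  refine ⟨k, ?_⟩
  rw [h1, ← hk]; simp

theorem not_isIntegral_half {c : ℤ} (hc : Odd c) (μ : ℂ) (h : 2 * μ = c) : ¬ IsIntegral ℤ μ := by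
  intro hμ
  obtain ⟨k, hk⟩ := exists_int_of_isIntegral hμ two_ne_zero (m := c)
    (by rw [mul_comm]; exact_mod_cast h)
  rw [hk] at h
  have h2 : 2 * k = c := by exact_mod_cast h
  rw [← h2] at hc
  exact (Int.not_odd_iff_even.mpr (even_two_mul k)) hc

theorem isUnit_odd_add_two_mul [FiniteDimensional ℂ V] {X : End ℂ V} (hX : IsIntegral ℤ X)
    {c : ℤ} (hc : Odd c) : IsUnit ((c : ℂ) • (1 : End ℂ V) + (2 : ℂ) • X) := by
  rw [LinearMap.isUnit_iff_ker_eq_bot, LinearMap.ker_eq_bot']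
  intro v hv
  by_contra hne
  have h1 : X v = (-(c : ℂ) / 2) • v := by
    have h2 : (c : ℂ) • v + (2 : ℂ) • X v = 0 := by simpa using hv
    have h3 : (2 : ℂ) • X v = -((c : ℂ) • v) := eq_neg_of_add_eq_zero_right h2
    rw [div_eq_inv_mul, mul_smul, neg_smul, ← h3, smul_smul]
    norm_num
  refine not_isIntegral_half (c := -c) hc.neg _ ?_ (isIntegral_of_eigenvalue hX hne h1)
  push_cast; ring

variable [Fintype G] [FiniteDimensional ℂ V]

theorem sum_character_mem_subgroup (ρ : Representation ℂ G V) (H : Subgroup G) :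
    ∑ g with g ∈ H, ρ.character g =
      Nat.card H * finrank ℂ (invariants (ρ.comp H.subtype)) := by
  have h := card_inv_sum_character (G := H) (ρ.comp H.subtype)
  rw [inv_mul_eq_iff_eq_mul₀ (cardC_ne_zero H)] at h
  rw [← h]
  exact Finset.sum_subtype _ (by simp) _

theorem sum_zpowers_class_int (ρ : Representation ℂ G V) (N : ℕ) :
    ∀ g : G, orderOf g ≤ N → ∃ n : ℤ,
      ∑ h with Subgroup.zpowers h = Subgroup.zpowers g, ρ.character h = n := by
  induction N with
  | zero => intro g hg; exact absurd (orderOf_pos g) (by omega)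
  | succ N ih =>
    intro g hg
    have h1 := sum_character_mem_subgroup ρ (Subgroup.zpowers g)
    rw [← Finset.sum_filter_add_sum_filter_not _
      (fun h => Subgroup.zpowers h = Subgroup.zpowers g)] at h1
    have h2 : (Finset.univ.filter (fun h => h ∈ Subgroup.zpowers g)).filter
        (fun h => Subgroup.zpowers h = Subgroup.zpowers g) =
        Finset.univ.filter (fun h => Subgroup.zpowers h = Subgroup.zpowers g) := by
      ext h
      simp only [Finset.mem_filter, Finset.mem_univ, true_and, and_iff_right_iff_imp]
      intro hh; rw [← hh]; exact Subgroup.mem_zpowers h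
    rw [h2] at h1
    set S := (Finset.univ.filter (fun h => h ∈ Subgroup.zpowers g)).filter
        (fun h => ¬ Subgroup.zpowers h = Subgroup.zpowers g) with hS
    have h3 : ∃ n : ℤ, ∑ h ∈ S, ρ.character h = n := by
      rw [← Finset.sum_fiberwise_of_maps_to (g := Subgroup.zpowers)
        (t := S.image Subgroup.zpowers) (fun i hi => Finset.mem_image_of_mem _ hi)]
      have : ∀ K ∈ S.image Subgroup.zpowers, ∃ n : ℤ,
          ∑ h ∈ S with Subgroup.zpowers h = K, ρ.character h = n := by
        intro K hK
        obtain ⟨x, hx, rfl⟩ := Finset.mem_image.mp hK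
        have hx' : x ∈ Subgroup.zpowers g ∧ Subgroup.zpowers x ≠ Subgroup.zpowers g := by
          simpa [hS] using hx
        have hle : Subgroup.zpowers x ≤ Subgroup.zpowers g := by
          rw [Subgroup.zpowers_le]; exact hx'.1
        have hlt : orderOf x < orderOf g := by
          by_contra hge
          exact hx'.2 (Subgroup.eq_of_le_of_card_ge hle (by
            rw [Nat.card_zpowers, Nat.card_zpowers]; omega))
        obtain ⟨n, hn⟩ := ih x (by omega)
        refine ⟨n, ?_⟩
        rw [← hn]
        refine Finset.sum_congr ?_ fun _ _ => rfl
        ext h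
        simp only [hS, Finset.mem_filter, Finset.mem_univ, true_and, and_iff_right_iff_imp]
        intro hh
        refine ⟨hle ?_, by rw [hh]; exact hx'.2⟩
        rw [← hh]; exact Subgroup.mem_zpowers h
      choose! n hn using this
      exact ⟨∑ K ∈ S.image Subgroup.zpowers, n K, by
        rw [Int.cast_sum]; exact Finset.sum_congr rfl hn⟩
    obtain ⟨n, hn⟩ := h3
    rw [hn] at h1
    exact ⟨(Nat.card (Subgroup.zpowers g) *
      finrank ℂ (invariants (ρ.comp (Subgroup.zpowers g).subtype)) : ℕ) - n, by
      push_cast; exact eq_sub_of_add_eq h1⟩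

/-- Sums of characters over unions of rational classes are integers. -/
theorem sum_character_int (ρ : Representation ℂ G V) (S : Finset G)
    (hS : ∀ g ∈ S, ∀ h, Subgroup.zpowers h = Subgroup.zpowers g → h ∈ S) :
    ∃ n : ℤ, ∑ g ∈ S, ρ.character g = n := by
  rw [← Finset.sum_fiberwise_of_maps_to (g := Subgroup.zpowers)
    (t := S.image Subgroup.zpowers) (fun i hi => Finset.mem_image_of_mem _ hi)]
  have : ∀ K ∈ S.image Subgroup.zpowers, ∃ n : ℤ,
      ∑ h ∈ S with Subgroup.zpowers h = K, ρ.character h = n := by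
    intro K hK
    obtain ⟨x, hx, rfl⟩ := Finset.mem_image.mp hK
    obtain ⟨n, hn⟩ := sum_zpowers_class_int ρ _ x le_rfl
    refine ⟨n, ?_⟩
    rw [← hn]
    refine Finset.sum_congr ?_ fun _ _ => rfl
    ext h
    simp only [Finset.mem_filter, Finset.mem_univ, true_and, and_iff_right_iff_imp]
    exact hS x hx h
  choose! n hn using this
  exact ⟨∑ K ∈ S.image Subgroup.zpowers, n K, by
    rw [Int.cast_sum]; exact Finset.sum_congr rfl hn⟩

theorem orderOf_eq_of_zpowers_eq {g h : G} (hgh : Subgroup.zpowers h = Subgroup.zpowers g) :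
    orderOf h = orderOf g := by
  rw [← Nat.card_zpowers, hgh, Nat.card_zpowers]

theorem character_int_of_involution (ρ : Representation ℂ G V) {t : G} (ht : t * t = 1) :
    ∃ n : ℤ, ρ.character t = n := by
  obtain ⟨n, hn⟩ := sum_character_int ρ {t} (by
    intro g hg h hh
    rw [Finset.mem_singleton] at hg ⊢
    subst hg
    have h1 : h ∈ Subgroup.zpowers g := by rw [← hh]; exact Subgroup.mem_zpowers h
    obtain ⟨k, rfl⟩ := h1
    rcases Int.even_or_odd' k with ⟨m, rfl | rfl⟩
    · have : g ^ (2 * m) = 1 := by rw [zpow_mul, zpow_two, ht, one_zpow]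
      simp only [this, Subgroup.zpowers_one_eq_bot] at hh ⊢
      rw [eq_comm, Subgroup.zpowers_eq_bot] at hh
      exact hh.symm
    · change g ^ (2 * m + 1) = g
      rw [zpow_add, zpow_mul, zpow_two, ht, one_zpow, one_mul, zpow_one])
  exact ⟨n, by simpa using hn⟩

theorem sum_sub_sum_fixed_mem {M α : Type*} [AddCommGroup M] (N : AddSubgroup M) (S : Finset α)
    (f : α → M) (σ : α → α) (hS : ∀ x ∈ S, σ x ∈ S) (hσ : ∀ x ∈ S, σ (σ x) = x)
    (h : ∀ x ∈ S, σ x ≠ x → f x + f (σ x) ∈ N) :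
    ∑ x ∈ S, f x - ∑ x ∈ S with σ x = x, f x ∈ N := by
  rw [← Finset.sum_filter_add_sum_filter_not S (fun x => σ x = x) f, add_sub_cancel_left,
    ← QuotientAddGroup.eq_zero_iff]
  change QuotientAddGroup.mk' N _ = 0
  rw [map_sum]
  refine Finset.sum_involution (fun x _ => σ x) ?_ ?_ ?_ ?_
  · intro x hx
    rw [Finset.mem_filter] at hx
    rw [← map_add]
    exact (QuotientAddGroup.eq_zero_iff _).mpr (h x hx.1 hx.2)
  · intro x hx _
    exact (Finset.mem_filter.mp hx).2
  · intro x hx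
    rw [Finset.mem_filter] at hx ⊢
    refine ⟨hS x hx.1, fun h1 => hx.2 ?_⟩
    rw [hσ x hx.1] at h1
    exact h1.symm
  · intro x hx
    exact hσ x (Finset.mem_filter.mp hx).1

/-- The elements of odd order. -/
noncomputable def oddElts (G : Type*) [Group G] [Fintype G] : Finset G :=
  Finset.univ.filter fun g => Odd (orderOf g)

theorem mem_oddElts {g : G} : g ∈ oddElts G ↔ Odd (orderOf g) := by simp [oddElts]

theorem sum_oddElts_int (ρ : Representation ℂ G V) :
    ∃ n : ℤ, ∑ g ∈ oddElts G, ρ.character g = n :=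
  sum_character_int ρ _ fun g hg h hh => by
    rw [mem_oddElts] at hg ⊢
    rwa [orderOf_eq_of_zpowers_eq hh]

theorem card_oddElts_odd : Odd (oddElts G).card := by
  have h1 := sum_sub_sum_fixed_mem (AddSubgroup.zmultiples (2 : ℤ)) (oddElts G) (fun _ => 1)
    (fun g : G => g⁻¹) (fun g hg => by rw [mem_oddElts] at hg ⊢; rwa [orderOf_inv])
    (fun g _ => inv_inv g) (fun g _ _ => ⟨1, by norm_num⟩)
  have h2 : (oddElts G).filter (fun g => g⁻¹ = g) = {1} := by
    ext g
    simp only [Finset.mem_filter, mem_oddElts, Finset.mem_singleton]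
    constructor
    · rintro ⟨h3, h4⟩
      have h5 : orderOf g ∣ 2 := orderOf_dvd_of_pow_eq_one (by
        rw [pow_two]; nth_rewrite 1 [← h4]; simp)
      exact orderOf_eq_one_iff.mp (Nat.eq_one_of_dvd_coprimes
        ((Nat.coprime_two_left).mpr h3) h5 dvd_rfl)
    · rintro rfl; simp
  rw [h2] at h1
  simp only [Finset.sum_const, Finset.card_singleton, Int.mem_zmultiples_iff, nsmul_eq_mul] at h1
  rw [Nat.odd_iff]
  push_cast at h1
  omega

/-- The sum of the elements of odd order in the integral group ring. -/
noncomputable def oddSum (G : Type*) [Group G] [Fintype G] : MonoidAlgebra ℤ G :=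
  ∑ g ∈ oddElts G, MonoidAlgebra.of ℤ G g

theorem zact_oddSum (ρ : Representation ℂ G V) : zact ρ (oddSum G) = ∑ g ∈ oddElts G, ρ g := by
  simp [oddSum, zact_of, map_sum, -MonoidAlgebra.of_apply]

theorem sum_oddElts_scalar (ρ : Representation ℂ G V) (h : ρ.IsIrreducible) :
    ∃ c : ℤ, ∑ g ∈ oddElts G, ρ g = (c : ℂ) • 1 ∧
      (c : ℂ) * finrank ℂ V = ∑ g ∈ oddElts G, ρ.character g := by
  have ha : IsClassFun fun g : G => if g ∈ oddElts G then (1 : ℂ) else 0 := by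
    intro g x
    simp only [mem_oddElts]
    rw [show orderOf (g * x * g⁻¹) = orderOf x from
      orderOf_injective (MulAut.conj g).toMonoidHom (MulAut.conj g).injective x]
  obtain ⟨c, h1, h2⟩ := sum_classFun_scalar ρ h ha
  simp only [ite_smul, one_smul, zero_smul, ite_mul, one_mul, zero_mul, Finset.sum_ite_mem,
    Finset.univ_inter] at h1 h2
  have hV := ((isIrreducible_iff_submodule ρ).mp h).1
  obtain ⟨v, hv⟩ := exists_ne (0 : V)
  have hisInt : IsIntegral ℤ c := by
    refine isIntegral_of_eigenvalue (isIntegral_zact ρ (oddSum G)) hv ?_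
    rw [zact_oddSum, h1]; simp
  obtain ⟨n, hn⟩ := sum_oddElts_int ρ
  obtain ⟨k, hk⟩ := exists_int_of_isIntegral hisInt (finrank_pos_of_irr ρ h).ne'
    (h2.trans hn)
  exact ⟨k, by rw [h1, hk], by rw [← h2, hk]⟩

end integrality

section cosetAverages
open Representation Module
open scoped Classical

variable {V : Type*} [AddCommGroup V] [Module ℂ V]

theorem trace_eq_of_intertwine {A B U : End ℂ V} (hU : IsUnit U) (h : A * U = U * B) :
    LinearMap.trace ℂ V A = LinearMap.trace ℂ V B := by
  obtain ⟨u, rfl⟩ := hU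
  have h1 : A = u * B * ↑u⁻¹ := by rw [← h, mul_assoc, Units.mul_inv, mul_one]
  rw [h1, LinearMap.trace_mul_comm, ← mul_assoc, Units.inv_mul, one_mul]

/-- Trace vanishing from a splitting `R + Y R Y⁻¹ = c f`. -/
theorem trace_zero_of_odd_split {c : ℂ} (hc : c ≠ 0) {Y R f K p : End ℂ V}
    (hp : (2 : ℂ) • p = 1 + Y * Y) (hY : Y * Y * Y * Y = 1) (hYf : Y * f = f * Y)
    (hRY : Y * Y * R = R * (Y * Y)) (hRf : R * f = R)
    (hsplit : R + Y * R * (Y * Y * Y) = c • f)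
    (hKY : K * Y = Y * K) (hKR : K * R = R * K)
    (hU : IsUnit ((c ^ 2) • (1 : End ℂ V) +
      (2 : ℂ) • (-(c • R) + R * (1 + Y) * R * (1 - Y)))) :
    LinearMap.trace ℂ V (p * (f * (Y * K))) = 0 := by
  have two : (2 : ℂ) ≠ 0 := two_ne_zero
  have hp' : p = (2 : ℂ)⁻¹ • (1 + Y * Y) := by rw [← hp, smul_smul]; norm_num
  have comm_p : ∀ X : End ℂ V, Y * Y * X = X * (Y * Y) → X * p = p * X := by
    intro X hX
    rw [hp', smul_mul_assoc, mul_smul_comm, add_mul, mul_add, one_mul, mul_one, hX]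
  have ext : ∀ {A B C : End ℂ V}, A * B = C → ∀ X, A * (B * X) = C * X := by
    intro A B C h X; rw [← mul_assoc, h]
  have pY := comm_p Y (by simp only [mul_assoc])
  have pR := comm_p R hRY
  have pK := comm_p K (by rw [mul_assoc, ← hKY, ← mul_assoc, ← hKY, mul_assoc])
  have pf := comm_p f (by rw [mul_assoc, hYf, ← mul_assoc, hYf, mul_assoc])
  have pYY : p * (Y * Y) = p := by
    rw [hp', smul_mul_assoc, add_mul, one_mul, ← mul_assoc, hY, add_comm]
  have pp : p * p = p := by
    nth_rewrite 2 [hp']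
    rw [mul_smul_comm, mul_add, mul_one, pYY, ← two_smul ℂ p, smul_smul]; norm_num
  have pY' := ext pY
  have pR' := ext pR
  have pK' := ext pK
  have pf' := ext pf
  have pp' := ext pp
  simp only [mul_assoc] at pY' pR' pK' pf'
  obtain ⟨Z, hZ⟩ : ∃ Z, Z = p * Y := ⟨_, rfl⟩
  obtain ⟨S, hS⟩ : ∃ S, S = p * R := ⟨_, rfl⟩
  obtain ⟨f₁, hf₁⟩ : ∃ S, S = p * f := ⟨_, rfl⟩
  have ZZ : Z * Z = p := by simp only [hZ, mul_assoc, pY', pYY, pp]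
  have pS : p * S = S := by simp only [hS, pp']
  have Sp : S * p = S := by simp only [hS, mul_assoc, pR, pp']
  have pZ : p * Z = Z := by simp only [hZ, pp']
  have Zp : Z * p = Z := by simp only [hZ, mul_assoc, pY, pp']
  have Zf : Z * f₁ = f₁ * Z := by simp only [hZ, hf₁, mul_assoc, pY', pf', pp', hYf]
  have Sf : S * f₁ = S := by simp only [hS, hf₁, mul_assoc, pR', pp', hRf]
  have fp : f₁ * p = f₁ := by simp only [hf₁, mul_assoc, pf, pp']
  have ZSZ' : Z * S * Z = c • f₁ - S := by
    refine eq_sub_of_add_eq' ?_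
    have e : Z * S * Z = p * (Y * R * (Y * Y * Y)) := by
      have : p * (Y * R * (Y * Y * Y)) = p * (Y * Y) * (Y * R * Y) := by
        have h1 : Y * R * (Y * Y * Y) = Y * (R * (Y * Y)) * Y := by simp only [mul_assoc]
        rw [h1, ← hRY]
        simp only [mul_assoc]
      rw [this, pYY]
      simp only [hZ, hS, mul_assoc, pY', pR', pp']
    rw [e, hS, ← mul_add, hsplit, mul_smul_comm, hf₁]
  have ZS : Z * S = c • (f₁ * Z) - S * Z := by
    have h1 : Z * S = Z * S * Z * Z := by rw [mul_assoc (Z * S), ZZ, mul_assoc, Sp]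
    rw [h1, ZSZ', sub_mul, smul_mul_assoc]
  have SZS : S * (Z * S) = c • (S * Z) - S * (S * Z) := by
    rw [ZS, mul_sub, mul_smul_comm, ← mul_assoc, Sf]
  have SZS' := ext SZS
  have pS' := ext pS
  obtain ⟨U, hUdef⟩ : ∃ U, U = (c ^ 2) • (1 : End ℂ V) +
      (2 : ℂ) • (-(c • R) + R * (1 + Y) * R * (1 - Y)) := ⟨_, rfl⟩
  rw [← hUdef] at hU
  have pU : p * U = c ^ 2 • p + (2 : ℂ) • (-(c • S) + (S + S * Z) * (S - S * Z)) := by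
    simp only [hUdef, hS, hZ, mul_add, add_mul, mul_sub, mul_smul_comm,
      mul_assoc, mul_one, mul_neg, pY', pR', pp']
  have Up : U * p = p * U := by
    simp only [hUdef, mul_add, add_mul, mul_sub, sub_mul, smul_mul_assoc, mul_smul_comm,
      mul_assoc, mul_one, one_mul, mul_neg, neg_mul, pY, pR, pY', pR']
  have KY' := ext hKY
  have KR' := ext hKR
  simp only [mul_assoc] at KY' KR' SZS'
  have key : (S + S * Z) * (p * U) = (p * U) * (S - S * Z) := by
    rw [pU]
    simp only [mul_add, add_mul, mul_sub, sub_mul, smul_mul_assoc, mul_smul_comm,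
      mul_assoc, mul_neg, neg_mul, ZZ, pS, Sp, Zp, pS', SZS, SZS',
      smul_sub, smul_add, smul_neg, smul_smul]
    module
  have KU : K * U = U * K := by
    simp only [hUdef, mul_add, add_mul, mul_sub, sub_mul, smul_mul_assoc, mul_smul_comm,
      mul_assoc, mul_one, one_mul, mul_neg, neg_mul, hKY, hKR, KY', KR']
  have tr1 : LinearMap.trace ℂ V ((S + S * Z) * K) = LinearMap.trace ℂ V ((S - S * Z) * K) := by
    refine trace_eq_of_intertwine hU ?_
    have e1 : (S + S * Z) * K * U = (S + S * Z) * (p * U) * K := by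
      have e2 : (S + S * Z) * p = S + S * Z := by rw [add_mul, mul_assoc S Z p, Sp, Zp]
      rw [← mul_assoc _ p, e2, mul_assoc, KU, ← mul_assoc]
    rw [e1, key, ← Up, mul_assoc U, mul_sub, pS, ← mul_assoc p, pS, mul_assoc]
  have tr2 : LinearMap.trace ℂ V (S * Z * K) = 0 := by
    rw [add_mul, sub_mul, map_add, map_sub] at tr1
    linear_combination tr1 / 2
  have e5 : p * (f * (Y * K)) = c⁻¹ • (S * Z * K + Z * S * K) := by
    rw [ZS, sub_mul, add_sub_cancel, smul_mul_assoc, smul_smul, inv_mul_cancel₀ hc, one_smul]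
    simp only [hf₁, hZ, mul_assoc, pf', pp']
  have ZK : Z * K = K * Z := by simp only [hZ, mul_assoc, pK', hKY]
  rw [e5, map_smul, map_add, tr2, mul_assoc, LinearMap.trace_mul_comm, mul_assoc, ← ZK,
    ← mul_assoc, tr2]
  simp

theorem odd_orderOf_of_pow {G : Type*} [Group G] {x : G} {n : ℕ} (hn : Odd n) (h : x ^ n = 1) :
    Odd (orderOf x) := hn.of_dvd_nat (orderOf_dvd_of_pow_eq_one h)

theorem exists_mul_pow_eq {G : Type*} [Group G] {O : Subgroup G} {r o : G} (ho : o ∈ O)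
    (hr : ∀ k ∈ O, r * k * r⁻¹ ∈ O) (n : ℕ) : ∃ o' ∈ O, (o * r) ^ n = o' * r ^ n := by
  induction n with
  | zero => exact ⟨1, O.one_mem, by simp⟩
  | succ n ih =>
    obtain ⟨o', h1, h2⟩ := ih
    refine ⟨o * (r * o' * r⁻¹), O.mul_mem ho (hr _ h1), ?_⟩
    rw [pow_succ', h2, pow_succ']
    group

theorem odd_orderOf_mul {G : Type*} [Group G] [Finite G] {O : Subgroup G} (hO : Odd (Nat.card O))
    {r o : G} (ho : o ∈ O) (hr : ∀ k ∈ O, r * k * r⁻¹ ∈ O) (hodd : Odd (orderOf r)) :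
    Odd (orderOf (o * r)) := by
  obtain ⟨o', h1, h2⟩ := exists_mul_pow_eq ho hr (orderOf r)
  refine odd_orderOf_of_pow (n := orderOf r * Nat.card O) (hodd.mul hO) ?_
  rw [pow_mul, h2, pow_orderOf_eq_one, mul_one]
  have := pow_card_eq_one' (G := O) (x := ⟨o', h1⟩)
  exact congrArg Subtype.val this

variable {G : Type*} [Group G] [Fintype G]

/-- The sum of the elements of a subgroup in the integral group ring. -/
noncomputable def subSum (O : Subgroup G) : MonoidAlgebra ℤ G := ∑ o : O, MonoidAlgebra.of ℤ G o

theorem of_mul_subSum {O : Subgroup G} {k : G} (hk : k ∈ O) :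
    MonoidAlgebra.of ℤ G k * subSum O = subSum O := by
  rw [subSum, Finset.mul_sum]
  refine Fintype.sum_equiv (Equiv.mulLeft (⟨k, hk⟩ : O)) _ _ fun o => ?_
  rw [← map_mul]; rfl

theorem subSum_mul_of {O : Subgroup G} {k : G} (hk : k ∈ O) :
    subSum O * MonoidAlgebra.of ℤ G k = subSum O := by
  rw [subSum, Finset.sum_mul]
  refine Fintype.sum_equiv (Equiv.mulRight (⟨k, hk⟩ : O)) _ _ fun o => ?_
  rw [← map_mul]; rfl

theorem subSum_mul_self (O : Subgroup G) :
    subSum O * subSum O = (Nat.card O : ℤ) • subSum O := by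
  nth_rewrite 1 [subSum]
  rw [Finset.sum_mul, Finset.sum_congr rfl fun (o : O) _ => of_mul_subSum o.2]
  simp

theorem subSum_comm {O : Subgroup G} {y : G} (h : ∀ k ∈ O, k * y = y * k) :
    MonoidAlgebra.of ℤ G y * subSum O = subSum O * MonoidAlgebra.of ℤ G y := by
  rw [subSum, Finset.sum_mul, Finset.mul_sum]
  exact Finset.sum_congr rfl fun o _ => by rw [← map_mul, ← map_mul, h o o.2]

/-- The sum of the elements of odd order commuting with `y`. -/
noncomputable def oddCentSum (y : G) : MonoidAlgebra ℤ G :=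
  ∑ g ∈ oddElts G with g * y = y * g, MonoidAlgebra.of ℤ G g

theorem oddCentSum_mul_of {O : Subgroup G} (hO : Odd (Nat.card O)) {y : G}
    (hOy : ∀ k ∈ O, k * y = y * k) (hOn : ∀ g, g * y = y * g → ∀ k ∈ O, g * k * g⁻¹ ∈ O)
    {k : G} (hk : k ∈ O) :
    oddCentSum y * MonoidAlgebra.of ℤ G k = oddCentSum y := by
  have aux : ∀ k ∈ O, ∀ g ∈ (oddElts G).filter (fun g => g * y = y * g),
      g * k ∈ (oddElts G).filter (fun g => g * y = y * g) := by
    intro k hk g hg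
    rw [Finset.mem_filter, mem_oddElts] at hg ⊢
    refine ⟨?_, by rw [mul_assoc, hOy k hk, ← mul_assoc, hg.2, mul_assoc]⟩
    have h1 : g * k = (g * k * g⁻¹) * g := by group
    rw [h1]
    exact odd_orderOf_mul hO (hOn g hg.2 k hk) (hOn g hg.2) hg.1
  rw [oddCentSum, Finset.sum_mul]
  refine Finset.sum_nbij' (· * k) (· * k⁻¹) (aux k hk) (aux _ (O.inv_mem hk)) ?_ ?_ ?_
  · intro g _; simp
  · intro g _; simp
  · intro g _; rw [← map_mul]

theorem exists_half_sum {y : G} (hy : y ^ 4 = 1) : ∃ P : MonoidAlgebra ℤ G,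
    MonoidAlgebra.of ℤ G (y ^ 2) * P = P * MonoidAlgebra.of ℤ G (y ^ 2) ∧
    P + MonoidAlgebra.of ℤ G y * P * MonoidAlgebra.of ℤ G (y ^ 3) = oddSum G - oddCentSum y := by
  have hyi : y ^ 3 = y⁻¹ := by rw [eq_inv_iff_mul_eq_one, ← pow_succ, hy]
  have hy22 : y ^ 2 * y ^ 2 = 1 := by rw [← pow_add, hy]
  let e := Fintype.equivFin G
  let f : G → Fin (Fintype.card G) := fun r => min (e r) (e (y ^ 2 * r * y ^ 2))
  have f2 : ∀ r, f (y ^ 2 * r * y ^ 2) = f r := by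
    intro r
    have : y ^ 2 * (y ^ 2 * r * y ^ 2) * y ^ 2 = r := by
      calc _ = (y ^ 2 * y ^ 2) * r * (y ^ 2 * y ^ 2) := by simp only [mul_assoc]
        _ = r := by rw [hy22]; simp
    simp only [f, this, min_comm]
  let S := (oddElts G).filter fun g => ¬ g * y = y * g
  have hSx : ∀ x : G, x * y = y * x → ∀ r ∈ S, x * r * x⁻¹ ∈ S := by
    intro x hx r hr
    simp only [S, Finset.mem_filter, mem_oddElts] at hr ⊢
    refine ⟨by rw [← MulAut.conj_apply, MulEquiv.orderOf_eq]; exact hr.1, fun h => hr.2 ?_⟩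
    have h1 : Commute (x * r * x⁻¹) y := h
    have h2 : Commute (x⁻¹ * (x * r * x⁻¹) * x) (x⁻¹ * y * x) := by
      have := h1.map (MulAut.conj x⁻¹).toMonoidHom
      simpa using this
    rw [mul_assoc x⁻¹ y x, ← hx, inv_mul_cancel_left] at h2
    have h3 : x⁻¹ * (x * r * x⁻¹) * x = r := by group
    rw [h3] at h2
    exact h2
  have hSc : ∀ r ∈ S, y * r * y⁻¹ ∈ S := hSx y rfl
  have hSc' : ∀ r ∈ S, y⁻¹ * r * y ∈ S := by
    intro r hr
    have := hSx y⁻¹ (by group) r hr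
    rwa [inv_inv] at this
  have hy2i : (y ^ 2)⁻¹ = y ^ 2 := inv_eq_of_mul_eq_one_right hy22
  have yy : ∀ r, y * (y * r * y⁻¹) * y⁻¹ = y ^ 2 * r * y ^ 2 := by
    intro r
    have : y ^ 2 * r * y ^ 2 = y ^ 2 * r * (y ^ 2)⁻¹ := by rw [hy2i]
    rw [this, pow_two]; group
  have ff : ∀ r, f (y * (y * r * y⁻¹) * y⁻¹) = f r := by
    intro r
    rw [yy, f2]
  have fne : ∀ r ∈ S, f (y * r * y⁻¹) ≠ f r := by
    intro r hr h
    have hr' := (Finset.mem_filter.mp hr).2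
    have h0 : y * r * y⁻¹ ≠ r := fun h1 => hr' (by
      rw [mul_inv_eq_iff_eq_mul] at h1; exact h1.symm)
    have h3 : y ^ 2 * (y * r * y⁻¹) * y ^ 2 ≠ r := fun h1 => hr' (by
      have h2 : y ^ 2 * (y * r * y⁻¹) * y ^ 2 = y ^ 3 * r * y := by
        rw [pow_succ y 2, pow_two]; group
      rw [h2, hyi, mul_assoc, inv_mul_eq_iff_eq_mul] at h1
      exact h1)
    have h4 : y * r * y⁻¹ ≠ y ^ 2 * r * y ^ 2 := fun h1 => h0 (by
      have h2 : y ^ 2 * r * y ^ 2 = y * (y * r * y ^ 3) * y⁻¹ := by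
        rw [pow_succ y 2, pow_two]; group
      rw [h2, hyi, mul_left_inj, mul_right_inj] at h1
      exact h1.symm)
    have h5 : y ^ 2 * (y * r * y⁻¹) * y ^ 2 ≠ y ^ 2 * r * y ^ 2 := fun h1 => h0
      (mul_left_cancel (mul_right_cancel h1))
    simp only [f] at h
    rcases min_choice (e (y * r * y⁻¹)) (e (y ^ 2 * (y * r * y⁻¹) * y ^ 2)) with h1 | h1 <;>
    rcases min_choice (e r) (e (y ^ 2 * r * y ^ 2)) with h2 | h2 <;>
    rw [h1, h2] at h <;> have := e.injective h <;> contradiction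
  refine ⟨∑ r ∈ S with f r < f (y * r * y⁻¹), MonoidAlgebra.of ℤ G r, ?_, ?_⟩
  · rw [Finset.mul_sum, Finset.sum_mul]
    have aux : ∀ r ∈ S.filter (fun r => f r < f (y * r * y⁻¹)),
        y ^ 2 * r * y ^ 2 ∈ S.filter (fun r => f r < f (y * r * y⁻¹)) := by
      intro r hr
      rw [Finset.mem_filter] at hr ⊢
      have h1 := (yy r).symm
      refine ⟨by rw [h1]; exact hSc _ (hSc _ hr.1), ?_⟩
      rw [h1, ff, ff]; exact hr.2
    refine Finset.sum_nbij' (fun r => y ^ 2 * r * y ^ 2) (fun r => y ^ 2 * r * y ^ 2) aux aux ?_ ?_ ?_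
    · intro r _
      calc _ = (y ^ 2 * y ^ 2) * r * (y ^ 2 * y ^ 2) := by simp only [mul_assoc]
        _ = r := by rw [hy22]; simp
    · intro r _
      calc _ = (y ^ 2 * y ^ 2) * r * (y ^ 2 * y ^ 2) := by simp only [mul_assoc]
        _ = r := by rw [hy22]; simp
    · intro r _
      rw [← map_mul, ← map_mul, mul_assoc (y ^ 2 * r), hy22, mul_one]
  · rw [eq_sub_iff_add_eq, oddSum, oddCentSum,
      ← Finset.sum_filter_add_sum_filter_not (oddElts G) (fun g => g * y = y * g), add_comm]
    congr 1
    rw [← Finset.sum_filter_add_sum_filter_not S (fun r => f r < f (y * r * y⁻¹))]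
    congr 1
    rw [Finset.mul_sum, Finset.sum_mul]
    refine Finset.sum_nbij' (fun r => y * r * y⁻¹) (fun r => y⁻¹ * r * y) ?_ ?_ ?_ ?_ ?_
    · intro r hr
      rw [Finset.mem_filter] at hr ⊢
      refine ⟨hSc _ hr.1, ?_⟩
      rw [ff, not_lt]; exact hr.2.le
    · intro r hr
      rw [Finset.mem_filter] at hr ⊢
      have h1 : y * (y⁻¹ * r * y) * y⁻¹ = r := by group
      refine ⟨hSc' _ hr.1, ?_⟩
      rw [h1, ← ff (y⁻¹ * r * y), h1]
      exact lt_of_le_of_ne (not_lt.mp hr.2) (fne r hr.1)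
    · intro r _; group
    · intro r _; group
    · intro r _; rw [← map_mul, ← map_mul, hyi]

end cosetAverages

section oddSection
open Representation Module
open scoped Classical
variable {V : Type*} [AddCommGroup V] [Module ℂ V] [FiniteDimensional ℂ V]
variable {G : Type*} [Group G] [Fintype G]

theorem exists_odd_split {y : G} (hy : y ^ 4 = 1) {O : Subgroup G}
    (hO : Odd (Nat.card O)) (hOy : ∀ k ∈ O, k * y = y * k)
    (hOn : ∀ g, g * y = y * g → ∀ k ∈ O, g * k * g⁻¹ ∈ O) :
    ∃ (M z : MonoidAlgebra ℤ G), z = (Nat.card O : ℤ) • 1 - subSum O ∧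
      z * z = (Nat.card O : ℤ) • z ∧
      MonoidAlgebra.of ℤ G (y ^ 2) * M = M * MonoidAlgebra.of ℤ G (y ^ 2) ∧
      (∀ k ∈ O, MonoidAlgebra.of ℤ G k * M = M * MonoidAlgebra.of ℤ G k) ∧
      (M + MonoidAlgebra.of ℤ G y * M * MonoidAlgebra.of ℤ G (y ^ 3)) * z =
        (∑ o : O, MonoidAlgebra.of ℤ G o * oddSum G * MonoidAlgebra.of ℤ G (o⁻¹ : G)) * z := by
  obtain ⟨P, hP1, hP2⟩ := exists_half_sum hy
  have hz : ∀ z : MonoidAlgebra ℤ G, z = (Nat.card O : ℤ) • 1 - subSum O → 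
      ∀ k ∈ O, MonoidAlgebra.of ℤ G k * z = z * MonoidAlgebra.of ℤ G k := by
    rintro z rfl k hk
    rw [mul_sub, sub_mul, of_mul_subSum hk, subSum_mul_of hk, mul_smul_comm, smul_mul_assoc,
      one_mul, mul_one]
  obtain ⟨z, hz'⟩ : ∃ z : MonoidAlgebra ℤ G, z = (Nat.card O : ℤ) • 1 - subSum O := ⟨_, rfl⟩
  replace hz := hz z hz'
  have hCz : oddCentSum y * z = 0 := by
    rw [hz', mul_sub, mul_smul_comm, mul_one, subSum, Finset.mul_sum,
      Finset.sum_congr rfl fun (o : O) _ => oddCentSum_mul_of hO hOy hOn o.2]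
    simp
  have hyO : ∀ n : ℕ, ∀ k ∈ O, k * y ^ n = y ^ n * k := fun n k hk =>
    ((show Commute k y from hOy k hk).pow_right n)
  refine ⟨∑ o : O, MonoidAlgebra.of ℤ G o * P * MonoidAlgebra.of ℤ G (o⁻¹ : G), z, hz', ?_, ?_,
    ?_, ?_⟩
  · nth_rewrite 1 [hz']
    rw [hz', sub_mul, smul_mul_assoc, one_mul, mul_sub, subSum_mul_self, mul_smul_comm, mul_one,
      sub_self, sub_zero]
  · rw [Finset.mul_sum, Finset.sum_mul]
    refine Finset.sum_congr rfl fun o _ => ?_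
    rw [← mul_assoc, ← mul_assoc, ← map_mul, ← hyO 2 o o.2, map_mul, mul_assoc _ _ P, hP1,
      mul_assoc, mul_assoc, mul_assoc, mul_assoc, ← map_mul, ← map_mul,
      hyO 2 _ (O.inv_mem o.2)]
  · intro k hk
    rw [Finset.mul_sum, Finset.sum_mul]
    refine Fintype.sum_equiv (Equiv.mulLeft (⟨k, hk⟩ : O)) _ _ fun o => ?_
    have : ((Equiv.mulLeft (⟨k, hk⟩ : O) o : O) : G) = k * o := rfl
    have h2 : MonoidAlgebra.of ℤ G (k * o)⁻¹ * MonoidAlgebra.of ℤ G k =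
        MonoidAlgebra.of ℤ G (o⁻¹ : G) := by
      rw [← map_mul]; congr 1; group
    rw [this, mul_assoc _ _ (MonoidAlgebra.of ℤ G k), h2, map_mul]
    simp only [mul_assoc]
  · have h1 : ∀ o : O, MonoidAlgebra.of ℤ G y *
        (MonoidAlgebra.of ℤ G o * P * MonoidAlgebra.of ℤ G (o⁻¹ : G)) *
        MonoidAlgebra.of ℤ G (y ^ 3) = MonoidAlgebra.of ℤ G o *
        (MonoidAlgebra.of ℤ G y * P * MonoidAlgebra.of ℤ G (y ^ 3)) *
          MonoidAlgebra.of ℤ G (o⁻¹ : G) := by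
      intro o
      have a : MonoidAlgebra.of ℤ G y * MonoidAlgebra.of ℤ G o =
          MonoidAlgebra.of ℤ G o * MonoidAlgebra.of ℤ G y := by
        rw [← map_mul, ← map_mul, hOy o o.2]
      have b : MonoidAlgebra.of ℤ G (o⁻¹ : G) * MonoidAlgebra.of ℤ G (y ^ 3) =
          MonoidAlgebra.of ℤ G (y ^ 3) * MonoidAlgebra.of ℤ G (o⁻¹ : G) := by
        rw [← map_mul, ← map_mul, hyO 3 _ (O.inv_mem o.2)]
      calc _ = (MonoidAlgebra.of ℤ G y * MonoidAlgebra.of ℤ G o) * P *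
            (MonoidAlgebra.of ℤ G (o⁻¹ : G) * MonoidAlgebra.of ℤ G (y ^ 3)) := by
            simp only [mul_assoc]
        _ = _ := by rw [a, b]; simp only [mul_assoc]
    rw [Finset.mul_sum, Finset.sum_mul, ← Finset.sum_add_distrib, Finset.sum_mul, Finset.sum_mul]
    refine Finset.sum_congr rfl fun o _ => ?_
    rw [h1, ← add_mul, ← mul_add, hP2, mul_sub, sub_mul, sub_mul, sub_eq_self,
      mul_assoc _ (oddCentSum y), oddCentSum_mul_of hO hOy hOn (O.inv_mem o.2), mul_assoc, hCz,
      mul_zero]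

theorem character_section {ρ : Representation ℂ G V} {c : ℤ} (hc : Odd c)
    (hζ : ∑ g ∈ oddElts G, ρ g = (c : ℂ) • 1) {y : G} (hy : y ^ 4 = 1) {O : Subgroup G}
    (hO : Odd (Nat.card O)) (hOy : ∀ k ∈ O, k * y = y * k)
    (hOn : ∀ g, g * y = y * g → ∀ k ∈ O, g * k * g⁻¹ ∈ O) {k : G} (hk : k ∈ O) :
    ρ.character (y * k) + ρ.character (y ^ 3 * k) = ρ.character y + ρ.character (y ^ 3) := by
  obtain ⟨M, z, hz, hzz, hM2, hMO, hMs⟩ := exists_odd_split hy hO hOy hOn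
  set N : ℤ := (Nat.card O : ℤ) with hN
  have hNodd : Odd N := by rw [hN]; exact_mod_cast hO
  have hN0 : (N : ℂ) ≠ 0 := by
    intro h; have : N = 0 := by exact_mod_cast h
    rw [this] at hNodd; simp at hNodd
  obtain ⟨c', hc'⟩ : ∃ c' : ℤ, c' = c * N ^ 3 := ⟨_, rfl⟩
  have hc'odd : Odd c' := by rw [hc']; exact hc.mul hNodd.pow
  have hc0 : (c' : ℂ) ≠ 0 := by
    intro h; have : c' = 0 := by exact_mod_cast h
    rw [this] at hc'odd; simp at hc'odd
  have hzk : ∀ k ∈ O, MonoidAlgebra.of ℤ G k * z = z * MonoidAlgebra.of ℤ G k := by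
    intro k hk
    rw [hz, mul_sub, sub_mul, of_mul_subSum hk, subSum_mul_of hk, mul_smul_comm, smul_mul_assoc,
      one_mul, mul_one]
  have hyz : MonoidAlgebra.of ℤ G y * z = z * MonoidAlgebra.of ℤ G y := by
    rw [hz, mul_sub, sub_mul, subSum_comm hOy, mul_smul_comm, smul_mul_assoc,
      one_mul, mul_one]
  have hy2z : MonoidAlgebra.of ℤ G (y ^ 2) * z = z * MonoidAlgebra.of ℤ G (y ^ 2) := by
    rw [map_pow]; exact (show Commute _ _ from hyz).pow_left 2
  have hy3z : MonoidAlgebra.of ℤ G (y ^ 3) * z = z * MonoidAlgebra.of ℤ G (y ^ 3) := by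
    rw [map_pow]; exact (show Commute _ _ from hyz).pow_left 3
  set φ := zact ρ with hφ
  set Y := ρ y with hY
  obtain ⟨x, hx⟩ : ∃ x, x = z * M * z := ⟨_, rfl⟩
  set R := φ x with hR
  obtain ⟨f, hf⟩ : ∃ f : End ℂ V, f = (N : ℂ)⁻¹ • φ z := ⟨_, rfl⟩
  have hφN : ∀ a : MonoidAlgebra ℤ G, φ (N • a) = (N : ℂ) • φ a := by
    intro a; rw [map_zsmul, Int.cast_smul_eq_zsmul]
  have hφz : φ z = (N : ℂ) • f := by rw [hf, smul_smul, mul_inv_cancel₀ hN0, one_smul]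
  have hzx : z * x = N • x := by rw [hx, ← mul_assoc, ← mul_assoc, hzz, smul_mul_assoc, smul_mul_assoc]
  have hxz : x * z = N • x := by rw [hx, mul_assoc, hzz, mul_smul_comm]
  have hY2 : φ (MonoidAlgebra.of ℤ G (y ^ 2)) = Y * Y := by rw [zact_of, map_pow, pow_two]
  have hY3 : φ (MonoidAlgebra.of ℤ G (y ^ 3)) = Y * Y * Y := by
    rw [zact_of, map_pow, pow_succ, pow_two]
  have hY1 : φ (MonoidAlgebra.of ℤ G y) = Y := zact_of ρ y
  have e1 : R * f = R := by
    rw [hf, mul_smul_comm, hR, ← map_mul, hxz, hφN, smul_smul, inv_mul_cancel₀ hN0, one_smul]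
  have e2 : Y * f = f * Y := by
    rw [hf, mul_smul_comm, smul_mul_assoc, ← hY1, ← map_mul, ← map_mul, hyz]
  have e3 : Y * Y * R = R * (Y * Y) := by
    rw [← hY2, hR, ← map_mul, ← map_mul]
    congr 1
    rw [hx, ← mul_assoc, ← mul_assoc, hy2z, mul_assoc z, hM2, ← mul_assoc, mul_assoc, hy2z,
      ← mul_assoc]
  have hYYYY : Y * Y * Y * Y = 1 := by
    have := congrArg ρ hy
    rw [map_pow, map_one] at this
    rw [← this]; simp only [pow_succ, pow_zero, one_mul, hY]
  have e4 : R + Y * R * (Y * Y * Y) = (c' : ℂ) • f := by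
    have h1 : x + MonoidAlgebra.of ℤ G y * x * MonoidAlgebra.of ℤ G (y ^ 3) =
        z * ((M + MonoidAlgebra.of ℤ G y * M * MonoidAlgebra.of ℤ G (y ^ 3)) * z) := by
      rw [hx, add_mul, mul_add, mul_assoc z M z]
      congr 1
      rw [← mul_assoc, ← mul_assoc, hyz, mul_assoc _ z, ← hy3z]
      simp only [mul_assoc]
    have h2 : ∀ o : O, φ (MonoidAlgebra.of ℤ G o * oddSum G * MonoidAlgebra.of ℤ G (o⁻¹ : G)) =
        (c : ℂ) • (1 : End ℂ V) := by
      intro o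
      rw [map_mul, map_mul, zact_oddSum, hζ, zact_of, zact_of, mul_smul_comm, mul_one,
        smul_mul_assoc, ← map_mul, mul_inv_cancel, map_one]
    have h3 : R + Y * R * (Y * Y * Y) =
        φ (x + MonoidAlgebra.of ℤ G y * x * MonoidAlgebra.of ℤ G (y ^ 3)) := by
      rw [map_add, map_mul, map_mul, hY1, hY3]
    rw [h3, h1, hMs, map_mul, map_mul, map_sum, Finset.sum_congr rfl fun o _ => h2 o]
    rw [Finset.sum_const, Finset.card_univ, ← Nat.card_eq_fintype_card, smul_mul_assoc,
      smul_mul_assoc, one_mul, mul_smul_comm, mul_smul_comm, ← map_mul, hzz, hφN, hφz, hc',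
      ← Nat.cast_smul_eq_nsmul ℂ, smul_smul, smul_smul, smul_smul]
    congr 1
    push_cast [hN]; ring
  have hU : IsUnit (((c' : ℂ) ^ 2) • (1 : End ℂ V) +
      (2 : ℂ) • (-((c' : ℂ) • R) + R * (1 + Y) * R * (1 - Y))) := by
    have h1 : -((c' : ℂ) • R) + R * (1 + Y) * R * (1 - Y) =
        φ (-(c' • x) + x * (1 + MonoidAlgebra.of ℤ G y) * x * (1 - MonoidAlgebra.of ℤ G y)) := by
      rw [map_add, map_neg, map_zsmul, map_mul, map_mul, map_mul, map_add, map_sub, map_one, hY1,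
        Int.cast_smul_eq_zsmul]
    rw [h1]
    have h2 := isUnit_odd_add_two_mul (isIntegral_zact ρ (-(c' • x) + x * (1 + MonoidAlgebra.of ℤ G y) * x * (1 - MonoidAlgebra.of ℤ G y))) (hc'odd.pow (n := 2))
    push_cast at h2
    exact h2
  obtain ⟨p, hp⟩ : ∃ p : End ℂ V, p = (2 : ℂ)⁻¹ • (1 + Y * Y) := ⟨_, rfl⟩
  have hp2 : (2 : ℂ) • p = 1 + Y * Y := by rw [hp, smul_smul]; norm_num
  have main : ∀ k ∈ O, LinearMap.trace ℂ V (p * (f * (Y * ρ k))) = 0 := by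
    intro k hk
    refine trace_zero_of_odd_split hc0 hp2 hYYYY e2 e3 e1 e4 ?_ ?_ hU
    · rw [hY, ← map_mul, ← map_mul, hOy k hk]
    · rw [← zact_of, hR, ← map_mul, ← map_mul]
      congr 1
      rw [hx, ← mul_assoc, ← mul_assoc, hzk k hk, mul_assoc z, hMO k hk, ← mul_assoc, mul_assoc,
        hzk k hk, ← mul_assoc]
  have hfF : ∀ k ∈ O, f * (Y * ρ k) = Y * ρ k - (N : ℂ)⁻¹ • (φ (subSum O) * Y) := by
    intro k hk
    have h1 : f = 1 - (N : ℂ)⁻¹ • φ (subSum O) := by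
      rw [hf, hz, map_sub, hφN, map_one, smul_sub, smul_smul, inv_mul_cancel₀ hN0, one_smul]
    rw [h1, sub_mul, one_mul, smul_mul_assoc]
    congr 2
    rw [hY, ← map_mul, ← hOy k hk, map_mul, ← mul_assoc, ← zact_of ρ k, ← map_mul,
      subSum_mul_of hk]
  have key : ∀ k ∈ O, ρ.character (y * k) + ρ.character (y ^ 3 * k) =
      2 * ((N : ℂ)⁻¹ * LinearMap.trace ℂ V (p * (φ (subSum O) * Y))) := by
    intro k hk
    have h1 := main k hk
    rw [hfF k hk, mul_sub, map_sub, mul_smul_comm, map_smul, smul_eq_mul, sub_eq_zero] at h1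
    rw [← h1, hp, smul_mul_assoc, map_smul, smul_eq_mul, mul_inv_cancel_left₀ two_ne_zero,
      add_mul, one_mul, map_add]
    congr 1
    · rw [hY, ← map_mul]; rfl
    · rw [hY, ← map_mul, ← map_mul, ← map_mul, ← mul_assoc, ← pow_two, ← pow_succ]; rfl
  have h1 := key 1 O.one_mem
  rw [mul_one, mul_one] at h1
  rw [h1, key k hk]

end oddSection

section minimal

theorem exists_hom_of_cyclic_sylow {G : Type*} [Group G] [Finite G] (S : Sylow 2 G)
    (hS : IsCyclic S) : ∃ τ : G →* S, Odd (Nat.card τ.ker) ∧ ∀ s ∈ S, τ s = 1 → s = 1 := by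
  have := Fact.mk Nat.prime_two
  by_cases h2 : 2 ∣ Nat.card G
  · have hp : (Nat.card G).minFac = 2 := (Nat.minFac_eq_two_iff _).mpr h2
    refine ⟨MonoidHom.transferSylow S (hS.normalizer_le_centralizer hp), ?_, ?_⟩
    · rw [← Nat.not_even_iff_odd, even_iff_two_dvd]
      exact MonoidHom.not_dvd_card_ker_transferSylow S _
    · intro s hs h
      have := MonoidHom.ker_transferSylow_disjoint S (hS.normalizer_le_centralizer hp) S S.2
      exact (Subgroup.disjoint_def.mp this) (MonoidHom.mem_ker.mpr h) hs
  · refine ⟨1, ?_, ?_⟩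
    · rw [← Nat.not_even_iff_odd, even_iff_two_dvd]
      exact fun h => h2 (h.trans (Subgroup.card_subgroup_dvd_card _))
    · intro s hs _
      obtain ⟨k, hk⟩ := S.2 ⟨s, hs⟩
      rw [← orderOf_eq_one_iff]
      have h1 : orderOf s ∣ 2 ^ k := orderOf_dvd_of_pow_eq_one (congrArg Subtype.val hk)
      obtain ⟨j, _, hj⟩ := (Nat.dvd_prime_pow Nat.prime_two).mp h1
      rcases j with _ | j
      · simpa using hj
      · exact absurd (dvd_trans ⟨2 ^ j, by rw [hj, pow_succ']⟩ (orderOf_dvd_natCard s)) h2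

theorem odd_card_of_no_involution {G : Type*} [Group G] [Finite G] {K : Subgroup G}
    (h : ∀ k ∈ K, k * k = 1 → k = 1) : Odd (Nat.card K) := by
  have := Fact.mk Nat.prime_two
  rw [← Nat.not_even_iff_odd, even_iff_two_dvd]
  intro h2
  obtain ⟨x, hx⟩ := exists_prime_orderOf_dvd_card' 2 h2
  have h1 : (x : G) = 1 := h x x.2 (by
    have := pow_orderOf_eq_one x
    rw [hx, pow_two] at this
    exact congrArg Subtype.val this)
  rw [show x = 1 from Subtype.ext h1, orderOf_one] at hx
  omega

theorem eq_one_of_odd_of_pow_two {G : Type*} [Group G] {x : G} {k : ℕ} (hx : Odd (orderOf x))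
    (h : x ^ 2 ^ k = 1) : x = 1 := by
  have h1 : orderOf x ∣ 2 ^ k := orderOf_dvd_of_pow_eq_one h
  exact orderOf_eq_one_iff.mp (Nat.eq_one_of_dvd_coprimes
    (((Nat.coprime_two_left).mpr hx).pow_left k) h1 dvd_rfl)

/-- A minimal configuration in the proof of the theorem on isolated involutions. -/
structure IsMinIso {G : Type*} [Group G] (t : G) : Prop where
  iso : IsIsolated t
  not_central : ∃ g, g * t ≠ t * g
  gen : Subgroup.closure (Set.range fun g => g * t * g⁻¹) = ⊤
  no_odd : ∀ N : Subgroup G, N.Normal → Odd (Nat.card N) → N = ⊥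
  no_inv : ∀ u : G, u * u = 1 → (∀ g, g * u = u * g) → u = 1
  sub : ∀ H : Subgroup G, H ≠ ⊤ → ∀ s : H, IsIsolated s → Odd (Nat.card (isoKernel s))

theorem orderOf_map_odd {G H : Type*} [Group G] [Group H] (f : G →* H) {x : G}
    (h : Odd (orderOf x)) : Odd (orderOf (f x)) :=
  h.of_dvd_nat (orderOf_map_dvd f x)

theorem isIsolated_map {G H : Type*} [Group G] [Group H] {f : G →* H}
    (hf : Function.Surjective f) {t : G} (h : IsIsolated t) : IsIsolated (f t) := by
  refine ⟨by rw [← map_mul, h.1, map_one], fun g => ?_⟩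
  obtain ⟨g, rfl⟩ := hf g
  simpa using orderOf_map_odd f (h.2 g)

theorem isIsolated_subgroup {G : Type*} [Group G] {H : Subgroup G} {t : G} (ht : t ∈ H)
    (h : IsIsolated t) : IsIsolated (⟨t, ht⟩ : H) := by
  refine ⟨Subtype.ext h.1, fun g => ?_⟩
  rw [← Subgroup.orderOf_coe]
  exact h.2 g

theorem isIsolated_conj {G : Type*} [Group G] {t : G} (h : IsIsolated t) (x : G) :
    IsIsolated (x * t * x⁻¹) := by
  have := isIsolated_map (f := (MulAut.conj x).toMonoidHom) (MulAut.conj x).surjective h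
  simpa using this

theorem isoKernel_map {G H : Type*} [Group G] [Group H] {f : G →* H}
    (hf : Function.Surjective f) (t : G) : isoKernel (f t) = (isoKernel t).map f := by
  unfold isoKernel
  rw [MonoidHom.map_closure, ← Set.range_comp]
  congr 1
  ext y
  constructor
  · rintro ⟨g, rfl⟩
    obtain ⟨g, rfl⟩ := hf g
    exact ⟨g, by simp⟩
  · rintro ⟨g, rfl⟩
    exact ⟨f g, by simp⟩

universe u
theorem isolated_of_min (hmin : ∀ (G : Type u) [Group G] [Finite G] (t : G), IsMinIso t → False) :
    ∀ (n : ℕ) (G : Type u) [Group G] [Finite G] (t : G), Nat.card G ≤ n → IsIsolated t →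
      Odd (Nat.card (isoKernel t)) := by
  intro n
  induction n with
  | zero =>
    intro G _ _ t h
    exact absurd (Nat.card_pos (α := G)) (by omega)
  | succ n ih =>
    intro G _ _ t hn ht
    by_contra hodd
    have quotOdd : ∀ N : Subgroup G, ∀ _ : N.Normal, N ≠ ⊥ →
        Odd (Nat.card ((isoKernel t).map (QuotientGroup.mk' N))) := by
      intro N hN hne
      have h1 : Nat.card (G ⧸ N) < Nat.card G := by
        have h2 := Subgroup.card_eq_card_quotient_mul_card_subgroup N
        have h3 : 1 < Nat.card N := (Subgroup.one_lt_card_iff_ne_bot N).mpr hne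
        rw [h2]
        exact lt_mul_of_one_lt_right Nat.card_pos h3
      have h4 := ih (G ⧸ N) (QuotientGroup.mk' N t) (by omega)
        (isIsolated_map (QuotientGroup.mk'_surjective N) ht)
      rwa [isoKernel_map (QuotientGroup.mk'_surjective N)] at h4
    have quot : ∀ N : Subgroup G, ∀ _ : N.Normal, N ≠ ⊥ →
        ∀ k ∈ isoKernel t, k * k = 1 → k ∈ N := by
      intro N hN hne k hk hkk
      have h5 := eq_one_of_odd_card (quotOdd N hN hne) (Subgroup.mem_map_of_mem _ hk) (by rw [← map_mul, hkk, map_one])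
      exact (QuotientGroup.eq_one_iff k).mp h5
    have sub : ∀ H : Subgroup G, H ≠ ⊤ → ∀ s : H, IsIsolated s → Odd (Nat.card (isoKernel s)) := by
      intro H hH s hs
      refine ih H s ?_ hs
      have : Nat.card H < Nat.card G := by
        refine lt_of_le_of_ne (Subgroup.card_le_card_group H) fun h => hH ?_
        exact Subgroup.eq_top_of_card_eq H h
      omega
    refine hmin G t ⟨ht, ?_, ?_, ?_, ?_, sub⟩
    · by_contra hc
      push Not at hc
      refine hodd (odd_card_of_no_involution fun k hk _ => ?_)
      have : isoKernel t ≤ ⊥ := by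
        rw [isoKernel, Subgroup.closure_le]
        rintro _ ⟨g, rfl⟩
        simp [hc, ht.1]
      exact this hk
    · by_contra hL
      set L := Subgroup.closure (Set.range fun g => g * t * g⁻¹) with hLdef
      have hx : ∀ g, g * t * g⁻¹ ∈ L := fun g => Subgroup.subset_closure ⟨g, rfl⟩
      have htL : t ∈ L := by simpa using hx 1
      have h1 := sub L hL ⟨t, htL⟩ (isIsolated_subgroup htL ht)
      refine hodd ?_
      have h2 : isoKernel t = (isoKernel (⟨t, htL⟩ : L)).map L.subtype := by
        apply le_antisymm
        · rw [isoKernel, Subgroup.closure_le]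
          rintro _ ⟨g, rfl⟩
          obtain ⟨y, hy⟩ := conj_of_odd (A := L) (s := ⟨t, htL⟩) (J := ⟨g * t * g⁻¹, hx g⟩)
            (Subtype.ext ht.1) (Subtype.ext (isIsolated_conj ht g).1) (by
              rw [← Subgroup.orderOf_coe]
              change Odd (orderOf (g * t * g⁻¹ * t))
              have := (isIsolated_conj ht g).2 g⁻¹
              have e : g⁻¹ * (g * t * g⁻¹) * g⁻¹⁻¹ = t := by group
              rwa [e] at this)
          refine ⟨⟨t, htL⟩ * (y * ⟨t, htL⟩ * y⁻¹), Subgroup.subset_closure ⟨y, rfl⟩, ?_⟩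
          rw [hy]; rfl
        · rw [isoKernel, MonoidHom.map_closure, Subgroup.closure_le]
          rintro _ ⟨_, ⟨g, rfl⟩, rfl⟩
          exact Subgroup.subset_closure ⟨g, rfl⟩
      rw [h2, Subgroup.card_map_of_injective L.subtype_injective]
      exact h1
    · intro N hN hNodd
      by_contra hne
      exact hodd (odd_card_of_no_involution fun k hk hkk =>
        eq_one_of_odd_card hNodd (quot N hN hne k hk hkk) hkk)
    · intro u hu huc
      by_contra hne
      have hUn : (Subgroup.zpowers u).Normal := ⟨fun x hx g => by
        obtain ⟨k, rfl⟩ := hx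
        have : g * u ^ k * g⁻¹ = u ^ k := by
          rw [mul_inv_eq_iff_eq_mul]
          exact (show Commute g u from huc g).zpow_right k
        change g * u ^ k * g⁻¹ ∈ _
        rw [this]; exact ⟨k, rfl⟩⟩
      have hmem : ∀ x ∈ Subgroup.zpowers u, x = 1 ∨ x = u := by
        rintro x ⟨k, rfl⟩
        change u ^ k = 1 ∨ u ^ k = u
        rcases Int.even_or_odd' k with ⟨m, rfl | rfl⟩
        · left; rw [zpow_mul, zpow_two, hu, one_zpow]
        · right; rw [zpow_add, zpow_mul, zpow_two, hu, one_zpow, one_mul, zpow_one]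
      have hkey : ∀ k ∈ isoKernel t, k * k = 1 → k = 1 ∨ k = u := fun k hk hkk =>
        hmem k (quot _ hUn (by simpa using hne) k hk hkk)
      have huK : u ∈ isoKernel t := by
        by_contra hu'
        refine hodd (odd_card_of_no_involution fun k hk hkk => (hkey k hk hkk).resolve_right ?_)
        rintro rfl; exact hu' hk
      have := Fact.mk Nat.prime_two
      obtain ⟨S⟩ : Nonempty (Sylow 2 (isoKernel t)) := inferInstance
      have hSu : (S : Subgroup (isoKernel t)) ≤ Subgroup.zpowers ⟨u, huK⟩ := by
        intro s hs
        obtain ⟨k, hk⟩ := S.2 ⟨s, hs⟩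
        have hk' : (s : G) ^ 2 ^ k = 1 := congrArg (fun x => ((x : S) : isoKernel t).1) hk
        have h1 : QuotientGroup.mk' (Subgroup.zpowers u) (s : G) = 1 := by
          refine eq_one_of_odd_of_pow_two (k := k) ?_ (by rw [← map_pow, hk', map_one])
          exact (quotOdd _ hUn (by simpa using hne)).of_dvd_nat
            (Subgroup.orderOf_dvd_natCard _ (Subgroup.mem_map_of_mem _ s.2))
        obtain ⟨m, hm⟩ := (QuotientGroup.eq_one_iff (s : G)).mp h1
        exact ⟨m, Subtype.ext (by simpa using hm)⟩
      have hcyc : IsCyclic S :=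
        isCyclic_of_injective (Subgroup.inclusion hSu) (Subgroup.inclusion_injective hSu)
      obtain ⟨τ, hτ, -⟩ := exists_hom_of_cyclic_sylow S hcyc
      have h2 : isoKernel t ≤ τ.ker.map (isoKernel t).subtype := by
        refine (Subgroup.closure_le _).mpr ?_
        rintro _ ⟨g, rfl⟩
        have hg : t * (g * t * g⁻¹) ∈ isoKernel t := Subgroup.subset_closure ⟨g, rfl⟩
        refine ⟨⟨_, hg⟩, ?_, rfl⟩
        obtain ⟨k, hk⟩ := S.2 (τ ⟨_, hg⟩)
        refine eq_one_of_odd_of_pow_two (orderOf_map_odd τ ?_) hk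
        rw [← Subgroup.orderOf_coe]
        exact ht.2 g
      have h3 : τ.ker = ⊤ := by
        rw [eq_top_iff]
        intro x _
        obtain ⟨y, hy, hyx⟩ := h2 x.2
        rwa [← Subtype.ext hyx]
      rw [h3, Subgroup.card_top] at hτ
      exact hodd hτ

end minimal

section minimalBasics
open Representation Module
open scoped Classical
universe v
variable {G : Type v} [Group G] {t : G}

theorem IsIsolated.odd_mul (ht : IsIsolated t) {x y : G} (hx : IsConj t x) (hy : IsConj t y) :
    Odd (orderOf (x * y)) := by
  obtain ⟨a, rfl⟩ := isConj_iff.mp hx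
  obtain ⟨b, rfl⟩ := isConj_iff.mp hy
  have h := ht.2 (a⁻¹ * b)
  rw [← orderOf_injective (MulAut.conj a).toMonoidHom (MulAut.conj a).injective] at h
  have e : (MulAut.conj a).toMonoidHom (t * (a⁻¹ * b * t * (a⁻¹ * b)⁻¹)) =
      a * t * a⁻¹ * (b * t * b⁻¹) := by
    simp only [MulEquiv.toMonoidHom_eq_coe, MonoidHom.coe_coe, MulAut.conj_apply]; group
  rwa [e] at h

theorem IsIsolated.mul_self (ht : IsIsolated t) {x : G} (hx : IsConj t x) : x * x = 1 := by
  obtain ⟨a, rfl⟩ := isConj_iff.mp hx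
  exact (isIsolated_conj ht a).1

theorem IsIsolated.eq_of_commute (ht : IsIsolated t) {x y : G} (hx : IsConj t x)
    (hy : IsConj t y) (h : x * y = y * x) : x = y := by
  have h1 : x * y = 1 := by
    refine eq_one_of_odd_of_pow_two (k := 1) (ht.odd_mul hx hy) ?_
    have hxx := ht.mul_self hx
    have hyy := ht.mul_self hy
    calc (x * y) ^ 2 ^ 1 = x * (y * x) * y := by rw [pow_one, pow_two]; group
      _ = x * x * (y * y) := by rw [← h]; group
      _ = 1 := by rw [hxx, hyy, mul_one]
  rw [eq_inv_of_mul_eq_one_left h1]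
  exact inv_eq_of_mul_eq_one_left (ht.mul_self hy)

theorem IsIsolated.exists_conj_mem [Finite G] (ht : IsIsolated t) (H : Subgroup G) {x y : G}
    (hx : IsConj t x) (hy : IsConj t y) (hxH : x ∈ H) (hyH : y ∈ H) :
    ∃ g ∈ H, g * x * g⁻¹ = y := by
  obtain ⟨g, hg⟩ := conj_of_odd (A := H) (s := ⟨x, hxH⟩) (J := ⟨y, hyH⟩)
    (Subtype.ext (ht.mul_self hx)) (Subtype.ext (ht.mul_self hy)) (by
      rw [← Subgroup.orderOf_coe]; exact ht.odd_mul hy hx)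
  exact ⟨g, g.2, congrArg Subtype.val hg⟩

theorem isIrrChar_one : IsIrrChar (fun _ : G => (1 : ℂ)) := by
  have h := isIrrChar_character (Representation.trivial ℂ G ℂ) (by
    rw [isIrreducible_iff_submodule]
    refine ⟨inferInstance, fun W hW => ?_⟩
    rcases eq_bot_or_eq_top W with h | h <;> simp [h])
  convert h using 2
  simp [character]

variable [Fintype G]

theorem eq_one_of_character_eq {V : Type*} [AddCommGroup V] [Module ℂ V] [FiniteDimensional ℂ V]
    (ρ : Representation ℂ G V) (ht : t * t = 1) (h : ρ.character t = ρ.character 1) :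
    ρ t = 1 := by
  have h2 : ρ t * ρ t = 1 := by rw [← map_mul, ht, map_one]
  have hid : IsIdempotentElem ((2 : ℂ)⁻¹ • (1 - ρ t)) := by
    rw [IsIdempotentElem, smul_mul_smul_comm,
      show (1 - ρ t) * (1 - ρ t) = (2 : ℂ) • (1 - ρ t) by
        simp only [mul_sub, sub_mul, h2, one_mul, mul_one, two_smul]; abel, smul_smul]
    norm_num
  have h3 := LinearMap.IsIdempotentElem.eq_zero_of_trace_eq_zero hid (by
    rw [map_smul, map_sub]
    have : LinearMap.trace ℂ V (ρ t) = LinearMap.trace ℂ V 1 := by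
      simpa [character] using h
    rw [this, sub_self, smul_zero])
  rw [smul_eq_zero, sub_eq_zero] at h3
  exact (h3.resolve_left (by norm_num)).symm

/-- A homomorphism killing the generating involution is trivial. -/
theorem IsMinIso.map_eq_one (hm : IsMinIso t) {M : Type*} [Monoid M] (f : G →* M)
    (h : f t = 1) (g : G) : f g = 1 := by
  have h1 : f.ker = ⊤ := by
    rw [eq_top_iff, ← hm.gen, Subgroup.closure_le]
    rintro _ ⟨g, rfl⟩
    rw [SetLike.mem_coe, MonoidHom.mem_ker, map_mul, map_mul, h, mul_one, ← map_mul,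
      mul_inv_cancel, map_one]
  have : g ∈ f.ker := by rw [h1]; trivial
  exact this

theorem IsMinIso.eq_one_of_irr (hm : IsMinIso t) {χ : G → ℂ} (hχ : IsIrrChar χ)
    (h : χ t = χ 1) : χ = fun _ => 1 := by
  obtain ⟨n, ρ, hρ, rfl⟩ := hχ
  have h1 := hm.map_eq_one ρ (eq_one_of_character_eq ρ hm.iso.1 h)
  have h2 : ρ.character = fun _ => (n : ℂ) := by
    funext g; simp [character, h1]
  have h3 := charPair_irr ⟨n, ρ, hρ, rfl⟩ ⟨n, ρ, hρ, rfl⟩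
  rw [if_pos rfl, h2] at h3
  simp only [charPair, Finset.sum_const, Finset.card_univ, nsmul_eq_mul,
    ← Nat.card_eq_fintype_card] at h3
  rw [← mul_assoc, inv_mul_cancel₀ (cardC_ne_zero G), one_mul] at h3
  have h4 : n * n = 1 := by exact_mod_cast h3
  rw [h2, Nat.eq_one_of_mul_eq_one_right h4]
  simp

/-- Sums over the conjugacy class of `x`, as a central element. -/
theorem irr_conj_sum {χ : G → ℂ} (hχ : IsIrrChar χ) (x h : G) :
    χ 1 * ∑ g ∈ Finset.univ.filter (IsConj x), χ (g * h) =
      (Finset.univ.filter (IsConj x)).card * χ x * χ h := by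
  have := irr_central_mul hχ (a := fun g => if IsConj x g then 1 else 0) (by
    intro g y
    have : IsConj x (g * y * g⁻¹) ↔ IsConj x y :=
      ⟨fun h => h.trans (isConj_iff.mpr ⟨g⁻¹, by group⟩), fun h => h.trans (isConj_iff.mpr ⟨g, rfl⟩)⟩
    simp only [this]) h
  simp only [ite_mul, one_mul, zero_mul, ← Finset.sum_filter] at this
  rw [this]
  congr 1
  rw [Finset.sum_congr rfl (g := fun _ => χ x)]
  · simp
  · intro g hg
    obtain ⟨a, rfl⟩ := isConj_iff.mp (Finset.mem_filter.mp hg).2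
    exact hχ.isClassFun a x

theorem sum_irr_one_mul (g : G) :
    ∑ χ ∈ irr G, χ 1 * χ g = if g = 1 then (Nat.card G : ℂ) else 0 := by
  have h := classFun_expand (f := fun g : G => if g = 1 then (Nat.card G : ℂ) else 0) (by
    intro a x
    simp [mul_inv_eq_one]) g
  rw [h]
  refine Finset.sum_congr rfl fun χ _ => ?_
  simp [charPair]

end minimalBasics

section caseKlein
open Representation Module
open scoped Classical
universe v
variable {G : Type v} [Group G] {t : G} [Fintype G]

/-- In the centralizer of a noncentral element commuting with `t`, products with `t` lie in a
normal subgroup of odd order. -/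
theorem IsMinIso.exists_odd (hm : IsMinIso t) {w : G} (hw : ∃ g, g * w ≠ w * g)
    (hwt : t * w = w * t) : ∃ O : Subgroup G, Odd (Nat.card O) ∧ (∀ k ∈ O, k * w = w * k) ∧
      (∀ g, g * w = w * g → ∀ k ∈ O, g * k * g⁻¹ ∈ O) ∧
      (∀ y, IsConj t y → y * w = w * y → t * y ∈ O) := by
  set H := Subgroup.centralizer {w} with hH
  have hmem : ∀ g, g ∈ H ↔ g * w = w * g := fun g => by
    rw [hH, Subgroup.mem_centralizer_singleton_iff]
  have htop : H ≠ ⊤ := by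
    intro h
    obtain ⟨g, hg⟩ := hw
    exact hg ((hmem g).mp (by rw [h]; trivial))
  have htH : t ∈ H := (hmem t).mpr hwt
  have hiso := isIsolated_subgroup htH hm.iso
  have hodd := hm.sub H htop ⟨t, htH⟩ hiso
  have hN := isoKernel_normal (t := (⟨t, htH⟩ : H)) hiso.1
  refine ⟨(isoKernel (⟨t, htH⟩ : H)).map H.subtype, ?_, ?_, ?_, ?_⟩
  · rwa [Subgroup.card_map_of_injective H.subtype_injective]
  · rintro _ ⟨k, _, rfl⟩
    exact (hmem _).mp k.2
  · rintro g hg _ ⟨k, hk, rfl⟩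
    exact ⟨_, hN.conj_mem k hk ⟨g, (hmem g).mpr hg⟩, rfl⟩
  · intro y hy hyw
    obtain ⟨g, hg, rfl⟩ := hm.iso.exists_conj_mem H (IsConj.refl t) hy htH ((hmem y).mpr hyw)
    exact ⟨⟨t, htH⟩ * (⟨g, hg⟩ * ⟨t, htH⟩ * ⟨g, hg⟩⁻¹), Subgroup.subset_closure ⟨⟨g, hg⟩, rfl⟩, rfl⟩

theorem IsMinIso.klein_conj (hm : IsMinIso t) {u : G} (hu : u * u = 1) (hut : t * u = u * t)
    {x : G} (hx : IsConj t x) : ∃ g y, IsConj t y ∧ y * (t * u) = t * u * y ∧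
      g * (x * u) * g⁻¹ = t * u * (y * t) := by
  have hxx := hm.iso.mul_self hx
  have hui : u⁻¹ = u := inv_eq_of_mul_eq_one_left hu
  have hxi : x⁻¹ = x := inv_eq_of_mul_eq_one_left hxx
  have hc2 : Odd (orderOf ((x * u) * (x * u))) := by
    have := hm.iso.odd_mul hx (hx.trans (isConj_iff.mpr ⟨u, rfl⟩))
    rw [hui] at this
    simpa only [mul_assoc] using this
  obtain ⟨m, hmm⟩ := hc2
  set c := x * u with hc
  have hxc : x * c * x⁻¹ = c⁻¹ := by
    rw [hc, mul_inv_rev, hui, hxi, mul_assoc, mul_assoc, ← mul_assoc x x, hxx, one_mul]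
  have hxck : ∀ k : ℕ, x * c ^ k = (c ^ k)⁻¹ * x := fun k => by
    have : x * c ^ k * x⁻¹ = (c ^ k)⁻¹ := by rw [← conj_pow, hxc, inv_pow]
    rw [← this]; group
  have hcz : c ^ (2 * m + 1) * c ^ (2 * m + 1) = 1 := by
    rw [← Commute.mul_pow (Commute.refl c), ← hmm, pow_orderOf_eq_one]
  set x' := c ^ m * x * (c ^ m)⁻¹ with hx'
  have hx'T : IsConj t x' := hx.trans (isConj_iff.mpr ⟨_, rfl⟩)
  have hx'e : x' = c ^ (2 * m) * x := by
    rw [hx', mul_assoc, show x * (c ^ m)⁻¹ = c ^ m * x by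
      rw [mul_inv_eq_iff_eq_mul, mul_assoc, hxck]; group, ← mul_assoc, ← pow_add, two_mul]
  have hz : x' * u = c ^ (2 * m + 1) := by
    rw [hx'e, mul_assoc, ← hc, pow_succ]
  have hx_sq := hm.iso.mul_self hx'T
  have hx'i : x'⁻¹ = x' := inv_eq_of_mul_eq_one_left hx_sq
  have hcomm : x' * u = u * x' := by
    have := hz ▸ hcz
    have h2 := inv_eq_of_mul_eq_one_left this
    rw [mul_inv_rev, hui, hx'i] at h2
    exact h2.symm
  obtain ⟨g, hg, hgx⟩ := hm.iso.exists_conj_mem (Subgroup.centralizer {u}) hx'T (IsConj.refl t)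
    (by rw [Subgroup.mem_centralizer_singleton_iff]; exact hcomm)
    (by rw [Subgroup.mem_centralizer_singleton_iff]; exact hut)
  have hgu : g * u * g⁻¹ = u := by
    rw [Subgroup.mem_centralizer_singleton_iff] at hg
    rw [mul_inv_eq_iff_eq_mul]; exact hg
  have hgz : g * (x' * u) * g⁻¹ = t * u := by
    rw [← conj_mul, hgx, hgu]
  have hxz : x * (x' * u) = x' * u * x := by
    have h1 := hxck (2 * m + 1)
    rw [inv_eq_of_mul_eq_one_left hcz] at h1
    rwa [hz]
  refine ⟨g, g * x * g⁻¹, hx.trans (isConj_iff.mpr ⟨_, rfl⟩), ?_, ?_⟩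
  · rw [← hgz, conj_mul, conj_mul, hxz]
  · have h1 : c = x' * u * (x * x') := by
      calc c = x * (x' * u * x') := by rw [hcomm, mul_assoc u, hx_sq, mul_one]
        _ = x' * u * (x * x') := by rw [← mul_assoc, hxz, mul_assoc]
    rw [← hgz, show g * x * g⁻¹ * t = g * (x * x') * g⁻¹ by rw [← conj_mul, hgx], conj_mul, ← h1]

theorem IsMinIso.klein_character (hm : IsMinIso t) {u : G} (hu : u * u = 1)
    (hut : t * u = u * t) (hne : u ≠ t) {n : ℕ} {ρ : Representation ℂ G (Fin n → ℂ)}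
    (hρ : ρ.IsIrreducible) {c : ℤ} (hc : Odd c) (hζ : ∑ g ∈ oddElts G, ρ g = (c : ℂ) • 1) :
    ρ.character 1 * ρ.character (t * u) = ρ.character t * ρ.character u := by
  have hww : t * u * (t * u) = 1 := by
    rw [mul_assoc, ← mul_assoc u t u, ← hut, mul_assoc t u u, hu, mul_one, hm.iso.1]
  have hw1 : t * u ≠ 1 := fun h => hne (by
    have := eq_inv_of_mul_eq_one_right h
    rw [this]; exact inv_eq_of_mul_eq_one_left hm.iso.1)
  have hwc : ∃ g, g * (t * u) ≠ t * u * g := by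
    by_contra h; push Not at h
    exact hw1 (hm.no_inv _ hww h)
  obtain ⟨O, hO, hOw, hOn, hOt⟩ := hm.exists_odd hwc (by rw [mul_assoc, hut])
  have hw3 : (t * u) ^ 3 = t * u := by rw [pow_succ, pow_two, hww, one_mul]
  have hw4 : (t * u) ^ 4 = 1 := by rw [pow_succ, hw3, hww]
  have key : ∀ x, IsConj t x → ρ.character (x * u) = ρ.character (t * u) := by
    intro x hx
    obtain ⟨g, y, hy, hyw, hg⟩ := hm.klein_conj hu hut hx
    have hyt : y * t ∈ O := by
      have := O.inv_mem (hOt y hy hyw)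
      rwa [mul_inv_rev, inv_eq_of_mul_eq_one_left hm.iso.1,
        inv_eq_of_mul_eq_one_left (hm.iso.mul_self hy)] at this
    have h := character_section hc hζ hw4 hO hOw hOn hyt
    rw [hw3, ← hg, ρ.char_conj] at h
    linear_combination h / 2
  have h := irr_conj_sum ⟨n, ρ, hρ, rfl⟩ t u
  rw [Finset.sum_congr rfl fun x hx => key x (Finset.mem_filter.mp hx).2, Finset.sum_const,
    nsmul_eq_mul] at h
  have h0 : ((Finset.univ.filter (IsConj t)).card : ℂ) ≠ 0 := by
    rw [Nat.cast_ne_zero, Finset.card_ne_zero]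
    exact ⟨t, by simpa using IsConj.refl t⟩
  apply mul_left_cancel₀ h0
  linear_combination h

theorem four_dvd_card {u : G} (ht : t * t = 1) (ht1 : t ≠ 1) (hu : u * u = 1) (hu1 : u ≠ 1)
    (hut : t * u = u * t) (hne : u ≠ t) : 4 ∣ Nat.card G := by
  have hti : t⁻¹ = t := inv_eq_of_mul_eq_one_left ht
  have hdis : Disjoint (Subgroup.zpowers t) (Subgroup.zpowers u) := by
    rw [Subgroup.disjoint_def]
    have hmem : ∀ (s : G), s * s = 1 → ∀ x ∈ Subgroup.zpowers s, x = 1 ∨ x = s := by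
      rintro s hs x ⟨k, rfl⟩
      change s ^ k = 1 ∨ s ^ k = s
      rcases Int.even_or_odd' k with ⟨m, rfl | rfl⟩
      · left; rw [zpow_mul, zpow_two, hs, one_zpow]
      · right; rw [zpow_add, zpow_mul, zpow_two, hs, one_zpow, one_mul, zpow_one]
    intro x hx hx'
    rcases hmem t ht x hx with h | h
    · exact h
    · rcases hmem u hu x hx' with h' | h'
      · exact h'
      · exact absurd (h'.symm.trans h) hne
  have h2 : ∀ (s : G), s * s = 1 → s ≠ 1 → orderOf s = 2 := fun s hs hs1 =>
    orderOf_eq_prime (by rw [pow_two, hs]) hs1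
  have hsup : Nat.card (Subgroup.zpowers t × Subgroup.zpowers u) = 4 := by
    rw [Nat.card_prod, Nat.card_zpowers, Nat.card_zpowers, h2 t ht ht1, h2 u hu hu1]
  let f : Subgroup.zpowers t × Subgroup.zpowers u →* G :=
    MonoidHom.noncommCoprod (Subgroup.zpowers t).subtype (Subgroup.zpowers u).subtype (by
      rintro ⟨_, k, rfl⟩ ⟨_, l, rfl⟩
      exact (show Commute t u from hut).zpow_zpow k l)
  have hf : Function.Injective f := by
    rw [injective_iff_map_eq_one]
    rintro ⟨a, b⟩ hab
    have h3 : (a : G) * b = 1 := hab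
    have h4 : (a : G) = (b : G)⁻¹ := eq_inv_of_mul_eq_one_left h3
    have ha : (a : G) = 1 := Subgroup.disjoint_def.mp hdis a.2 (by rw [h4]; exact inv_mem b.2)
    have hb : (b : G) = 1 := by rw [ha, one_mul] at h3; exact h3
    exact Prod.ext (Subtype.ext ha) (Subtype.ext hb)
  rw [← hsup]
  exact Subgroup.card_dvd_of_injective f hf

theorem IsMinIso.no_klein (hm : IsMinIso t) {u : G} (hu : u * u = 1) (hu1 : u ≠ 1)
    (hut : t * u = u * t) : u = t := by
  by_contra hne
  have hww : t * u * (t * u) = 1 := by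
    rw [mul_assoc, ← mul_assoc u t u, ← hut, mul_assoc t u u, hu, mul_one, hm.iso.1]
  have htt := hm.iso.1
  have ht1 : t ≠ 1 := by
    rintro rfl
    obtain ⟨g, hg⟩ := hm.not_central
    simp at hg
  have hw1 : t * u ≠ 1 := fun h => hne (by
    have := eq_inv_of_mul_eq_one_right h
    rw [this]; exact inv_eq_of_mul_eq_one_left hm.iso.1)
  have htw : t * (t * u) = u := by rw [← mul_assoc, htt, one_mul]
  -- each irreducible character contributes a multiple of four, except the trivial one
  have key : ∀ χ ∈ irr G, ∃ k : ℤ, ∑ a ∈ oddElts G, ∑ b ∈ oddElts G,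
      (χ 1 * χ (a * b * u) + χ 1 * χ (a * b * (t * u))) = k ∧
        ((χ ≠ fun _ => 1) → (4 : ℤ) ∣ k) := by
    intro χ hχ
    have hχ := mem_irr.mp hχ
    obtain ⟨n, ρ, hρ, hρχ⟩ := id hχ
    obtain ⟨c, hζ, -⟩ := sum_oddElts_scalar ρ hρ
    have h1 : ∀ h, ∑ a ∈ oddElts G, ∑ b ∈ oddElts G, χ (a * b * h) = c ^ 2 * χ h := by
      intro h
      have : (∑ a ∈ oddElts G, ρ a) * (∑ b ∈ oddElts G, ρ b) * ρ h = ((c : ℂ) ^ 2) • ρ h := by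
        rw [hζ, smul_mul_smul_comm, one_mul, smul_mul_assoc, one_mul, pow_two]
      have := congrArg (LinearMap.trace ℂ _) this
      rw [Finset.sum_mul_sum, Finset.sum_mul, map_sum, map_smul] at this
      simp only [Finset.sum_mul, map_sum, ← map_mul] at this
      rw [← hρχ]
      exact this
    have h2 : ∑ a ∈ oddElts G, ∑ b ∈ oddElts G,
        (χ 1 * χ (a * b * u) + χ 1 * χ (a * b * (t * u))) =
        c ^ 2 * (χ 1 * (χ u + χ (t * u))) := by
      simp only [Finset.sum_add_distrib, ← Finset.mul_sum, h1]; ring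
    obtain ⟨p, hp⟩ := character_int_of_involution ρ hu
    obtain ⟨q, hq⟩ := character_int_of_involution ρ hww
    have h3 : χ 1 = n := by rw [← hρχ, char_one]; simp
    rw [hρχ] at hp hq
    refine ⟨c ^ 2 * (n * (p + q)), ?_, ?_⟩
    · rw [h2, hp, hq, h3]; push_cast; ring
    · intro hne1
      rcases Int.even_or_odd c with hc | hc
      · obtain ⟨d, rfl⟩ := hc
        exact ⟨d ^ 2 * (n * (p + q)), by ring⟩
      · have e1 := hm.klein_character hu hut hne hρ hc hζ
        have e2 := hm.klein_character (u := t * u) hww (by rw [mul_assoc, hut])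
          (fun h => hu1 (by simpa using h)) hρ hc hζ
        rw [htw, hρχ] at e2
        rw [hρχ] at e1
        have e3 : (χ 1 - χ t) * (χ u + χ (t * u)) = 0 := by linear_combination e1 + e2
        rcases mul_eq_zero.mp e3 with h | h
        · exact absurd (hm.eq_one_of_irr hχ (sub_eq_zero.mp h).symm) hne1
        · rw [hp, hq] at h
          have : p + q = 0 := by exact_mod_cast h
          rw [this]; simp
  choose! k hk hk4 using key
  have hsum : ∑ χ ∈ irr G, ∑ a ∈ oddElts G, ∑ b ∈ oddElts G,
      (χ 1 * χ (a * b * u) + χ 1 * χ (a * b * (t * u))) =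
      (Nat.card G : ℂ) * ((∑ a ∈ oddElts G, ∑ b ∈ oddElts G,
        ((if a * b * u = 1 then 1 else 0) + if a * b * (t * u) = 1 then 1 else 0) : ℤ)) := by
    rw [Finset.sum_comm]
    push_cast
    rw [Finset.mul_sum]
    refine Finset.sum_congr rfl fun a _ => ?_
    rw [Finset.sum_comm, Finset.mul_sum]
    refine Finset.sum_congr rfl fun b _ => ?_
    rw [Finset.sum_add_distrib, sum_irr_one_mul, sum_irr_one_mul]
    split_ifs <;> ring
  rw [Finset.sum_congr rfl fun χ hχ => hk χ hχ] at hsum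
  have hsum' : ∑ χ ∈ irr G, k χ = (Nat.card G : ℤ) * (∑ a ∈ oddElts G, ∑ b ∈ oddElts G,
        ((if a * b * u = 1 then 1 else 0) + if a * b * (t * u) = 1 then 1 else 0) : ℤ) := by
    exact_mod_cast hsum
  have h1mem : (fun _ => 1 : G → ℂ) ∈ irr G := mem_irr.mpr isIrrChar_one
  have h4G : (4 : ℤ) ∣ Nat.card G := by
    exact_mod_cast four_dvd_card htt ht1 hu hu1 hut hne
  have h5 : (4 : ℤ) ∣ ∑ χ ∈ irr G, k χ := by rw [hsum']; exact h4G.mul_right _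
  rw [← Finset.add_sum_erase _ _ h1mem] at h5
  have h6 : (4 : ℤ) ∣ ∑ χ ∈ (irr G).erase (fun _ => 1), k χ :=
    Finset.dvd_sum fun χ hχ => hk4 χ (Finset.mem_of_mem_erase hχ) (Finset.ne_of_mem_erase hχ)
  have h7 := (Int.dvd_add_left h6).mp h5
  have h8 := hk _ h1mem
  simp only [Finset.sum_const, nsmul_eq_mul, mul_one] at h8
  have h9 : k (fun _ => 1) = (oddElts G).card * ((oddElts G).card * 2) := by
    have : ((oddElts G).card : ℂ) * ((oddElts G).card * (1 + 1)) = k (fun _ => 1) := h8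
    rw [one_add_one_eq_two] at this
    exact_mod_cast this.symm
  rw [h9] at h7
  have hodd : Odd ((oddElts G).card : ℤ) := by exact_mod_cast card_oddElts_odd (G := G)
  obtain ⟨r, hr⟩ := hodd
  rw [hr] at h7
  obtain ⟨s, hs⟩ := h7
  have : (2 * r + 1) * ((2 * r + 1) * 2) = 4 * (2 * r * r + 2 * r) + 2 := by ring
  omega

end caseKlein

section rankOne
universe v

theorem isCyclic_of_central_four (n : ℕ) : ∀ (P : Type v) [Group P] [Finite P],
    Nat.card P = 2 ^ n →
    (∀ x y : P, x * x = 1 → x ≠ 1 → y * y = 1 → y ≠ 1 → x = y) →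
    ∀ z : P, (∀ g, g * z = z * g) → orderOf z = 4 → IsCyclic P := by
  induction n with
  | zero =>
    intro P _ _ hP _ z _ _
    have : Subsingleton P := (Nat.card_eq_one_iff_unique.mp (by simpa using hP)).1
    infer_instance
  | succ n ih =>
    intro P _ _ hP huniq z hz hz4
    have := Fact.mk Nat.prime_two
    by_cases hzP : Nat.card P = 4
    · exact isCyclic_of_orderOf_eq_card z (by rw [hz4, hzP])
    have h4P : (4 : ℕ) ∣ 2 ^ (n + 1) := by rw [← hP, ← hz4]; exact orderOf_dvd_natCard z
    have h4n : 2 ≤ n := by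
      have : 2 ≤ n + 1 := (Nat.pow_dvd_pow_iff_le_right (by norm_num : 1 < 2)).mp
        (by simpa using h4P)
      rcases Nat.lt_or_ge n 2 with h | h
      · exfalso; apply hzP
        rw [hP, show n + 1 = 2 by omega]; norm_num
      · exact h
    obtain ⟨M, hM, hzM⟩ := Sylow.exists_subgroup_card_pow_prime_le (p := 2) (n := 2) (m := n)
      (by rw [hP]; exact pow_dvd_pow _ (Nat.le_succ n)) (Subgroup.zpowers z)
      (by rw [Nat.card_zpowers, hz4]; norm_num) h4n
    have hidx : M.index = 2 := by
      have := M.card_mul_index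
      rw [hM, hP, pow_succ] at this
      exact Nat.eq_of_mul_eq_mul_left (by positivity) this
    have hMn : M.Normal := Subgroup.normal_of_index_eq_two hidx
    have hzM' : z ∈ M := hzM (Subgroup.mem_zpowers z)
    have hMc : IsCyclic M := ih M hM (fun x y h1 h2 h3 h4 => Subtype.ext
      (huniq x y (congrArg Subtype.val h1) (fun h => h2 (Subtype.ext h))
        (congrArg Subtype.val h3) (fun h => h4 (Subtype.ext h))))
      ⟨z, hzM'⟩ (fun g => Subtype.ext (hz g)) (by rw [← Subgroup.orderOf_coe]; exact hz4)
    obtain ⟨⟨a, haM⟩, ha⟩ := hMc.exists_generator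
    have hgen : ∀ x ∈ M, ∃ k : ℤ, a ^ k = x := fun x hx => by
      obtain ⟨k, hk⟩ := ha ⟨x, hx⟩
      exact ⟨k, congrArg Subtype.val hk⟩
    have hao : orderOf a = 2 ^ n := by
      have := orderOf_eq_card_of_forall_mem_zpowers ha
      rw [hM, ← Subgroup.orderOf_coe] at this
      exact this
    obtain ⟨g, hg⟩ : ∃ g, g ∉ M := by
      by_contra h; push Not at h
      rw [(Subgroup.eq_top_iff' M).mpr h, Subgroup.index_top] at hidx
      omega
    obtain ⟨k, hk⟩ := hgen _ (Subgroup.mul_self_mem_of_index_two hidx g)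
    obtain ⟨u, hu⟩ := hgen _ (hMn.conj_mem a haM g)
    obtain ⟨m, hm⟩ := hgen z hzM'
    have hconj : ∀ i : ℤ, g * a ^ i * g⁻¹ = a ^ (u * i) := fun i => by
      rw [zpow_mul, hu, conj_zpow]
    have hu4 : (4 : ℤ) ∣ u - 1 := by
      have h1 : z ^ (u - 1) = 1 := by
        have h2 := hconj m
        rw [hm, hz g, mul_inv_cancel_right, mul_comm u m, zpow_mul, hm] at h2
        rw [zpow_sub_one, ← h2, mul_inv_cancel]
      have := orderOf_dvd_iff_zpow_eq_one.mpr h1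
      rwa [hz4] at this
    obtain ⟨q, hq⟩ := hu4
    by_cases hkpar : Even k
    · exfalso
      obtain ⟨l, rfl⟩ := hkpar
      have hcop : IsCoprime (2 * q + 1 : ℤ) (2 ^ n) :=
        IsCoprime.pow_right ⟨1, -q, by ring⟩
      obtain ⟨r, s, hrs⟩ := hcop
      have hsq : (g * a ^ (-(r * l))) * (g * a ^ (-(r * l))) = 1 := by
        have : (g * a ^ (-(r * l))) * (g * a ^ (-(r * l))) =
            (g * a ^ (-(r * l)) * g⁻¹) * (g * g) * a ^ (-(r * l)) := by group
        rw [this, hconj, ← hk, ← zpow_add, ← zpow_add]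
        have e : u * -(r * l) + (l + l) + -(r * l) = 2 ^ n * (2 * s * l) := by
          have : u = 4 * q + 1 := by linarith
          rw [this]; linear_combination (-2 * l) * hrs
        rw [e, zpow_mul]
        have : a ^ ((2 : ℤ) ^ n) = 1 := by
          have := pow_orderOf_eq_one a
          rw [hao] at this
          exact_mod_cast this
        rw [this, one_zpow]
      have hnM : g * a ^ (-(r * l)) ∉ M := fun h =>
        hg ((Subgroup.mul_mem_cancel_right M (M.zpow_mem haM _)).mp h)
      have hzz : z * z * (z * z) = 1 := by
        have := pow_orderOf_eq_one z
        rw [hz4] at this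
        rw [← this]; simp [pow_succ, mul_assoc]
      have hzz1 : z * z ≠ 1 := by
        intro h
        have := orderOf_dvd_of_pow_eq_one (x := z) (n := 2) (by rw [pow_two, h])
        rw [hz4] at this; omega
      refine hnM ?_
      rw [huniq _ (z * z) hsq (fun h => hnM (by rw [h]; exact M.one_mem)) hzz hzz1]
      exact M.mul_mem hzM' hzM'
    · -- here `g` generates
      rw [Int.not_even_iff_odd] at hkpar
      obtain ⟨l, rfl⟩ := hkpar
      have hcop : IsCoprime (2 * l + 1 : ℤ) (2 ^ n) := IsCoprime.pow_right ⟨1, -l, by ring⟩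
      obtain ⟨r, s, hrs⟩ := hcop
      have hag : a ∈ Subgroup.zpowers g := by
        have : a = (g * g) ^ r := by
          rw [← hk, ← zpow_mul, show (2 * l + 1) * r = 1 - 2 ^ n * s by linarith, zpow_sub,
            zpow_mul, zpow_one]
          have : a ^ ((2 : ℤ) ^ n) = 1 := by
            have := pow_orderOf_eq_one a
            rw [hao] at this
            exact_mod_cast this
          rw [this, one_zpow, inv_one, mul_one]
        rw [this]
        exact Subgroup.zpow_mem _ (mul_mem (Subgroup.mem_zpowers g) (Subgroup.mem_zpowers g)) _
      refine ⟨g, fun x => ?_⟩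
      have hMle : ∀ x ∈ M, x ∈ Subgroup.zpowers g := fun x hx => by
        obtain ⟨k, rfl⟩ := hgen x hx
        exact Subgroup.zpow_mem _ hag k
      by_cases hx : x ∈ M
      · exact hMle x hx
      · have h1 : x * g ∈ M := (Subgroup.mul_mem_iff_of_index_two hidx).mpr
          ⟨fun h => absurd h hx, fun h => absurd h hg⟩
        have := mul_mem (hMle _ h1) (inv_mem (Subgroup.mem_zpowers g))
        rwa [mul_inv_cancel_right] at this

variable {G : Type v} [Group G] {t : G} [Fintype G]

theorem exists_central_involution {P : Type*} [Group P] [Finite P] (hP : IsPGroup 2 P)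
    [Nontrivial P] : ∃ z : P, z * z = 1 ∧ z ≠ 1 ∧ ∀ g, g * z = z * g := by
  have := Fact.mk Nat.prime_two
  have hnt := hP.center_nontrivial
  have hZ : IsPGroup 2 (Subgroup.center P) := hP.to_subgroup _
  obtain ⟨n, hn, hc⟩ := hZ.nontrivial_iff_card.mp hnt
  obtain ⟨x, hx⟩ := exists_prime_orderOf_dvd_card' (G := Subgroup.center P) 2
    (by rw [hc]; exact dvd_pow_self 2 hn.ne')
  refine ⟨x, ?_, ?_, fun g => Subgroup.mem_center_iff.mp x.2 g⟩
  · have := pow_orderOf_eq_one x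
    rw [hx, pow_two] at this
    exact congrArg Subtype.val this
  · intro h
    rw [show x = 1 from Subtype.ext h, orderOf_one] at hx
    omega

theorem IsMinIso.ne_one (hm : IsMinIso t) : t ≠ 1 := by
  rintro rfl
  obtain ⟨g, hg⟩ := hm.not_central
  simp at hg

theorem IsMinIso.isConj_of_involution (hm : IsMinIso t) {u : G} (hu : u * u = 1) (hu1 : u ≠ 1) :
    IsConj t u := by
  have := Fact.mk Nat.prime_two
  have h2 : ∀ (s : G), s * s = 1 → IsPGroup 2 (Subgroup.zpowers s) := fun s hs => by
    rintro ⟨x, k, rfl⟩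
    refine ⟨1, Subtype.ext ?_⟩
    change (s ^ k) ^ (2 ^ 1) = 1
    rw [pow_one, ← zpow_natCast, ← zpow_mul, mul_comm, zpow_mul]
    simp [pow_two, hs]
  obtain ⟨S, hS⟩ := (h2 t hm.iso.1).exists_le_sylow
  obtain ⟨S', hS'⟩ := (h2 u hu).exists_le_sylow
  have htS : t ∈ S := hS (Subgroup.mem_zpowers t)
  have huS : u ∈ S' := hS' (Subgroup.mem_zpowers u)
  have : Nontrivial S := ⟨⟨⟨t, htS⟩, 1, fun h => hm.ne_one (congrArg Subtype.val h)⟩⟩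
  obtain ⟨z, hz, hz1, hzc⟩ := exists_central_involution S.2
  have hzS : ∀ s ∈ S, s * (z : G) = z * s := fun s hs => congrArg Subtype.val (hzc ⟨s, hs⟩)
  have hzt : (z : G) = t := hm.no_klein (congrArg Subtype.val hz)
    (fun h => hz1 (Subtype.ext h)) (hzS t htS)
  obtain ⟨g, hg⟩ := MulAction.exists_smul_eq G S' S
  have hgu : g * u * g⁻¹ ∈ S := by
    rw [← hg]
    exact ⟨u, huS, rfl⟩
  have h3 := hm.no_klein (u := g * u * g⁻¹) (by rw [conj_mul, hu]; group)
    (fun h => hu1 (by simpa using h)) (by rw [← hzt]; exact (hzS _ hgu).symm)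
  exact (isConj_iff.mpr ⟨g, h3⟩ : IsConj u t).symm

theorem IsMinIso.unique_involution (hm : IsMinIso t) {P : Subgroup G} (hP : IsPGroup 2 P)
    {x y : G} (hx : x ∈ P) (hy : y ∈ P) (hxx : x * x = 1) (hx1 : x ≠ 1) (hyy : y * y = 1)
    (hy1 : y ≠ 1) : x = y := by
  have : Nontrivial P := ⟨⟨⟨x, hx⟩, 1, fun h => hx1 (congrArg Subtype.val h)⟩⟩
  obtain ⟨z, hz, hz1, hzc⟩ := exists_central_involution hP
  have hzT := hm.isConj_of_involution (congrArg Subtype.val hz) (fun h => hz1 (Subtype.ext h))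
  have key : ∀ u ∈ P, u * u = 1 → u ≠ 1 → (z : G) = u := fun u hu huu hu1 =>
    hm.iso.eq_of_commute hzT (hm.isConj_of_involution huu hu1)
      (congrArg Subtype.val (hzc ⟨u, hu⟩)).symm
  rw [← key x hx hxx hx1, ← key y hy hyy hy1]

theorem IsMinIso.not_isCyclic (hm : IsMinIso t) (S : Sylow 2 G) : ¬ IsCyclic S := by
  intro hS
  obtain ⟨τ, hτ, -⟩ := exists_hom_of_cyclic_sylow S hS
  have hker := hm.no_odd τ.ker inferInstance hτ
  have hinj := (MonoidHom.ker_eq_bot_iff τ).mp hker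
  obtain ⟨g, hg⟩ := hm.not_central
  exact hg (hinj (by rw [map_mul, map_mul]; exact hS.commGroup.mul_comm _ _))

theorem IsMinIso.isCyclic_of_central (hm : IsMinIso t) {P : Subgroup G} (hP : IsPGroup 2 P)
    {z : G} (hz : z ∈ P) (hzc : ∀ g ∈ P, g * z = z * g) (hz4 : orderOf z = 4) : IsCyclic P := by
  have := Fact.mk Nat.prime_two
  obtain ⟨n, hn⟩ := IsPGroup.iff_card.mp hP
  refine isCyclic_of_central_four n P hn (fun x y h1 h2 h3 h4 => Subtype.ext ?_) ⟨z, hz⟩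
    (fun g => Subtype.ext (hzc g g.2)) (by rw [← Subgroup.orderOf_coe]; exact hz4)
  exact hm.unique_involution hP x.2 y.2 (congrArg Subtype.val h1) (fun h => h2 (Subtype.ext h))
        (congrArg Subtype.val h3) (fun h => h4 (Subtype.ext h))

end rankOne

section rankOneStructure
universe v
variable {G : Type v} [Group G] {t : G} [Fintype G]

theorem orderOf_eq_four {y : G} (h : y * y = t) (ht : t * t = 1) (ht1 : t ≠ 1) :
    orderOf y = 4 := by
  have := orderOf_eq_prime_pow (p := 2) (n := 1) (x := y) (by
    rw [pow_one, pow_two, h]; exact ht1) (by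
    rw [show 2 ^ (1 + 1) = 2 + 2 from rfl, pow_add, pow_two, h, ht])
  simpa using this

theorem IsMinIso.exists_inverted (hm : IsMinIso t) : ∃ (S : Sylow 2 G) (y j : G), t ∈ S ∧ y ∈ S ∧
    j ∈ S ∧ y * y = t ∧ j * y * j⁻¹ = y⁻¹ ∧ (∀ s ∈ S, s * t = t * s) ∧
    ∀ s ∈ S, s * y * s⁻¹ = y ∨ s * y * s⁻¹ = y⁻¹ := by
  have := Fact.mk Nat.prime_two
  have htt := hm.iso.1
  have h2 : IsPGroup 2 (Subgroup.zpowers t) := by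
    rintro ⟨x, k, rfl⟩
    refine ⟨1, Subtype.ext ?_⟩
    change (t ^ k) ^ (2 ^ 1) = 1
    rw [pow_one, ← zpow_natCast, ← zpow_mul, mul_comm, zpow_mul]
    simp [pow_two, htt]
  obtain ⟨S, hS⟩ := h2.exists_le_sylow
  have htS : t ∈ S := hS (Subgroup.mem_zpowers t)
  have : Nontrivial S := ⟨⟨⟨t, htS⟩, 1, fun h => hm.ne_one (congrArg Subtype.val h)⟩⟩
  have hinv : ∀ u ∈ S, u * u = 1 → u ≠ 1 → u = t := fun u hu huu hu1 =>
    hm.unique_involution S.2 hu htS huu hu1 htt hm.ne_one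
  have hcen : ∀ s ∈ S, s * t = t * s := by
    intro s hs
    have h1 := hinv (s * t * s⁻¹) (S.mul_mem (S.mul_mem hs htS) (S.inv_mem hs))
      (by rw [conj_mul, htt]; group) (fun h => hm.ne_one (by simpa using h))
    rwa [mul_inv_eq_iff_eq_mul] at h1
  let tS : S := ⟨t, htS⟩
  let Z : Subgroup S := Subgroup.zpowers tS
  have hZmem : ∀ x : S, x ∈ Z → x = 1 ∨ x = tS := by
    rintro x ⟨k, rfl⟩
    have hs : tS * tS = 1 := Subtype.ext htt
    change tS ^ k = 1 ∨ tS ^ k = tS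
    rcases Int.even_or_odd' k with ⟨m, rfl | rfl⟩
    · left; rw [zpow_mul, zpow_two, hs, one_zpow]
    · right; rw [zpow_add, zpow_mul, zpow_two, hs, one_zpow, one_mul, zpow_one]
  have hZn : Z.Normal := ⟨fun x hx g => by
    have : g * x * g⁻¹ = x := by
      rw [mul_inv_eq_iff_eq_mul]
      rcases hZmem x hx with rfl | rfl
      · simp
      · exact Subtype.ext (hcen g g.2)
    rwa [this]⟩
  have hZt : Z ≠ ⊤ := fun h => hm.not_isCyclic S ⟨tS, fun x => by
    change x ∈ Z
    rw [h]; trivial⟩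
  have : Nontrivial (S ⧸ Z) := QuotientGroup.nontrivial_iff.mpr hZt
  obtain ⟨w, hww, hw1, hwc⟩ := exists_central_involution (P := S ⧸ Z) (S.2.to_quotient Z)
  obtain ⟨⟨y, hyS⟩, rfl⟩ := QuotientGroup.mk_surjective w
  have hyZ : (⟨y, hyS⟩ : S) ∉ Z := fun h => hw1 ((QuotientGroup.eq_one_iff _).mpr h)
  have hyy : y * y = t := by
    have h1 : (⟨y, hyS⟩ * ⟨y, hyS⟩ : S) ∈ Z := (QuotientGroup.eq_one_iff _).mp hww
    rcases hZmem _ h1 with h | h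
    · exfalso
      have h3 : y * y = 1 := congrArg Subtype.val h
      by_cases hy1 : y = 1
      · exact hyZ (by
          rw [show (⟨y, hyS⟩ : S) = 1 from Subtype.ext hy1]; exact Z.one_mem)
      · exact hyZ (by
          rw [show (⟨y, hyS⟩ : S) = tS from Subtype.ext (hinv y hyS h3 hy1)]
          exact Subgroup.mem_zpowers _)
    · exact congrArg Subtype.val h
  have hyt : t * y = y⁻¹ := by
    rw [eq_inv_iff_mul_eq_one, mul_assoc, hyy, htt]
  have hall : ∀ s ∈ S, s * y * s⁻¹ = y ∨ s * y * s⁻¹ = y⁻¹ := by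
    intro s hs
    have h1 := hwc (QuotientGroup.mk ⟨s, hs⟩)
    rw [← QuotientGroup.mk_mul, ← QuotientGroup.mk_mul, QuotientGroup.eq] at h1
    rcases hZmem _ h1 with h | h
    · left
      have h3 : (s * y)⁻¹ * (y * s) = 1 := congrArg Subtype.val h
      rw [mul_inv_eq_iff_eq_mul]
      exact (inv_mul_eq_one.mp h3)
    · right
      have h3 : (s * y)⁻¹ * (y * s) = t := congrArg Subtype.val h
      rw [inv_mul_eq_iff_eq_mul] at h3
      rw [← hyt, mul_inv_eq_iff_eq_mul, mul_assoc, h3, ← mul_assoc,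
        ← hcen _ (S.mul_mem hs hyS), mul_assoc, htt, mul_one]
  have hy4 := orderOf_eq_four hyy htt hm.ne_one
  obtain ⟨j, hjS, hj⟩ : ∃ j ∈ S, j * y * j⁻¹ ≠ y := by
    by_contra h
    push Not at h
    refine hm.not_isCyclic S (hm.isCyclic_of_central S.2 hyS (fun g hg => ?_) hy4)
    rw [← mul_inv_eq_iff_eq_mul]
    exact h g hg
  exact ⟨S, y, j, htS, hyS, hjS, hyy, (hall j hjS).resolve_left hj, hcen, hall⟩

/-- A normal complement in the centralizer of an element of order four. -/
theorem IsMinIso.exists_hom_centralizer (hm : IsMinIso t) {y : G} (hy : orderOf y = 4) :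
    ∃ (R : Sylow 2 (Subgroup.centralizer {y})) (τ : Subgroup.centralizer {y} →* R),
      IsCyclic R ∧ Odd (Nat.card τ.ker) ∧ ∀ s ∈ R, τ s = 1 → s = 1 := by
  have := Fact.mk Nat.prime_two
  have hyC : y ∈ Subgroup.centralizer {y} := Subgroup.mem_centralizer_singleton_iff.mpr rfl
  have hp : IsPGroup 2 (Subgroup.zpowers (⟨y, hyC⟩ : Subgroup.centralizer {y})) := by
    rintro ⟨x, k, rfl⟩
    refine ⟨2, Subtype.ext (Subtype.ext ?_)⟩
    change (y ^ k) ^ (2 ^ 2) = 1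
    have := pow_orderOf_eq_one y
    rw [← zpow_natCast, ← zpow_mul, mul_comm, zpow_mul]
    simp [← hy, this]
  obtain ⟨R, hR⟩ := hp.exists_le_sylow
  have hyR := hR (Subgroup.mem_zpowers _)
  have hmap : IsPGroup 2 ((R : Subgroup (Subgroup.centralizer {y})).map (Subgroup.subtype _)) :=
    R.2.map _
  have hc := hm.isCyclic_of_central hmap (z := y) ⟨_, hyR, rfl⟩ (by
    rintro _ ⟨x, _, rfl⟩
    exact (Subgroup.mem_centralizer_singleton_iff.mp x.2)) hy
  have hRc : IsCyclic R :=
    isCyclic_of_injective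
      ((R : Subgroup (Subgroup.centralizer {y})).equivMapOfInjective _ (Subgroup.subtype_injective _)).toMonoidHom
      (MulEquiv.injective _)
  obtain ⟨τ, h1, h2⟩ := exists_hom_of_cyclic_sylow R hRc
  exact ⟨R, τ, hRc, h1, h2⟩

end rankOneStructure

section specialHom
universe v
variable {G : Type v} [Group G] {t : G} [Fintype G]

theorem IsMinIso.order_four_commute (hm : IsMinIso t) {y w : G} (hy : orderOf y = 4)
    (hw : orderOf w = 4) (h : w * y = y * w) : w = y ∨ w = y⁻¹ := by
  have hsq : ∀ x : G, orderOf x = 4 → x * x ≠ 1 ∧ (x * x) * (x * x) = 1 := by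
    intro x hx
    constructor
    · intro h1
      have := orderOf_dvd_of_pow_eq_one (x := x) (n := 2) (by rw [pow_two, h1])
      rw [hx] at this; omega
    · have := pow_orderOf_eq_one x
      rw [hx] at this
      rw [← this]; simp [pow_succ, mul_assoc]
  have hc : Commute w y := h
  have huniq : ∀ a b : G, a * b = b * a → a * a = 1 → a ≠ 1 → b * b = 1 → b ≠ 1 → a = b :=
    fun a b hab h1 h2 h3 h4 => hm.iso.eq_of_commute (hm.isConj_of_involution h1 h2)
      (hm.isConj_of_involution h3 h4) hab
  have hww : w * w = y * y := huniq _ _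
    ((hc.mul_right hc).mul_left (hc.mul_right hc)) (hsq w hw).2 (hsq w hw).1 (hsq y hy).2 (hsq y hy).1
  have h2 : (w * y⁻¹) * (w * y⁻¹) = 1 := by
    have h3 : y⁻¹ * w = w * y⁻¹ := (hc.inv_right).eq.symm
    calc (w * y⁻¹) * (w * y⁻¹) = w * (y⁻¹ * w) * y⁻¹ := by group
      _ = (w * w) * (y * y)⁻¹ := by rw [h3]; group
      _ = 1 := by rw [hww, mul_inv_cancel]
  by_cases h1 : w * y⁻¹ = 1
  · left; exact mul_inv_eq_one.mp h1
  · right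
    have h3 := huniq (w * y⁻¹) (y * y) (((hc.mul_right hc)).mul_left
      ((Commute.refl y).inv_left.mul_right (Commute.refl y).inv_left)) h2 h1 (hsq y hy).2 (hsq y hy).1
    rw [mul_inv_eq_iff_eq_mul] at h3
    rw [h3, eq_inv_iff_mul_eq_one, mul_assoc (y * y)]
    exact (hsq y hy).2

theorem IsMinIso.mem_zpowers_of_four_dvd (hm : IsMinIso t) {y c : G} (hy : orderOf y = 4)
    (hc : c * y = y * c) (h4 : 4 ∣ orderOf c) : y ∈ Subgroup.zpowers c := by
  obtain ⟨m, hmm⟩ := h4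
  have hm0 : m ≠ 0 := by
    rintro rfl
    exact (orderOf_pos c).ne' (by simpa using hmm)
  have hw : orderOf (c ^ m) = 4 := by
    rw [orderOf_pow_of_dvd hm0 ⟨4, by rw [hmm, mul_comm]⟩, hmm]
    exact Nat.mul_div_cancel _ (Nat.pos_of_ne_zero hm0)
  have hwy : Commute (c ^ m) y := (show Commute c y from hc).pow_left m
  rcases hm.order_four_commute hy hw hwy with h | h
  · rw [← h]; exact Subgroup.npow_mem_zpowers c m
  · rw [← inv_inv y, ← h]; exact inv_mem (Subgroup.npow_mem_zpowers c m)

/-- A linear character of the centralizer of an element `y` of order four which is trivial on all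
elements whose order is not divisible by four. -/
theorem IsMinIso.exists_special (hm : IsMinIso t) {y j : G} (hy : orderOf y = 4)
    (hj : j * y * j⁻¹ = y⁻¹) : ∃ ξ : Subgroup.centralizer {y} →* ℂ,
    (∀ c, ξ c ≠ 1 → 4 ∣ orderOf (c : G)) ∧ (∃ c, ξ c ≠ 1) ∧
    ((∀ c c' : Subgroup.centralizer {y}, (c' : G) = j * c * j⁻¹ → ξ c' = ξ c) →
      ∃ O : Subgroup G, Odd (Nat.card O) ∧ (∀ k ∈ O, k * y = y * k) ∧
        (∀ g, g * y = y * g → ∃ r < 4, ∃ k ∈ O, g = y ^ r * k) ∧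
        ∀ (r : ℕ) (k : G) (c : Subgroup.centralizer {y}), k ∈ O → (c : G) = y ^ r * k →
          ξ c = (-1) ^ r) := by
  have := Fact.mk Nat.prime_two
  classical
  have hex := hm.exists_hom_centralizer hy
  revert hex
  generalize hC : Subgroup.centralizer {y} = C
  rintro ⟨R, τ, hR, hker, hinj⟩
  have hmem : ∀ g, g ∈ C ↔ g * y = y * g := fun g => hC ▸ Subgroup.mem_centralizer_singleton_iff
  let yC : C := ⟨y, (hmem y).mpr rfl⟩
  have hNe : NeZero (Nat.card R) := ⟨Nat.card_pos.ne'⟩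
  let ι : R ≃* rootsOfUnity (Nat.card R) ℂ := mulEquivOfCyclicCardEq
    (Complex.card_rootsOfUnity _).symm
  let κ : R →* ℂ := (Units.coeHom ℂ).comp ((rootsOfUnity (Nat.card R) ℂ).subtype.comp ι.toMonoidHom)
  have hκ : Function.Injective κ := Units.val_injective.comp (Subtype.val_injective.comp ι.injective)
  let ξ : C →* ℂ := ((powMonoidHom 2).comp κ).comp τ
  have hξ : ∀ c, ξ c = κ (τ c ^ 2) := fun c => (map_pow κ _ _).symm
  have hξ1 : ∀ c, ξ c = 1 ↔ τ c ^ 2 = 1 := fun c => by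
    rw [hξ, ← map_one κ, hκ.eq_iff]
  have hpow : ∀ r : R, ∃ k, orderOf r = 2 ^ k := fun r => by
    obtain ⟨k, hk⟩ := R.2 r
    obtain ⟨l, _, hl⟩ := (Nat.dvd_prime_pow Nat.prime_two).mp (orderOf_dvd_of_pow_eq_one hk)
    exact ⟨l, hl⟩
  have hodd1 : ∀ c, Odd (orderOf c) → τ c = 1 := fun c hc => by
    obtain ⟨k, hk⟩ := R.2 (τ c)
    exact eq_one_of_odd_of_pow_two (orderOf_map_odd τ hc) hk
  have hyy : τ yC ^ 2 ≠ 1 := by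
    intro h
    rw [← map_pow] at h
    have h1 := eq_one_of_odd_card hker (MonoidHom.mem_ker.mpr h) (by
      have := pow_orderOf_eq_one y
      rw [hy] at this
      exact Subtype.ext (by change y ^ 2 * y ^ 2 = 1; rw [← pow_add]; exact this))
    have h2 : y ^ 2 = 1 := congrArg Subtype.val h1
    have := orderOf_dvd_of_pow_eq_one h2
    rw [hy] at this; omega
  have hy4 : τ yC ^ 4 = 1 := by
    rw [← map_pow, ← map_one τ]
    congr 1
    have := pow_orderOf_eq_one y
    rw [hy] at this
    exact Subtype.ext this
  have hτy : orderOf (τ yC) = 4 :=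
    orderOf_eq_four rfl (by simpa [pow_succ, mul_assoc] using hy4) (by rwa [pow_two] at hyy)
  refine ⟨ξ, ?_, ⟨yC, fun h => hyy ((hξ1 _).mp h)⟩, ?_⟩
  · intro c hc
    rw [Ne, hξ1] at hc
    obtain ⟨k, hk⟩ := hpow (τ c)
    have : 4 ∣ orderOf (τ c) := by
      rcases k with _ | _ | k
      · exfalso; apply hc
        rw [pow_zero, orderOf_eq_one_iff] at hk
        rw [hk, one_pow]
      · exfalso; apply hc
        rw [zero_add, pow_one] at hk
        have h := pow_orderOf_eq_one (τ c)
        rwa [hk] at h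
      · exact ⟨2 ^ k, by rw [hk]; ring⟩
    rw [Subgroup.orderOf_coe]
    exact this.trans (orderOf_map_dvd τ c)
  · intro hinv
    obtain ⟨b, hb⟩ := hR.exists_generator
    have hτsurj : Function.Surjective τ := by
      have h1 : Function.Injective (τ.comp (R : Subgroup C).subtype) := by
        rw [injective_iff_map_eq_one]
        intro s hs
        exact Subtype.ext (hinj s s.2 hs)
      intro x
      obtain ⟨s, hs⟩ := (Finite.injective_iff_surjective.mp h1) x
      exact ⟨s, hs⟩
    obtain ⟨c0, hc0⟩ := hτsurj b
    have hjC : ∀ c : C, j * c * j⁻¹ ∈ C := fun c => by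
      rw [hmem]
      have h1 : Commute (c : G) y := (hmem c).mp c.2
      have h2 : j * c * j⁻¹ * y⁻¹ = y⁻¹ * (j * c * j⁻¹) := by
        rw [← hj, conj_mul, conj_mul, h1.eq]
      have h3 : Commute (j * c * j⁻¹) y⁻¹ := h2
      exact (Commute.inv_right_iff.mp h3).eq
    let jc : C → C := fun c => ⟨j * c * j⁻¹, hjC c⟩
    have jmul : ∀ a b, jc (a * b) = jc a * jc b := fun a b => Subtype.ext (conj_mul).symm
    let jh : C →* C := MonoidHom.mk' jc jmul
    obtain ⟨u, hu⟩ := hb (τ (jh c0))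
    obtain ⟨m, hmm⟩ := hb (τ yC)
    have hu' : b ^ u = τ (jh c0) := hu
    have hm' : b ^ m = τ yC := hmm
    have hu4 : (4 : ℤ) ∣ u + 1 := by
      have hk : τ (c0 ^ (-m) * yC) = 1 := by
        rw [map_mul, map_zpow, hc0, ← hm', ← zpow_add]; simp
      have hkodd : Odd (orderOf (c0 ^ (-m) * yC)) :=
        hker.of_dvd_nat (Subgroup.orderOf_dvd_natCard _ (MonoidHom.mem_ker.mpr hk))
      have h1 := hodd1 _ (orderOf_map_odd jh hkodd)
      rw [map_mul, map_zpow, map_mul, map_zpow, ← hu', show jh yC = yC⁻¹ from Subtype.ext hj,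
        map_inv, ← hm', ← zpow_mul, ← zpow_neg, ← zpow_add,
        show u * -m + -m = m * (-(u + 1)) by ring, zpow_mul, hm', zpow_neg, inv_eq_one] at h1
      have := orderOf_dvd_iff_zpow_eq_one.mpr h1
      rwa [hτy] at this
    have hR4 : ∀ r : R, r ^ 4 = 1 := by
      have h1 : ξ (jh c0) = ξ c0 := hinv _ _ rfl
      rw [hξ, hξ, hκ.eq_iff, ← hu', hc0, ← zpow_natCast, ← zpow_natCast, ← zpow_mul] at h1
      have h2 : b ^ (u * 2 - 2) = 1 := by
        rw [zpow_sub]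
        push_cast at h1
        rw [h1, mul_inv_cancel]
      have h3 := orderOf_dvd_iff_zpow_eq_one.mpr h2
      obtain ⟨k, hk⟩ := hpow b
      have hb4 : b ^ 4 = 1 := by
        apply orderOf_dvd_iff_pow_eq_one.mp
        rw [hk] at h3 ⊢
        rcases Nat.lt_or_ge k 3 with h | h
        · interval_cases k <;> norm_num
        · exfalso
          obtain ⟨l, rfl⟩ := Nat.exists_eq_add_of_le h
          rw [pow_add] at h3
          push_cast at h3
          have h5 : (2 : ℤ) ^ 3 ∣ u * 2 - 2 := (Dvd.intro _ rfl).trans h3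
          omega
      intro r
      obtain ⟨i, rfl⟩ := hb r
      change (b ^ i) ^ 4 = 1
      rw [← zpow_natCast, ← zpow_mul, mul_comm, zpow_mul]
      simp [hb4]
    have hgen : ∀ x : R, ∃ r < 4, x = τ yC ^ r := by
      have hcard : Nat.card R ∣ 4 := by
        rw [← orderOf_eq_card_of_forall_mem_zpowers hb]
        exact orderOf_dvd_of_pow_eq_one (hR4 b)
      have h4 : 4 ∣ Nat.card R := by rw [← hτy]; exact orderOf_dvd_natCard _
      have hcard4 := Nat.dvd_antisymm hcard h4
      intro x
      have h1 : Subgroup.zpowers (τ yC) = ⊤ :=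
        Subgroup.eq_top_of_card_eq _ (by rw [Nat.card_zpowers, hτy, hcard4])
      have h2 : x ∈ Subgroup.zpowers (τ yC) := by rw [h1]; trivial
      obtain ⟨i, hi⟩ := Subgroup.mem_zpowers_iff.mp h2
      refine ⟨(i % 4).toNat, by omega, ?_⟩
      rw [← zpow_natCast, Int.toNat_of_nonneg (by omega), ← hi]
      have := zpow_mod_orderOf (τ yC) i
      rw [hτy] at this
      exact this.symm
    refine ⟨τ.ker.map C.subtype, ?_, ?_, ?_, ?_⟩
    · rwa [Subgroup.card_map_of_injective C.subtype_injective]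
    · rintro _ ⟨k, _, rfl⟩
      exact (hmem _).mp k.2
    · intro g hg
      obtain ⟨r, hr, hrx⟩ := hgen (τ ⟨g, (hmem g).mpr hg⟩)
      refine ⟨r, hr, (y ^ r)⁻¹ * g, ⟨(yC ^ r)⁻¹ * ⟨g, (hmem g).mpr hg⟩, ?_, rfl⟩, by group⟩
      rw [SetLike.mem_coe, MonoidHom.mem_ker, map_mul, map_inv, map_pow, hrx, inv_mul_cancel]
    · rintro r _ c ⟨k, hk, rfl⟩ hc
      have hc' : c = yC ^ r * k := Subtype.ext hc
      have hk1 : ξ k = 1 := by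
        rw [hξ1, MonoidHom.mem_ker.mp hk, one_pow]
      have hy1 : ξ yC = -1 := by
        have h2 : ξ yC ^ 2 = 1 := by
          rw [hξ, ← map_pow, ← pow_mul, hy4, map_one]
        rcases sq_eq_one_iff.mp h2 with h | h
        · exact absurd ((hξ1 _).mp h) hyy
        · exact h
      rw [hc', map_mul, map_pow, hk1, hy1, mul_one]

end specialHom

section inducedFun
open Representation Module
open scoped Classical
universe v
variable {G : Type v} [Group G] [Fintype G]

theorem IsIrrChar.comp_inv {χ : G → ℂ} (hχ : IsIrrChar χ) : IsIrrChar fun g => χ g⁻¹ := by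
  obtain ⟨n, ρ, hρ, rfl⟩ := hχ
  have h1 : (dual ρ).character = fun g => ρ.character g⁻¹ := funext fun g => char_dual ρ g
  rw [← h1]
  apply isIrrChar_character
  rw [isIrreducible_iff_submodule] at hρ ⊢
  obtain ⟨hn, hW⟩ := hρ
  refine ⟨inferInstance, fun W hinv => ?_⟩
  have h2 := Subspace.dualCoannihilator_dualAnnihilator_eq (W := W)
  rcases hW W.dualCoannihilator (fun g v hv => by
    rw [Submodule.mem_dualCoannihilator] at hv ⊢
    intro φ hφ
    have h3 := hv _ (hinv g⁻¹ φ hφ)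
    simpa [dual_apply, Dual.transpose_apply] using h3) with h | h
  · right; rw [← h2, h, Submodule.dualAnnihilator_bot]
  · left; rw [← h2, h, Submodule.dualAnnihilator_top]

theorem sum_eq_sum_subgroup (C : Subgroup G) {f : G → ℂ} (hf : ∀ g, g ∉ C → f g = 0) :
    ∑ g, f g = ∑ c : C, f c := by
  rw [← Finset.sum_subset (Finset.filter_subset (· ∈ C) Finset.univ)
    (fun g _ h => hf g (by simpa using h))]
  exact Finset.sum_subtype _ (by simp) f

theorem sum_comp_conj (f : G → ℂ) (x : G) : ∑ g, f (x * g * x⁻¹) = ∑ g, f g :=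
  Equiv.sum_comp (MulAut.conj x).toEquiv f

/-- The function induced from a function on `G` supported on a subgroup `C`. -/
noncomputable def inducedFun (C : Subgroup G) (f : G → ℂ) (g : G) : ℂ :=
  (Nat.card C : ℂ)⁻¹ * ∑ x, f (x * g * x⁻¹)

theorem inducedFun_isClassFun (C : Subgroup G) (f : G → ℂ) : IsClassFun (inducedFun C f) := by
  intro a g
  unfold inducedFun
  congr 1
  rw [← Equiv.sum_comp (Equiv.mulRight a) fun x => f (x * g * x⁻¹)]
  refine Finset.sum_congr rfl fun x _ => ?_
  congr 1
  simp [mul_assoc]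

theorem charPair_inducedFun (C : Subgroup G) (f : G → ℂ) {h : G → ℂ} (hh : IsClassFun h) :
    charPair (inducedFun C f) h = (Nat.card C : ℂ)⁻¹ * ∑ g, f g * h g⁻¹ := by
  have h1 : ∀ x, ∑ g, f (x * g * x⁻¹) * h g⁻¹ = ∑ g, f g * h g⁻¹ := fun x => by
    rw [← sum_comp_conj (fun g => f g * h g⁻¹) x]
    refine Finset.sum_congr rfl fun g _ => ?_
    congr 1
    rw [← hh x g⁻¹]; congr 1; group
  unfold charPair inducedFun
  have h2 : ∑ g, ((Nat.card C : ℂ)⁻¹ * ∑ x, f (x * g * x⁻¹)) * h g⁻¹ =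
      (Nat.card C : ℂ)⁻¹ * (Nat.card G * ∑ g, f g * h g⁻¹) := by
    simp_rw [mul_assoc (Nat.card C : ℂ)⁻¹, Finset.sum_mul]
    rw [← Finset.mul_sum, Finset.sum_comm, Finset.sum_congr rfl fun x _ => h1 x]
    simp [Nat.card_eq_fintype_card]
  rw [h2, mul_left_comm, inv_mul_cancel_left₀ (cardC_ne_zero G)]

/-- The representation on `ℂ` given by a linear character. -/
noncomputable def linearRep {G : Type*} [Group G] (ξ : G →* ℂ) : Representation ℂ G ℂ :=
  (algebraMap ℂ (End ℂ ℂ)).toMonoidHom.comp ξ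

theorem linearRep_character {G : Type*} [Group G] (ξ : G →* ℂ) : (linearRep ξ).character = ξ := by
  funext g
  have : linearRep ξ g = ξ g • (1 : End ℂ ℂ) :=
    (Algebra.algebraMap_eq_smul_one (A := End ℂ ℂ) (ξ g))
  rw [character, this, map_smul, LinearMap.trace_one]
  simp

theorem sum_linear_mul_character (C : Subgroup G) (ξ : C →* ℂ) {V : Type*} [AddCommGroup V]
    [Module ℂ V] [FiniteDimensional ℂ V] (ρ : Representation ℂ G V) :
    ∃ n : ℕ, (Nat.card C : ℂ)⁻¹ * ∑ c : C, ξ c * ρ.character (c : G)⁻¹ = n := by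
  have := charPair_character (ρ.comp C.subtype) (linearRep ξ)
  rw [linearRep_character] at this
  exact ⟨_, this⟩

end inducedFun

section virtualChar
open Representation Module
open scoped Classical
universe v
variable {G : Type v} [Group G] [Fintype G] {t : G}

/-- The data of a normal complement in the centralizer of `y`, whose Sylow `2`-subgroup is `⟨y⟩`. -/
structure IsOddPart (y j : G) (O : Subgroup G) : Prop where
  odd : Odd (Nat.card O)
  comm : ∀ k ∈ O, k * y = y * k
  split : ∀ g, g * y = y * g → ∃ r < 4, ∃ k ∈ O, g = y ^ r * k
  conj : ∀ k ∈ O, j * k * j⁻¹ ∈ O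

theorem mem_of_odd_of_split {y : G} (hy : orderOf y = 4) {O : Subgroup G}
    (hO : ∀ k ∈ O, k * y = y * k) (hs : ∀ g, g * y = y * g → ∃ r < 4, ∃ k ∈ O, g = y ^ r * k)
    {g : G} (hg : g * y = y * g) (hodd : Odd (orderOf g)) (hcard : Odd (Nat.card O)) : g ∈ O := by
  obtain ⟨r, hr, k, hk, rfl⟩ := hs g hg
  have hc : Commute (y ^ r) k := (show Commute y k from (hO k hk).symm).pow_left r
  have hkodd : Odd (orderOf k) := hcard.of_dvd_nat (Subgroup.orderOf_dvd_natCard _ hk)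
  have h1 : Odd (orderOf (y ^ r)) := by
    have h2 : y ^ r = (y ^ r * k) * k⁻¹ := by group
    have hcc : Commute (y ^ r * k) k⁻¹ := (hc.mul_left (Commute.refl k)).inv_right
    rw [h2]
    refine Odd.of_dvd_nat ?_ (hcc.orderOf_mul_dvd_mul_orderOf)
    rw [orderOf_inv]
    exact hodd.mul hkodd
  have h3 : y ^ r = 1 := eq_one_of_odd_of_pow_two (k := 2) h1 (by
    rw [← pow_mul, mul_comm, pow_mul]
    have := pow_orderOf_eq_one y
    rw [hy] at this
    norm_num [this])
  rw [h3, one_mul]; exact hk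

theorem pow_mul_injective {y : G} (hy : orderOf y = 4) {O : Subgroup G}
    (hcard : Odd (Nat.card O)) :
    Function.Injective fun p : Fin 4 × O => y ^ (p.1 : ℕ) * (p.2 : G) := by
  rintro ⟨⟨r, hr⟩, k, hk⟩ ⟨⟨s, hs⟩, l, hl⟩ h
  have h : y ^ r * k = y ^ s * l := h
  have h1 : (y ^ s)⁻¹ * y ^ r = l * k⁻¹ := by
    rw [eq_mul_inv_iff_mul_eq, mul_assoc, h]; group
  have h2 : (y ^ s)⁻¹ * y ^ r = 1 := by
    refine eq_one_of_odd_of_pow_two (k := 2) ?_ ?_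
    · rw [h1]
      exact hcard.of_dvd_nat (Subgroup.orderOf_dvd_natCard _ (O.mul_mem hl (O.inv_mem hk)))
    · have hc : Commute (y ^ s)⁻¹ (y ^ r) := ((Commute.refl y).pow_pow s r).inv_left
      have h4 : y ^ 4 = 1 := by rw [← hy]; exact pow_orderOf_eq_one y
      rw [show 2 ^ 2 = 4 from rfl, hc.mul_pow, inv_pow, ← pow_mul, ← pow_mul, mul_comm s, mul_comm r,
        pow_mul, pow_mul, h4]
      simp
  have h3 : r = s := by
    have := pow_inj_mod.mp (inv_mul_eq_one.mp h2)
    rw [hy, Nat.mod_eq_of_lt hs, Nat.mod_eq_of_lt hr] at this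
    exact this.symm
  subst h3
  simpa using h

/-- Summation over the centralizer of `y`. -/
theorem IsOddPart.sum_eq {y j : G} {O : Subgroup G} (h : IsOddPart y j O) (hy : orderOf y = 4)
    (F : G → ℂ) : ∑ c : Subgroup.centralizer {y}, F c = ∑ r ∈ Finset.range 4, ∑ k : O, F (y ^ r * k) := by
  have hmem : ∀ g, g ∈ Subgroup.centralizer {y} ↔ g * y = y * g :=
    fun g => Subgroup.mem_centralizer_singleton_iff
  rw [Finset.sum_range fun r => ∑ k : O, F (y ^ r * k), ← Fintype.sum_prod_type']
  symm
  refine Fintype.sum_bijective (fun p : Fin 4 × O => (⟨y ^ (p.1 : ℕ) * (p.2 : G), (hmem _).mpr ?_⟩ :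
    Subgroup.centralizer {y})) ⟨?_, ?_⟩ _ _ fun _ => rfl
  · exact ((Commute.refl y).pow_left _).mul_left (show Commute (p.2 : G) y from h.comm _ p.2.2)
  · intro p q hpq
    exact pow_mul_injective hy h.odd (congrArg Subtype.val hpq)
  · rintro ⟨g, hg⟩
    obtain ⟨r, hr, k, hk, e⟩ := h.split g ((hmem g).mp hg)
    exact ⟨⟨⟨r, hr⟩, k, hk⟩, Subtype.ext e.symm⟩

theorem IsOddPart.card_centralizer {y j : G} {O : Subgroup G} (h : IsOddPart y j O)
    (hy : orderOf y = 4) : Nat.card (Subgroup.centralizer {y}) = 4 * Nat.card O := by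
  have := h.sum_eq hy fun _ => 1
  simp only [Finset.sum_const, Finset.card_univ, Finset.card_range, nsmul_eq_mul, mul_one,
    ← Nat.card_eq_fintype_card] at this
  exact_mod_cast this

theorem IsOddPart.sum_conj {y j : G} {O : Subgroup G} (h : IsOddPart y j O) (F : G → ℂ) :
    ∑ k : O, F (j * k * j⁻¹) = ∑ k : O, F k := by
  refine Fintype.sum_bijective (fun k : O => (⟨j * k * j⁻¹, h.conj k k.2⟩ : O)) ?_ _ _ fun _ => rfl
  refine (Finite.injective_iff_bijective).mp fun a b hab => Subtype.ext ?_
  have := congrArg Subtype.val hab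
  simpa using this

theorem IsMinIso.exists_virtual (hm : IsMinIso t) {y j : G} (hy : orderOf y = 4)
    (hj : j * y * j⁻¹ = y⁻¹) : ∃ θ : G → ℂ, IsClassFun θ ∧ (∀ g, ¬ 4 ∣ orderOf g → θ g = 0) ∧
      (∀ χ, IsIrrChar χ → ∃ n : ℤ, charPair θ χ = n) ∧ charPair θ (fun _ => 1) = 1 ∧
      (charPair θ θ = 3 ∨ charPair θ θ = 4 ∧ ∃ O, IsOddPart y j O ∧
        ∀ χ, IsClassFun χ → charPair θ χ = (Nat.card O : ℂ)⁻¹ * ∑ k : O, χ (y * k)) := by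
  obtain ⟨ξ, hξ4, hξ1, hξO⟩ := hm.exists_special hy hj
  have hmem : ∀ g, g ∈ Subgroup.centralizer {y} ↔ g * y = y * g :=
    fun g => Subgroup.mem_centralizer_singleton_iff
  let f : G → ℂ := fun g => if h : g ∈ Subgroup.centralizer {y} then 1 - ξ ⟨g, h⟩ else 0
  have hf : ∀ g (h : g ∈ Subgroup.centralizer {y}), f g = 1 - ξ ⟨g, h⟩ := fun g h => dif_pos h
  have hfC : ∀ c : Subgroup.centralizer {y}, f c = 1 - ξ c := fun c => hf c c.2
  have hf0 : ∀ g, g ∉ Subgroup.centralizer {y} → f g = 0 := fun g h => dif_neg h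
  have hf4 : ∀ g, f g ≠ 0 → g * y = y * g ∧ 4 ∣ orderOf g := by
    intro g hg
    by_cases h : g ∈ Subgroup.centralizer {y}
    · refine ⟨(hmem g).mp h, hξ4 ⟨g, h⟩ fun h1 => hg ?_⟩
      rw [hf g h, h1, sub_self]
    · exact absurd (hf0 g h) hg
  have hyy : y ≠ y⁻¹ := fun h => by
    have := orderOf_dvd_of_pow_eq_one (x := y) (n := 2) (by rw [pow_two, ← eq_inv_iff_mul_eq_one]; exact h)
    rw [hy] at this; omega
  have hfconj : ∀ c ∈ Subgroup.centralizer {y}, ∀ g, f (c * g * c⁻¹) = f g := by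
    intro c hc g
    by_cases h : g ∈ Subgroup.centralizer {y}
    · have h1 := mul_mem (mul_mem hc h) (inv_mem hc)
      rw [hf _ h, hf _ h1]
      have : (⟨c * g * c⁻¹, h1⟩ : Subgroup.centralizer {y}) = ⟨c, hc⟩ * ⟨g, h⟩ * ⟨c, hc⟩⁻¹ := rfl
      rw [this, map_mul, map_mul, mul_comm (ξ _) (ξ ⟨g, h⟩), mul_assoc, ← map_mul, mul_inv_cancel,
        map_one, mul_one]
    · rw [hf0 g h, hf0]
      intro h1
      have := mul_mem (mul_mem (inv_mem hc) h1) hc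
      rw [show c⁻¹ * (c * g * c⁻¹) * c = g by group] at this
      exact h this
  have hjC : ∀ g, g ∈ Subgroup.centralizer {y} → j * g * j⁻¹ ∈ Subgroup.centralizer {y} := by
    intro g hg
    rw [hmem] at hg ⊢
    have h1 : Commute g y := hg
    have h2 : j * g * j⁻¹ * y⁻¹ = y⁻¹ * (j * g * j⁻¹) := by
      rw [← hj, conj_mul, conj_mul, h1.eq]
    have h3 : Commute (j * g * j⁻¹) y⁻¹ := h2
    exact (Commute.inv_right_iff.mp h3).eq
  let jh : Subgroup.centralizer {y} →* Subgroup.centralizer {y} :=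
    MonoidHom.mk' (fun c => ⟨j * c * j⁻¹, hjC c c.2⟩) fun a b => Subtype.ext conj_mul.symm
  have hC0 := cardC_ne_zero (Subgroup.centralizer {y})
  have hpair : ∀ χ : G → ℂ, IsClassFun χ → charPair (inducedFun (Subgroup.centralizer {y}) f) χ =
      (Nat.card (Subgroup.centralizer {y}) : ℂ)⁻¹ *
        ∑ c : Subgroup.centralizer {y}, (1 - ξ c) * χ (c : G)⁻¹ := by
    intro χ hχ
    rw [charPair_inducedFun _ _ hχ, sum_eq_sum_subgroup (Subgroup.centralizer {y})
      (fun g hg => by rw [hf0 g hg, zero_mul])]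
    simp_rw [hfC]
  have hξne : ξ ≠ 1 := fun h => by
    obtain ⟨c, hc⟩ := hξ1
    exact hc (by rw [h]; rfl)
  have hξsum : ∑ c, ξ c = 0 := sum_hom_units_eq_zero ξ hξne
  have hξinv : ∑ c, ξ c⁻¹ = 0 := by rw [← hξsum]; exact Equiv.sum_comp (Equiv.inv _) ξ
  refine ⟨inducedFun (Subgroup.centralizer {y}) f, inducedFun_isClassFun _ _, ?_, ?_, ?_, ?_⟩
  · intro g hg
    unfold inducedFun
    rw [Finset.sum_eq_zero, mul_zero]
    intro x _
    by_contra h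
    have := (hf4 _ h).2
    rw [show orderOf (x * g * x⁻¹) = orderOf g from MulEquiv.orderOf_eq (MulAut.conj x) g] at this
    exact hg this
  · rintro χ ⟨n, ρ, hρ, rfl⟩
    obtain ⟨a, ha⟩ := sum_linear_mul_character (Subgroup.centralizer {y}) 1 ρ
    obtain ⟨b, hb⟩ := sum_linear_mul_character (Subgroup.centralizer {y}) ξ ρ
    refine ⟨a - b, ?_⟩
    rw [hpair _ (character_isClassFun ρ)]
    push_cast
    rw [← ha, ← hb, ← mul_sub, ← Finset.sum_sub_distrib]
    congr 1
    refine Finset.sum_congr rfl fun c _ => ?_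
    simp [sub_mul]
  · rw [hpair _ fun _ _ => rfl]
    simp only [mul_one, Finset.sum_sub_distrib, hξsum, sub_zero, Finset.sum_const, Finset.card_univ,
      nsmul_eq_mul, ← Nat.card_eq_fintype_card]
    exact inv_mul_cancel₀ hC0
  · have hval : ∀ c : Subgroup.centralizer {y}, (1 - ξ c) *
        inducedFun (Subgroup.centralizer {y}) f (c : G)⁻¹ =
        (1 - ξ c) * ((1 - ξ c⁻¹) + (1 - ξ (jh c⁻¹))) := by
      intro c
      by_cases h0 : 1 - ξ c = 0
      · rw [h0, zero_mul, zero_mul]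
      congr 1
      have hcf : f c ≠ 0 := by rwa [hfC]
      have hyc := hm.mem_zpowers_of_four_dvd hy (hf4 _ hcf).1 (hf4 _ hcf).2
      have hsupp : ∀ x, f (x * (c : G)⁻¹ * x⁻¹) ≠ 0 → x * y * x⁻¹ = y ∨ x * y * x⁻¹ = y⁻¹ := by
        intro x hx
        refine hm.order_four_commute hy ?_ ?_
        · rw [← hy]; exact MulEquiv.orderOf_eq (MulAut.conj x) y
        · obtain ⟨i, hi⟩ := hyc
          have hi : (c : G) ^ i = y := hi
          have h1 : Commute (x * (c : G)⁻¹ * x⁻¹) y := (hf4 _ hx).1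
          have h2 : x * y * x⁻¹ = (x * (c : G)⁻¹ * x⁻¹) ^ (-i) := by
            rw [conj_zpow, inv_zpow, zpow_neg, inv_inv, hi]
          rw [h2]
          exact (h1.zpow_left _).eq
      have hsplit : ∀ x, f (x * (c : G)⁻¹ * x⁻¹) =
          (if x * y * x⁻¹ = y then f (x * (c : G)⁻¹ * x⁻¹) else 0) +
          (if x * y * x⁻¹ = y⁻¹ then f (x * (c : G)⁻¹ * x⁻¹) else 0) := by
        intro x
        by_cases h : f (x * (c : G)⁻¹ * x⁻¹) = 0
        · simp [h]
        · rcases hsupp x h with h1 | h1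
          · rw [if_pos h1, if_neg (by rw [h1]; exact hyy), add_zero]
          · rw [if_neg (by rw [h1]; exact hyy.symm), if_pos h1, zero_add]
      have hC' : ∀ x, x * y * x⁻¹ = y ↔ x ∈ Subgroup.centralizer {y} := fun x => by
        rw [hmem, mul_inv_eq_iff_eq_mul]
      unfold inducedFun
      rw [Finset.sum_congr rfl fun x _ => hsplit x, Finset.sum_add_distrib,
        ← Equiv.sum_comp (Equiv.mulRight j) fun x =>
          (if x * y * x⁻¹ = y⁻¹ then f (x * (c : G)⁻¹ * x⁻¹) else 0),
        sum_eq_sum_subgroup (Subgroup.centralizer {y})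
          (fun x hx => if_neg (by rwa [hC'])),
        sum_eq_sum_subgroup (Subgroup.centralizer {y}) (fun x hx => if_neg ?_)]
      · have h1 : ∀ d : Subgroup.centralizer {y}, (if (d : G) * y * (d : G)⁻¹ = y then
            f ((d : G) * (c : G)⁻¹ * (d : G)⁻¹) else 0) = 1 - ξ c⁻¹ := by
          intro d
          rw [if_pos ((hC' _).mpr d.2), hfconj _ d.2, ← hfC]; rfl
        have h2 : ∀ d : Subgroup.centralizer {y}, (if Equiv.mulRight j (d : G) * y *
            (Equiv.mulRight j (d : G))⁻¹ = y⁻¹ then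
            f (Equiv.mulRight j (d : G) * (c : G)⁻¹ * (Equiv.mulRight j (d : G))⁻¹) else 0) =
            1 - ξ (jh c⁻¹) := by
          intro d
          have h3 : ∀ g, Equiv.mulRight j (d : G) * g * (Equiv.mulRight j (d : G))⁻¹ =
            d * (j * g * j⁻¹) * (d : G)⁻¹ := fun g => by simp [mul_assoc]
          rw [h3, h3, hj, if_pos, hfconj _ d.2, ← hfC]
          · rfl
          · have h4 := (hC' _).mpr d.2
            calc (d : G) * y⁻¹ * (d : G)⁻¹ = ((d : G) * y * (d : G)⁻¹)⁻¹ := by group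
              _ = y⁻¹ := by rw [h4]
        rw [Finset.sum_congr rfl fun d _ => h1 d, Finset.sum_congr rfl fun d _ => h2 d]
        simp only [Finset.sum_const, Finset.card_univ, nsmul_eq_mul, ← Nat.card_eq_fintype_card]
        rw [← mul_add, inv_mul_cancel_left₀ hC0]
      · intro h
        apply hx
        rw [← hC']
        have h3 : Equiv.mulRight j x * y * (Equiv.mulRight j x)⁻¹ =
            (x * y * x⁻¹)⁻¹ := by
          rw [show (x * y * x⁻¹)⁻¹ = x * y⁻¹ * x⁻¹ by group, ← hj]; simp [mul_assoc]
        rw [h3] at h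
        exact inv_injective h
    let η : Subgroup.centralizer {y} →* ℂ :=
      { toFun := fun c => ξ c * ξ (jh c⁻¹)
        map_one' := by simp
        map_mul' := fun a b => by
          rw [mul_inv_rev, map_mul, map_mul, map_mul]; ring }
    have hη : ∀ c, η c = ξ c * ξ (jh c⁻¹) := fun c => rfl
    have hnorm : charPair (inducedFun (Subgroup.centralizer {y}) f)
        (inducedFun (Subgroup.centralizer {y}) f) =
        3 + (Nat.card (Subgroup.centralizer {y}) : ℂ)⁻¹ * ∑ c, η c := by
      rw [hpair _ (inducedFun_isClassFun _ _), Finset.sum_congr rfl fun c _ => hval c]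
      have h1 : ∀ c, (1 - ξ c) * ((1 - ξ c⁻¹) + (1 - ξ (jh c⁻¹))) =
          3 - 2 * ξ c - ξ c⁻¹ - ξ (jh c⁻¹) + η c := fun c => by
        have : ξ c * ξ c⁻¹ = 1 := by rw [← map_mul, mul_inv_cancel, map_one]
        rw [hη]; linear_combination this
      have h2 : ∑ c, ξ (jh c⁻¹) = 0 := by
        have hne : ξ.comp jh ≠ 1 := by
          intro h
          obtain ⟨c, hc⟩ := hξ1
          apply hc
          have h3 : ∀ a, ξ (jh a) = 1 := fun a => DFunLike.congr_fun h a
          have hinj : Function.Injective jh := fun a b hab => Subtype.ext (by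
            have h5 : j * (a : G) * j⁻¹ = j * b * j⁻¹ := congrArg Subtype.val hab
            simpa using h5)
          obtain ⟨a, rfl⟩ := (Finite.injective_iff_surjective.mp hinj) c
          exact h3 a
        rw [← sum_hom_units_eq_zero _ hne]
        exact Equiv.sum_comp (Equiv.inv _) (ξ.comp jh)
      rw [Finset.sum_congr rfl fun c _ => h1 c]
      simp only [Finset.sum_add_distrib, Finset.sum_sub_distrib, ← Finset.mul_sum, hξsum, hξinv, h2,
        Finset.sum_const, Finset.card_univ, nsmul_eq_mul, ← Nat.card_eq_fintype_card]
      field_simp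
      ring
    rw [hnorm]
    by_cases hη1 : η = 1
    · right
      constructor
      · rw [hη1]
        simp only [MonoidHom.one_apply, Finset.sum_const, Finset.card_univ, nsmul_eq_mul,
          ← Nat.card_eq_fintype_card, mul_one]
        rw [inv_mul_cancel₀ hC0]; norm_num
      · obtain ⟨O, hO1, hO2, hO3, hO4⟩ := hξO (by
          intro c c' h
          have h1 : c' = jh c := Subtype.ext h
          have h2 : ξ c * ξ (jh c⁻¹) = 1 := by rw [← hη, hη1]; rfl
          have h3 : ξ (jh c⁻¹) * ξ (jh c) = 1 := by rw [← map_mul, ← map_mul]; simp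
          rw [h1]
          linear_combination ξ c * h3 - ξ (jh c) * h2)
        have hOO : IsOddPart y j O := ⟨hO1, hO2, hO3, fun k hk =>
          mem_of_odd_of_split hy hO2 hO3 ((hmem _).mp (hjC k ((hmem k).mpr (hO2 k hk)))) (by
            rw [show orderOf (j * k * j⁻¹) = orderOf k from MulEquiv.orderOf_eq (MulAut.conj j) k]
            exact hO1.of_dvd_nat (Subgroup.orderOf_dvd_natCard _ hk)) hO1⟩
        refine ⟨O, hOO, fun χ hχ => ?_⟩
        rw [hpair χ hχ, hOO.card_centralizer hy]
        have h1 : ∑ c : Subgroup.centralizer {y}, (1 - ξ c) * χ (c : G)⁻¹ =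
            ∑ c : Subgroup.centralizer {y}, f c * χ (c : G)⁻¹ := by simp_rw [hfC]
        rw [h1, hOO.sum_eq hy fun g => f g * χ g⁻¹]
        have h2 : ∀ (r : ℕ) (k : O), f (y ^ r * k) = 1 - (-1) ^ r := fun r k => by
          have hk : y ^ r * (k : G) ∈ Subgroup.centralizer {y} := (hmem _).mpr
            (((Commute.refl y).pow_left _).mul_left (show Commute (k : G) y from hO2 _ k.2))
          rw [hf _ hk, hO4 r k ⟨_, hk⟩ k.2 rfl]
        simp_rw [h2]
        have hinvsum : ∀ F : G → ℂ, ∑ k : O, F (k : G)⁻¹ = ∑ k : O, F k := fun F =>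
          Equiv.sum_comp (Equiv.inv O) fun k : O => F k
        have hcomm : ∀ k : O, Commute (k : G) y := fun k => hO2 k k.2
        have h3 : ∑ k : O, χ (y ^ 1 * (k : G))⁻¹ = ∑ k : O, χ (y * k) := by
          rw [← hOO.sum_conj fun g => χ (y * g), ← hinvsum fun g => χ (y * (j * g * j⁻¹))]
          refine Finset.sum_congr rfl fun k _ => ?_
          rw [← hχ j]
          congr 1
          have h4 : y = j * y⁻¹ * j⁻¹ := by
            rw [show j * y⁻¹ * j⁻¹ = (j * y * j⁻¹)⁻¹ by group, hj, inv_inv]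
          rw [pow_one, mul_inv_rev, ((hcomm k).inv_inv).eq]
          conv_rhs => rw [h4]
          group
        have h4 : ∑ k : O, χ (y ^ 3 * (k : G))⁻¹ = ∑ k : O, χ (y * k) := by
          rw [← hinvsum fun g => χ (y * g)]
          refine Finset.sum_congr rfl fun k _ => ?_
          congr 1
          have h5 : (y ^ 3)⁻¹ = y := by
            rw [inv_eq_iff_mul_eq_one, ← pow_succ]
            have h6 := pow_orderOf_eq_one y
            rwa [hy] at h6
          rw [mul_inv_rev, h5, (hcomm k).inv_left.eq]
        have hO0 := cardC_ne_zero O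
        simp only [Finset.sum_range_succ, Finset.sum_range_zero, ← Finset.mul_sum, h3, h4]
        push_cast
        field_simp
        ring
    · left
      rw [sum_hom_units_eq_zero η hη1, mul_zero, add_zero]

end virtualChar

section realChar
open Representation Module
open scoped Classical
universe v
variable {G : Type v} [Group G] [Fintype G] {t : G}

theorem IsMinIso.exists_real_char (hm : IsMinIso t) {y j : G} (hyt : y * y = t)
    (hj : j * y * j⁻¹ = y⁻¹) : ∃ O, IsOddPart y j O ∧ ∃ χ, IsIrrChar χ ∧ χ t ≠ χ 1 ∧
      (∀ g, χ g⁻¹ = χ g) ∧ (∃ n : ℕ, Odd n ∧ χ 1 = n) ∧ ∃ ε : ℤ, (ε = 1 ∨ ε = -1) ∧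
      (ε : ℂ) = (Nat.card O : ℂ)⁻¹ * ∑ k : O, χ (y * k) := by
  have hy := orderOf_eq_four hyt hm.iso.1 hm.ne_one
  obtain ⟨θ, hθc, hθ0, hθn, hθ1, hθ⟩ := hm.exists_virtual hy hj
  have hone : (fun _ => 1) ∈ irr G := mem_irr.mpr isIrrChar_one
  let N : (G → ℂ) → ℂ := fun χ => charPair θ χ
  let m : (G → ℂ) → ℂ := fun χ => χ t / χ 1
  let T := ((irr G).erase fun _ => 1).filter fun χ => N χ ≠ 0
  have hT : ∀ χ ∈ T, IsIrrChar χ ∧ χ ≠ (fun _ => 1) ∧ N χ ≠ 0 := fun χ h => by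
    simp only [T, Finset.mem_filter, Finset.mem_erase, mem_irr] at h
    exact ⟨h.1.2, h.1.1, h.2⟩
  have hT' : ∀ χ, IsIrrChar χ → χ ≠ (fun _ => 1) → N χ ≠ 0 → χ ∈ T := fun χ h1 h2 h3 => by
    simp only [T, Finset.mem_filter, Finset.mem_erase, mem_irr]
    exact ⟨⟨h2, h1⟩, h3⟩
  have hm1 : ∀ χ ∈ T, m χ ≠ 1 := fun χ h h1 => (hT χ h).2.1 (hm.eq_one_of_irr (hT χ h).1
    ((div_eq_one_iff_eq (irr_one_ne_zero (hT χ h).1)).mp h1))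
  have hsum : ∀ F : (G → ℂ) → ℂ, ∑ χ ∈ irr G, N χ * F χ = F (fun _ => 1) + ∑ χ ∈ T, N χ * F χ := by
    intro F
    rw [← Finset.add_sum_erase _ _ hone, Finset.sum_filter_of_ne]
    · rw [show N (fun _ => 1) = 1 from hθ1, one_mul]
    · intro χ _ h h0
      exact h (by rw [h0, zero_mul])
  have hnot : ∀ g : G, g ^ 2 = 1 ∨ Odd (orderOf g) → ¬ 4 ∣ orderOf g := by
    rintro g (h | h) h4
    · have := Nat.le_of_dvd two_pos (h4.trans (orderOf_dvd_of_pow_eq_one h))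
      omega
    · have : 2 ∣ orderOf g := dvd_trans (by norm_num) h4
      exact (Nat.not_even_iff_odd.mpr h) (even_iff_two_dvd.mpr this)
  have hs0 : 1 + ∑ χ ∈ T, N χ * χ 1 = 0 := by
    rw [← hsum fun χ => χ 1, ← classFun_expand hθc]
    exact hθ0 _ (hnot _ (Or.inl (one_pow 2)))
  have hs1 : 1 + ∑ χ ∈ T, N χ * χ t = 0 := by
    rw [← hsum fun χ => χ t, ← classFun_expand hθc]
    exact hθ0 _ (hnot _ (Or.inl (by rw [pow_two, hm.iso.1])))
  have hs2 : 1 + ∑ χ ∈ T, N χ * (χ t * m χ) = 0 := by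
    have hcard : ((Finset.univ.filter (IsConj t)).card : ℂ) ≠ 0 := by
      exact_mod_cast (Finset.card_pos.mpr ⟨t, Finset.mem_filter.mpr ⟨Finset.mem_univ t, IsConj.refl t⟩⟩).ne'
    have h1 : ∑ χ ∈ irr G, N χ * (χ t * m χ) = 0 := by
      have h2 : ∀ χ ∈ irr G, N χ * (χ t * m χ) =
          ((Finset.univ.filter (IsConj t)).card : ℂ)⁻¹ *
            ∑ x ∈ Finset.univ.filter (IsConj t), N χ * χ (x * t) := by
        intro χ hχ
        have h3 := irr_one_ne_zero (mem_irr.mp hχ)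
        have h4 := irr_conj_sum (mem_irr.mp hχ) t t
        rw [← Finset.mul_sum]
        simp only [m]
        field_simp
        linear_combination -N χ * h4
      rw [Finset.sum_congr rfl h2, ← Finset.mul_sum, Finset.sum_comm, Finset.sum_eq_zero, mul_zero]
      intro x hx
      rw [← classFun_expand hθc]
      exact hθ0 _ (hnot _ (Or.inr (hm.iso.odd_mul (Finset.mem_filter.mp hx).2 (IsConj.refl t))))
    rw [hsum] at h1
    simpa [m] using h1
  have htwo : ∀ a b : ℂ, a ≠ 1 → b ≠ 1 → ¬ ∀ χ ∈ T, m χ = a ∨ m χ = b := by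
    intro a b ha hb h
    have h1 : ∑ χ ∈ T, N χ * χ 1 * ((m χ - a) * (m χ - b)) = 0 := by
      refine Finset.sum_eq_zero fun χ hχ => ?_
      rcases h χ hχ with h | h <;> rw [h] <;> ring
    have h2 : ∑ χ ∈ T, N χ * χ 1 * ((m χ - a) * (m χ - b)) =
        ∑ χ ∈ T, N χ * (χ t * m χ) - (a + b) * ∑ χ ∈ T, N χ * χ t + a * b * ∑ χ ∈ T, N χ * χ 1 := by
      rw [Finset.mul_sum, Finset.mul_sum, ← Finset.sum_sub_distrib, ← Finset.sum_add_distrib]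
      refine Finset.sum_congr rfl fun χ hχ => ?_
      have h3 := irr_one_ne_zero (hT χ hχ).1
      simp only [m]
      field_simp
      ring
    rw [h1] at h2
    have h4 : (1 - a) * (1 - b) = 0 := by
      linear_combination hs2 - (a + b) * hs1 + a * b * hs0 + h2
    rcases mul_eq_zero.mp h4 with h | h
    · exact ha (by linear_combination -h)
    · exact hb (by linear_combination -h)
  choose! n hn using hθn
  have hnT : ∀ χ ∈ T, 1 ≤ n χ ^ 2 := fun χ h => by
    have h0 : n χ ≠ 0 := fun h0 => (hT χ h).2.2 (by
      simp only [N]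
      rw [hn χ (hT χ h).1, h0, Int.cast_zero])
    have := sq_pos_of_ne_zero h0
    omega
  have hnorm : charPair θ θ = 1 + ((∑ χ ∈ T, n χ ^ 2 : ℤ) : ℂ) := by
    rw [parseval hθc, hsum fun χ => N χ, show N (fun _ => 1) = 1 from hθ1]
    push_cast
    congr 1
    refine Finset.sum_congr rfl fun χ h => ?_
    simp only [N]
    rw [hn χ (hT χ h).1]; ring
  have hcardT : (T.card : ℤ) ≤ ∑ χ ∈ T, n χ ^ 2 := by
    have := Finset.sum_le_sum hnT
    simpa using this
  have h3 : 3 ≤ T.card := by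
    by_contra hlt
    have hne : T.card = 0 ∨ T.card = 1 ∨ T.card = 2 := by omega
    rcases hne with h | h | h
    · rw [Finset.card_eq_zero] at h
      exact htwo 0 0 zero_ne_one zero_ne_one (by simp [h])
    · obtain ⟨χ, h⟩ := Finset.card_eq_one.mp h
      refine htwo (m χ) (m χ) (hm1 χ (by simp [h])) (hm1 χ (by simp [h])) (by simp [h])
    · obtain ⟨χ, ψ, _, h⟩ := Finset.card_eq_two.mp h
      refine htwo (m χ) (m ψ) (hm1 χ (by simp [h])) (hm1 ψ (by simp [h])) (by simp [h])
  rcases hθ with h | ⟨h, O, hO, hON⟩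
  · rw [hnorm] at h
    have : (1 + ∑ χ ∈ T, n χ ^ 2 : ℤ) = 3 := by exact_mod_cast h
    omega
  refine ⟨O, hO, ?_⟩
  have hsum3 : ∑ χ ∈ T, n χ ^ 2 = 3 := by
    rw [hnorm] at h
    have : (1 + ∑ χ ∈ T, n χ ^ 2 : ℤ) = 4 := by exact_mod_cast h
    omega
  have hcard : T.card = 3 := by omega
  have hn1 : ∀ χ ∈ T, n χ = 1 ∨ n χ = -1 := by
    intro χ hχ
    have h1 : ∑ χ ∈ T, (n χ ^ 2 - 1) = 0 := by
      rw [Finset.sum_sub_distrib, hsum3]; simp [hcard]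
    have h2 := (Finset.sum_eq_zero_iff_of_nonneg fun χ h => sub_nonneg.mpr (hnT χ h)).mp h1 χ hχ
    exact sq_eq_one_iff.mp (by linarith)
  have hminj : ∀ χ ∈ T, ∀ ψ ∈ T, m χ = m ψ → χ = ψ := by
    intro χ hχ ψ hψ he
    by_contra hne
    have h1 : ((T.erase χ).erase ψ).card = 1 := by
      rw [Finset.card_erase_of_mem (Finset.mem_erase.mpr ⟨Ne.symm hne, hψ⟩),
        Finset.card_erase_of_mem hχ, hcard]
    obtain ⟨φ, hφ⟩ := Finset.card_eq_one.mp h1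
    have hφT : φ ∈ T := Finset.mem_of_mem_erase (Finset.mem_of_mem_erase
      (hφ ▸ Finset.mem_singleton_self φ))
    refine htwo (m χ) (m φ) (hm1 χ hχ) (hm1 φ hφT) fun κ hκ => ?_
    by_cases h2 : κ = χ
    · left; rw [h2]
    by_cases h3 : κ = ψ
    · left; rw [h3, he]
    · right
      have : κ ∈ (T.erase χ).erase ψ := Finset.mem_erase.mpr ⟨h3, Finset.mem_erase.mpr ⟨h2, hκ⟩⟩
      rw [hφ, Finset.mem_singleton] at this
      rw [this]
  have hdeg : ∀ χ : G → ℂ, IsIrrChar χ → ∃ d : ℕ, χ 1 = d := by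
    rintro χ ⟨d, ρ, _, rfl⟩
    exact ⟨d, by rw [char_one]; simp⟩
  choose! d hd using hdeg
  have hoddT : ∃ χ ∈ T, Odd (d χ) := by
    by_contra hcon
    push Not at hcon
    have h1 : (1 + ∑ χ ∈ T, n χ * d χ : ℤ) = 0 := by
      have : ((1 + ∑ χ ∈ T, n χ * d χ : ℤ) : ℂ) = 0 := by
        push_cast
        rw [← hs0]
        congr 1
        refine Finset.sum_congr rfl fun χ hχ => ?_
        simp only [N]
        rw [hn χ (hT χ hχ).1, hd χ (hT χ hχ).1]
      exact_mod_cast this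
    have h2 : (2 : ℤ) ∣ ∑ χ ∈ T, n χ * d χ := Finset.dvd_sum fun χ hχ => by
      refine Dvd.dvd.mul_left ?_ _
      exact_mod_cast even_iff_two_dvd.mp (Nat.not_odd_iff_even.mp (hcon χ hχ))
    omega
  obtain ⟨χ, hχ, hodd⟩ := hoddT
  refine ⟨χ, (hT χ hχ).1, fun h => hm1 χ hχ (by
    simp only [m]; rw [h, div_self (irr_one_ne_zero (hT χ hχ).1)]), ?_,
    ⟨d χ, hodd, hd χ (hT χ hχ).1⟩, n χ, hn1 χ hχ, ?_⟩
  · have hχc := (hT χ hχ).1.isClassFun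
    have hinvc : IsClassFun fun g => χ g⁻¹ := (hT χ hχ).1.comp_inv.isClassFun
    have hNinv : N (fun g => χ g⁻¹) = N χ := by
      simp only [N]
      rw [hON _ hinvc, hON _ hχc]
      congr 1
      have hinvsum : ∀ F : G → ℂ, ∑ k : O, F (k : G)⁻¹ = ∑ k : O, F k := fun F =>
        Equiv.sum_comp (Equiv.inv O) fun k : O => F k
      rw [← hO.sum_conj fun g => χ (y * g), ← hinvsum fun g => χ (y * (j * g * j⁻¹))]
      refine Finset.sum_congr rfl fun k _ => ?_
      rw [← hχc j]
      congr 1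
      have h4 : y = j * y⁻¹ * j⁻¹ := by
        rw [show j * y⁻¹ * j⁻¹ = (j * y * j⁻¹)⁻¹ by group, hj, inv_inv]
      have hcomm : Commute (k : G) y := hO.comm k k.2
      rw [mul_inv_rev, (hcomm.inv_inv).eq]
      conv_rhs => rw [h4]
      group
    have h1 : (fun g => χ g⁻¹) = χ := by
      refine hminj _ (hT' _ (hT χ hχ).1.comp_inv ?_ ?_) χ hχ ?_
      · intro h
        apply (hT χ hχ).2.1
        funext g
        have := congrFun h g⁻¹
        simpa using this
      · rw [hNinv]; exact (hT χ hχ).2.2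
      · simp only [m]
        rw [inv_one, inv_eq_of_mul_eq_one_left hm.iso.1]
    intro g
    exact congrFun h1 g
  · rw [← hn χ (hT χ hχ).1, hON χ (hT χ hχ).1.isClassFun]

end realChar

section diagonal
open Representation Module
open scoped Classical Polynomial
universe v
variable {V : Type*} [AddCommGroup V] [Module ℂ V] [FiniteDimensional ℂ V]

theorem exists_eigenbasis {f : End ℂ V} {p : ℂ[X]} (hp : Squarefree p)
    (hf : Polynomial.aeval f p = 0) : ∃ (b : Basis (Fin (finrank ℂ V)) ℂ V)
      (d : Fin (finrank ℂ V) → ℂ), (∀ i, f (b i) = d i • b i) ∧ ∀ i, p.eval (d i) = 0 := by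
  have hs : f.IsSemisimple := Module.End.isSemisimple_of_squarefree_aeval_eq_zero hp hf
  let eigenDecomp := DirectSum.isInternal_submodule_of_iSupIndep_of_iSup_eq_top
    f.eigenspaces_iSupIndep hs.iSup_eigenspace_eq_top
  let v := eigenDecomp.collectedBasis fun μ ↦ finBasis ℂ (f.eigenspace μ)
  have : Fintype ((ν : ℂ) × Fin (finrank ℂ (f.eigenspace ν))) := FiniteDimensional.fintypeBasisIndex v
  have hv (i) : f (v i) = i.1 • v i :=
    End.mem_eigenspace_iff.mp (eigenDecomp.collectedBasis_mem _ i)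
  let e := Fintype.equivFinOfCardEq (finrank_eq_card_basis v).symm
  have hb : ∀ i, f ((v.reindex e) i) = (e.symm i).1 • (v.reindex e) i := fun i => by
    rw [Basis.reindex_apply, hv]
  refine ⟨v.reindex e, fun i => (e.symm i).1, hb, fun i => ?_⟩
  have h := Module.End.aeval_apply_of_hasEigenvector (p := p)
    (End.hasEigenvector_iff.mpr ⟨End.mem_eigenspace_iff.mpr (hb i), (v.reindex e).ne_zero i⟩)
  rw [hf] at h
  exact (smul_eq_zero.mp h.symm).resolve_right ((v.reindex e).ne_zero i)

theorem exists_eigenbasis_of_pow_eq_one {f : End ℂ V} {n : ℕ} (hn : n ≠ 0) (hf : f ^ n = 1) :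
    ∃ (b : Basis (Fin (finrank ℂ V)) ℂ V) (d : Fin (finrank ℂ V) → ℂ),
      (∀ i, f (b i) = d i • b i) ∧ ∀ i, d i ^ n = 1 := by
  obtain ⟨b, d, hb, hd⟩ := exists_eigenbasis (f := f) (p := Polynomial.X ^ n - 1)
    (Polynomial.X_pow_sub_one_separable_iff.mpr (by exact_mod_cast hn)).squarefree (by simp [hf])
  exact ⟨b, d, hb, fun i => by simpa [sub_eq_zero] using hd i⟩

theorem toMatrix_eq_diagonal {n : ℕ} {f : End ℂ V} {b : Basis (Fin n) ℂ V} {d : Fin n → ℂ}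
    (h : ∀ i, f (b i) = d i • b i) : LinearMap.toMatrix b b f = Matrix.diagonal d := by
  ext i j
  rw [LinearMap.toMatrix_apply, h, map_smul, Matrix.diagonal_apply, Basis.repr_self]
  by_cases hij : i = j
  · simp [hij]
  · simp [hij]

theorem trace_eq_sum {n : ℕ} {f : End ℂ V} {b : Basis (Fin n) ℂ V} {d : Fin n → ℂ}
    (h : ∀ i, f (b i) = d i • b i) : LinearMap.trace ℂ V f = ∑ i, d i := by
  rw [LinearMap.trace_eq_matrix_trace ℂ b, toMatrix_eq_diagonal h, Matrix.trace_diagonal]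

theorem det_eq_prod {n : ℕ} {f : End ℂ V} {b : Basis (Fin n) ℂ V} {d : Fin n → ℂ}
    (h : ∀ i, f (b i) = d i • b i) : LinearMap.det f = ∏ i, d i := by
  rw [← LinearMap.det_toMatrix b, toMatrix_eq_diagonal h, Matrix.det_diagonal]

theorem pow_apply_eigen {f : End ℂ V} {v : V} {d : ℂ} (h : f v = d • v) (k : ℕ) :
    (f ^ k) v = d ^ k • v := by
  induction k with
  | zero => simp
  | succ k ih => rw [pow_succ', Module.End.mul_apply, ih, map_smul, h, smul_smul, pow_succ]

variable {G : Type v} [Group G] [Finite G]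

/-- Simultaneous diagonal form of the powers of one element. -/
theorem exists_diagonal (ρ : Representation ℂ G V) (x : G) :
    ∃ (b : Basis (Fin (finrank ℂ V)) ℂ V) (d : Fin (finrank ℂ V) → ℂ),
      (∀ i (k : ℕ), ρ (x ^ k) (b i) = d i ^ k • b i) ∧ (∀ i, d i ^ orderOf x = 1) ∧
      (∀ k : ℕ, ρ.character (x ^ k) = ∑ i, d i ^ k) := by
  obtain ⟨b, d, hb, hd⟩ := exists_eigenbasis_of_pow_eq_one (f := ρ x) (orderOf_pos x).ne'
    (by rw [← map_pow, pow_orderOf_eq_one, map_one])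
  have h : ∀ i (k : ℕ), ρ (x ^ k) (b i) = d i ^ k • b i := fun i k => by
    rw [map_pow, pow_apply_eigen (hb i)]
  exact ⟨b, d, h, hd, fun k => trace_eq_sum fun i => h i k⟩

theorem conj_character (ρ : Representation ℂ G V) (x : G) :
    (starRingEnd ℂ) (ρ.character x) = ρ.character x⁻¹ := by
  obtain ⟨b, d, -, hd, h⟩ := exists_diagonal ρ x
  have h1 := h 1
  have h2 := h (orderOf x - 1)
  have hx : x ^ (orderOf x - 1) = x⁻¹ := by
    rw [eq_inv_iff_mul_eq_one, ← pow_succ, Nat.sub_add_cancel (orderOf_pos x), pow_orderOf_eq_one]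
  rw [pow_one] at h1
  rw [← hx, h1, h2, map_sum]
  refine Finset.sum_congr rfl fun i _ => ?_
  have hn : ‖d i‖ = 1 := Complex.norm_eq_one_of_pow_eq_one (hd i) (orderOf_pos x).ne'
  have h0 : d i ≠ 0 := by rw [← norm_ne_zero_iff, hn]; norm_num
  rw [pow_one]
  apply mul_left_cancel₀ h0
  rw [← pow_succ', Nat.sub_add_cancel (orderOf_pos x), hd, Complex.mul_conj, Complex.normSq_eq_norm_sq, hn]
  norm_num

theorem exists_eight_mul (ρ : Representation ℂ G V) {z : G} (hz : z ^ 4 = 1)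
    (hc : ρ.character z = ρ.character (z ^ 3)) (hdet : LinearMap.det (ρ z) = 1) :
    ∃ n : ℤ, ρ.character 1 - ρ.character z + ρ.character (z ^ 2) - ρ.character (z ^ 3) = 8 * n := by
  obtain ⟨b, d, hb, hd, h⟩ := exists_diagonal ρ z
  have hd4 : ∀ i, d i = 1 ∨ d i = Complex.I ∨ d i = -1 ∨ d i = -Complex.I := fun i => by
    have h4 : d i ^ 4 = 1 := by
      obtain ⟨m, hm⟩ := orderOf_dvd_of_pow_eq_one hz
      rw [hm, pow_mul, hd, one_pow]
    have : (d i - 1) * ((d i - Complex.I) * ((d i + 1) * (d i + Complex.I))) = 0 := by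
      have := Complex.I_sq
      linear_combination h4 + (1 - d i ^ 2) * this
    simpa [sub_eq_zero, add_eq_zero_iff_eq_neg] using this
  let N : ℂ → ℕ := fun μ => (Finset.univ.filter fun i => d i = μ).card
  have hI1 : Complex.I ≠ 1 := fun h => by simpa using congrArg Complex.im h
  have hI2 : Complex.I ≠ -1 := fun h => by simpa using congrArg Complex.im h
  have hI3 : Complex.I ≠ -Complex.I := fun h => by
    have := congrArg Complex.im h; norm_num at this
  have hI4 : -Complex.I ≠ 1 := fun h => by simpa using congrArg Complex.im h
  have hI5 : -Complex.I ≠ -1 := fun h => by simpa using congrArg Complex.im h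
  have hsplit : ∀ i (F : ℂ → ℂ), F (d i) = (if d i = 1 then F 1 else 0) +
      (if d i = Complex.I then F Complex.I else 0) + (if d i = -1 then F (-1) else 0) +
      (if d i = -Complex.I then F (-Complex.I) else 0) := fun i F => by
    rcases hd4 i with h | h | h | h <;> rw [h]
    · simp [hI1.symm, hI4.symm, show (1:ℂ) ≠ -1 by norm_num]
    · simp [hI1, hI2, hI3]
    · simp [hI2.symm, hI5.symm, show (-1:ℂ) ≠ 1 by norm_num]
    · simp [hI4, hI3.symm, hI5]
  have hsum : ∀ F : ℂ → ℂ, ∑ i, F (d i) = N 1 * F 1 + N Complex.I * F Complex.I +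
      N (-1) * F (-1) + N (-Complex.I) * F (-Complex.I) := fun F => by
    rw [Finset.sum_congr rfl fun i _ => hsplit i F]
    simp only [Finset.sum_add_distrib, ← Finset.sum_filter, Finset.sum_const, nsmul_eq_mul, N]
  have h0 := h 0
  have h1 := h 1
  have h2 := h 2
  have h3 := h 3
  rw [hsum fun μ => μ ^ 0] at h0
  rw [hsum fun μ => μ ^ 1] at h1
  rw [hsum fun μ => μ ^ 2] at h2
  rw [hsum fun μ => μ ^ 3] at h3
  simp only [pow_zero, pow_one] at h0 h1
  have hI := Complex.I_sq
  have hI3' : Complex.I ^ 3 = -Complex.I := by rw [pow_succ, hI]; ring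
  rw [h1, h3] at hc
  have hN : (N Complex.I : ℂ) = N (-Complex.I) := by
    have : 2 * Complex.I * ((N Complex.I : ℂ) - N (-Complex.I)) = 0 := by
      linear_combination hc + ((N Complex.I : ℂ) - N (-Complex.I)) * hI3'
    simpa [sub_eq_zero] using this
  have hdet' : ((-1 : ℂ)) ^ N (-1) = 1 := by
    have hp : LinearMap.det (ρ z) = ∏ i, d i := det_eq_prod fun i => by
      simpa using hb i 1
    have hprod : ∏ i, d i = 1 ^ N 1 * Complex.I ^ N Complex.I *
      (-1) ^ N (-1) * (-Complex.I) ^ N (-Complex.I) := by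
      have : ∀ i, d i = (if d i = 1 then 1 else 1) *
          (if d i = Complex.I then Complex.I else 1) * (if d i = -1 then (-1) else 1) *
          (if d i = -Complex.I then (-Complex.I) else 1) := fun i => by
        rcases hd4 i with h | h | h | h <;> rw [h]
        · simp [hI1.symm, hI4.symm, show (1:ℂ) ≠ -1 by norm_num]
        · simp [hI1, hI2, hI3]
        · simp [hI2.symm, hI5.symm, show (-1:ℂ) ≠ 1 by norm_num]
        · simp [hI4, hI3.symm, hI5]
      rw [Finset.prod_congr rfl fun i _ => this i]
      simp only [Finset.prod_mul_distrib, ← Finset.prod_filter, Finset.prod_const, N]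
    have hN' : N Complex.I = N (-Complex.I) := by exact_mod_cast hN
    rw [hp, hprod, hN', one_pow, one_mul, mul_right_comm, ← mul_pow] at hdet
    simpa using hdet
  have heven : Even (N (-1)) := by
    by_contra ho
    rw [Nat.not_even_iff_odd] at ho
    rw [ho.neg_one_pow] at hdet'
    norm_num at hdet'
  obtain ⟨n, hn⟩ := heven
  refine ⟨n, ?_⟩
  rw [h0, h1, h2, h3, hn, hN]
  push_cast
  linear_combination (2 * (N (-Complex.I) : ℂ)) * hI

end diagonal

section frobeniusSchur
open Representation Module
open scoped Classical Matrix
universe v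
variable {G : Type v} [Group G] [Fintype G] {n : ℕ}

/-- The map `M ↦ A * Mᵀ * Aᵀ` on square matrices. -/
noncomputable def transposeAct (A : Matrix (Fin n) (Fin n) ℂ) : End ℂ (Matrix (Fin n) (Fin n) ℂ) where
  toFun M := A * Mᵀ * Aᵀ
  map_add' M M' := by simp [Matrix.mul_add, Matrix.add_mul]
  map_smul' c M := by simp

/-- The map `M ↦ A * M * Aᵀ` on square matrices. -/
noncomputable def formAct (A : Matrix (Fin n) (Fin n) ℂ) : End ℂ (Matrix (Fin n) (Fin n) ℂ) where
  toFun M := A * M * Aᵀ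
  map_add' M M' := by simp [Matrix.mul_add, Matrix.add_mul]
  map_smul' c M := by simp

theorem trace_matrix_end (f : End ℂ (Matrix (Fin n) (Fin n) ℂ)) :
    LinearMap.trace ℂ _ f = ∑ i, ∑ j, f (Matrix.single i j 1) i j := by
  rw [LinearMap.trace_eq_matrix_trace ℂ (Matrix.stdBasis ℂ (Fin n) (Fin n)), Matrix.trace,
    ← Fintype.sum_prod_type']
  refine Finset.sum_congr rfl fun p _ => ?_
  rw [Matrix.diag_apply, LinearMap.toMatrix_apply, Matrix.stdBasis_eq_single]
  rfl

theorem trace_transposeAct (A : Matrix (Fin n) (Fin n) ℂ) :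
    LinearMap.trace ℂ _ (transposeAct A) = (A * A).trace := by
  rw [trace_matrix_end, Matrix.trace]
  refine Finset.sum_congr rfl fun i _ => ?_
  rw [Matrix.diag_apply, Matrix.mul_apply]
  refine Finset.sum_congr rfl fun j _ => ?_
  simp [transposeAct, Matrix.mul_apply, Matrix.single_apply, ite_and]

theorem trace_formAct (A : Matrix (Fin n) (Fin n) ℂ) :
    LinearMap.trace ℂ _ (formAct A) = A.trace ^ 2 := by
  rw [trace_matrix_end, Matrix.trace, sq, Finset.sum_mul_sum]
  refine Finset.sum_congr rfl fun i _ => Finset.sum_congr rfl fun j _ => ?_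
  simp [formAct, Matrix.mul_apply, Matrix.single_apply, ite_and]

theorem frobeniusSchur_matrix (A : G →* Matrix (Fin n) (Fin n) ℂ) :
    ∃ (k : ℤ) (m : ℕ), (Nat.card G : ℂ)⁻¹ * ∑ h, (A (h * h)).trace = k ∧
      (Nat.card G : ℂ)⁻¹ * ∑ h, (A h).trace ^ 2 = m ∧ k.natAbs ≤ m ∧ (2 : ℤ) ∣ k - m ∧
      (m ≠ 0 → ∃ M : Matrix (Fin n) (Fin n) ℂ, M ≠ 0 ∧ (∀ h, A h * M * (A h)ᵀ = M) ∧
        (Mᵀ = M ∨ Mᵀ = -M)) := by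
  have hG := cardC_ne_zero G
  let P : End ℂ (Matrix (Fin n) (Fin n) ℂ) := (Nat.card G : ℂ)⁻¹ • ∑ h, formAct (A h)
  let N : End ℂ (Matrix (Fin n) (Fin n) ℂ) := (Nat.card G : ℂ)⁻¹ • ∑ h, transposeAct (A h)
  have hcard : ∀ X : Matrix (Fin n) (Fin n) ℂ, (Nat.card G : ℂ)⁻¹ • ∑ _h : G, X = X := fun X => by
    rw [Finset.sum_const, Finset.card_univ, ← Nat.card_eq_fintype_card,
      ← Nat.cast_smul_eq_nsmul ℂ, smul_smul, inv_mul_cancel₀ hG, one_smul]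
  have hP : ∀ M, P M = (Nat.card G : ℂ)⁻¹ • ∑ h, A h * M * (A h)ᵀ := fun M => by
    simp [P, formAct, LinearMap.sum_apply]
  have hN : ∀ M, N M = P Mᵀ := fun M => by
    rw [hP]; simp [N, transposeAct, LinearMap.sum_apply]
  have hinv : ∀ M g, A g * P M * (A g)ᵀ = P M := fun M g => by
    rw [hP, Matrix.mul_smul, Matrix.smul_mul, Finset.mul_sum, Finset.sum_mul]
    congr 1
    refine Fintype.sum_equiv (Equiv.mulLeft g) _ _ fun h => ?_
    rw [Equiv.coe_mulLeft, map_mul, Matrix.transpose_mul]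
    simp only [Matrix.mul_assoc]
  have hfix : ∀ M, (∀ g, A g * M * (A g)ᵀ = M) → P M = M := fun M h => by
    rw [hP]; simp only [h]; exact hcard M
  have hT : ∀ M, (P M)ᵀ = P Mᵀ := fun M => by
    rw [hP, hP, Matrix.transpose_smul, Matrix.transpose_sum]
    simp [Matrix.transpose_mul, Matrix.mul_assoc]
  have hNN : N * N = P := LinearMap.ext fun M => by
    rw [Module.End.mul_apply, hN, hN, hT, Matrix.transpose_transpose]
    exact hfix _ (hinv M)
  have hNP : N * (N * N) = N := LinearMap.ext fun M => by
    rw [hNN, Module.End.mul_apply, hN, hT]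
    rw [hN]
    exact hfix _ (hinv _)
  have hp : Squarefree (Polynomial.X ^ 3 - Polynomial.X : Polynomial ℂ) := by
    have : (Polynomial.X ^ 3 - Polynomial.X : Polynomial ℂ).Separable := by
      refine ⟨Polynomial.C (-9 / 2) * Polynomial.X, Polynomial.C (3 / 2) * Polynomial.X ^ 2 - 1, ?_⟩
      simp only [Polynomial.derivative_sub, Polynomial.derivative_X_pow, Polynomial.derivative_X]
      apply Polynomial.funext
      intro x
      simp
      ring
    exact this.squarefree
  obtain ⟨b, d, hb, hd⟩ := exists_eigenbasis (f := N) hp (by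
    simp [pow_succ, mul_assoc, hNP])
  have hd' : ∀ i, d i = 0 ∨ d i = 1 ∨ d i = -1 := fun i => by
    have := hd i
    have : d i * ((d i - 1) * (d i + 1)) = 0 := by simp at this; linear_combination this
    simpa [sub_eq_zero, add_eq_zero_iff_eq_neg] using this
  choose e he using fun i => show ∃ e : ℤ, d i = e ∧ (e = 0 ∨ e = 1 ∨ e = -1) by
    rcases hd' i with h | h | h
    · exact ⟨0, by simp [h], by simp⟩
    · exact ⟨1, by simp [h], by simp⟩
    · exact ⟨-1, by simp [h], by simp⟩
  have htN : LinearMap.trace ℂ _ N = ∑ i, d i := trace_eq_sum hb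
  have htP : LinearMap.trace ℂ _ P = ∑ i, d i ^ 2 := trace_eq_sum (b := b) fun i => by
    rw [← hNN, Module.End.mul_apply, hb, map_smul, hb, smul_smul, sq]
  refine ⟨∑ i, e i, ∑ i, (e i).natAbs, ?_, ?_, ?_, ?_, ?_⟩
  · simp only [map_mul, ← trace_transposeAct]
    rw [← map_sum, ← smul_eq_mul, ← map_smul]
    change LinearMap.trace ℂ _ N = _
    rw [htN]; push_cast
    exact Finset.sum_congr rfl fun i _ => (he i).1
  · simp only [← trace_formAct]
    rw [← map_sum, ← smul_eq_mul, ← map_smul]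
    change LinearMap.trace ℂ _ P = _
    rw [htP]; push_cast
    refine Finset.sum_congr rfl fun i _ => ?_
    rw [(he i).1]
    rcases (he i).2 with h | h | h <;> simp [h]
  · zify
    rw [← Int.natCast_natAbs, Int.natCast_natAbs]
    exact Finset.abs_sum_le_sum_abs _ _
  · push_cast
    rw [← Finset.sum_sub_distrib]
    refine Finset.dvd_sum fun i _ => ?_
    rcases (he i).2 with h | h | h <;> simp [h]
  · intro hm
    obtain ⟨i, -, hi⟩ := Finset.exists_ne_zero_of_sum_ne_zero hm
    have hPb : P (b i) = b i := by
      rw [← hNN, Module.End.mul_apply, hb, map_smul, hb, smul_smul, (he i).1]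
      rcases (he i).2 with h | h | h
      · simp [h] at hi
      · simp [h]
      · simp [h]
    refine ⟨b i, b.ne_zero i, fun g => by rw [← hPb, hinv], ?_⟩
    have h1 := hb i
    rw [hN, ← hT, hPb, (he i).1] at h1
    rcases (he i).2 with h | h | h
    · simp [h] at hi
    · exact Or.inl (by simpa [h] using h1)
    · exact Or.inr (by simpa [h] using h1)

variable {V : Type*} [AddCommGroup V] [Module ℂ V] [FiniteDimensional ℂ V]

/-- The matrices of a representation in a basis. -/
noncomputable def matrixHom (ρ : Representation ℂ G V) (b : Basis (Fin n) ℂ V) :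
    G →* Matrix (Fin n) (Fin n) ℂ :=
  (LinearMap.toMatrixAlgEquiv b).toMulEquiv.toMonoidHom.comp ρ

theorem matrixHom_apply (ρ : Representation ℂ G V) (b : Basis (Fin n) ℂ V) (g : G) :
    matrixHom ρ b g = LinearMap.toMatrix b b (ρ g) := rfl

theorem trace_matrixHom (ρ : Representation ℂ G V) (b : Basis (Fin n) ℂ V) (g : G) :
    (matrixHom ρ b g).trace = ρ.character g := by
  rw [matrixHom_apply, ← LinearMap.trace_eq_matrix_trace ℂ b]; rfl

theorem exists_int_sum_sq (ρ : Representation ℂ G V) :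
    ∃ k : ℤ, (Nat.card G : ℂ)⁻¹ * ∑ h, ρ.character (h * h) = k := by
  obtain ⟨k, -, h, -⟩ := frobeniusSchur_matrix (matrixHom ρ (finBasis ℂ V))
  exact ⟨k, by simpa only [trace_matrixHom] using h⟩

theorem IsIrrChar.sum_sq_eq_zero {χ : G → ℂ} (hχ : IsIrrChar χ) (h : ∃ g, χ g⁻¹ ≠ χ g) :
    (Nat.card G : ℂ)⁻¹ * ∑ h, χ (h * h) = 0 := by
  have hχ' := hχ.comp_inv
  obtain ⟨d, ρ, hρ, rfl⟩ := id hχ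
  obtain ⟨k, m, h1, h2, h3, -⟩ := frobeniusSchur_matrix (matrixHom ρ (finBasis ℂ _))
  simp only [trace_matrixHom] at h1 h2
  have := charPair_irr hχ hχ'
  rw [if_neg (fun he => by obtain ⟨g, hg⟩ := h; exact hg (congrFun he g).symm)] at this
  simp only [charPair, inv_inv] at this
  simp only [sq] at h2
  rw [this] at h2
  have hm : m = 0 := by exact_mod_cast h2.symm
  rw [h1, show k = 0 by omega]; simp

theorem exists_sum_sq_odd {ρ : Representation ℂ G V} (hρ : ρ.IsIrreducible)
    (h : ∀ g, ρ.character g⁻¹ = ρ.character g) :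
    ∃ k : ℤ, Odd k ∧ (Nat.card G : ℂ)⁻¹ * ∑ h, ρ.character (h * h) = k := by
  obtain ⟨k, m, h1, h2, h3, h4, -⟩ := frobeniusSchur_matrix (matrixHom ρ (finBasis ℂ _))
  simp only [trace_matrixHom] at h1 h2
  have := charPair_irr (isIrrChar_character ρ hρ) (isIrrChar_character ρ hρ)
  simp only [charPair, h] at this
  simp only [sq] at h2
  have hm : m = 1 := by rw [this, if_pos trivial] at h2; exact_mod_cast h2.symm
  exact ⟨k, by rw [Int.odd_iff]; omega, h1⟩

/-- A real irreducible character of odd degree is afforded by a representation preserving a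
nondegenerate symmetric form. -/
theorem exists_symm_form {ρ : Representation ℂ G (Fin n → ℂ)} (hρ : ρ.IsIrreducible)
    (h : ∀ g, ρ.character g⁻¹ = ρ.character g) (hn : Odd n) (b : Basis (Fin n) ℂ (Fin n → ℂ)) :
    ∃ B : Matrix (Fin n) (Fin n) ℂ, IsUnit B ∧ Bᵀ = B ∧
      ∀ g, (matrixHom ρ b g)ᵀ * B * matrixHom ρ b g = B := by
  obtain ⟨k, m, -, h2, -, -, h5⟩ := frobeniusSchur_matrix (matrixHom ρ b)
  simp only [trace_matrixHom] at h2
  have := charPair_irr (isIrrChar_character ρ hρ) (isIrrChar_character ρ hρ)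
  simp only [charPair, h] at this
  simp only [sq] at h2
  rw [this, if_pos trivial] at h2
  obtain ⟨M, hM0, hM, hT⟩ := h5 (by rintro rfl; simp at h2)
  set A := matrixHom ρ b
  have hA : ∀ g, A g * A g⁻¹ = 1 := fun g => by rw [← map_mul, mul_inv_cancel, map_one]
  have hA' : ∀ g, A g⁻¹ * A g = 1 := fun g => by rw [← map_mul, inv_mul_cancel, map_one]
  have hMU : IsUnit M := by
    let f : End ℂ (Fin n → ℂ) := Matrix.toLin b b M
    have hf : f ≠ 0 := by simpa [f] using hM0
    have hr : LinearMap.range f = ⊤ := by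
      refine ((isIrreducible_iff_submodule ρ).mp hρ).2 _ ?_ |>.resolve_left ?_
      · rintro g _ ⟨w, rfl⟩
        have h3 : A g * M = M * (A g⁻¹)ᵀ := by
          conv_rhs => rw [← hM g]
          rw [Matrix.mul_assoc, ← Matrix.transpose_mul, hA', Matrix.transpose_one, Matrix.mul_one]
        refine ⟨Matrix.toLin b b (A g⁻¹)ᵀ w, ?_⟩
        have hg : ρ g = Matrix.toLin b b (A g) := by
          rw [matrixHom_apply, Matrix.toLin_toMatrix]
        rw [hg, ← LinearMap.comp_apply, ← LinearMap.comp_apply, ← Matrix.toLin_mul,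
          ← Matrix.toLin_mul, h3]
      · simpa [LinearMap.range_eq_bot] using hf
    have hs : Function.Surjective f := LinearMap.range_eq_top.mp hr
    have hu : IsUnit f := by
      rw [Module.End.isUnit_iff]
      exact ⟨LinearMap.injective_iff_surjective.mpr hs, hs⟩
    have := hu.map (LinearMap.toMatrixAlgEquiv b)
    simpa [f, LinearMap.toMatrixAlgEquiv, ] using this
  have hsymm : Mᵀ = M := hT.resolve_right fun hneg => by
    have h1 := congrArg Matrix.det hneg
    rw [Matrix.det_transpose, Matrix.det_neg, Fintype.card_fin, hn.neg_one_pow] at h1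
    have : M.det = 0 := by linear_combination h1 / 2
    exact ((Matrix.isUnit_iff_isUnit_det M).mp hMU).ne_zero this
  refine ⟨M⁻¹, ?_, ?_, fun g => ?_⟩
  · exact Matrix.isUnit_nonsing_inv_iff.mpr hMU
  · rw [Matrix.transpose_nonsing_inv, hsymm]
  · have hdet := (Matrix.isUnit_iff_isUnit_det M).mp hMU
    have := hM g
    have h1 : (A g)ᵀ * (M⁻¹ * A g * M) = 1 := by
      have h3 : M⁻¹ * (A g * M * (A g)ᵀ) = 1 := by rw [this, Matrix.nonsing_inv_mul _ hdet]
      rw [mul_eq_one_comm]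
      simpa only [Matrix.mul_assoc] using h3
    calc (A g)ᵀ * M⁻¹ * A g = (A g)ᵀ * (M⁻¹ * A g * M) * M⁻¹ := by
          rw [Matrix.mul_assoc _ _ M⁻¹, Matrix.mul_assoc _ M, Matrix.mul_nonsing_inv _ hdet,
            Matrix.mul_one, Matrix.mul_assoc]
      _ = M⁻¹ := by rw [h1, Matrix.one_mul]

end frobeniusSchur

section quaternion
open Representation Module
open scoped Classical
universe v
variable {G : Type v} [Group G] [Fintype G] {t : G}

theorem IsMinIso.hom_eq_one (hm : IsMinIso t) {M : Type*} [CommMonoid M] {y j : G} (hyt : y * y = t)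
    (hj : j * y * j⁻¹ = y⁻¹) (f : G →* M) (g : G) : f g = 1 := by
  refine hm.map_eq_one f ?_ g
  have h : f y⁻¹ = f y := by
    rw [← hj, map_mul, map_mul, mul_right_comm, ← map_mul, mul_inv_cancel, map_one, one_mul]
  rw [← hyt, map_mul]
  nth_rw 1 [← h]
  rw [← map_mul, inv_mul_cancel, map_one]

theorem IsMinIso.exists_eight_mul (hm : IsMinIso t) {y j : G} (hyt : y * y = t)
    (hj : j * y * j⁻¹ = y⁻¹) {V : Type*} [AddCommGroup V] [Module ℂ V] [FiniteDimensional ℂ V]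
    (ρ : Representation ℂ G V) :
    ∃ n : ℤ, ρ.character 1 - 2 * ρ.character y + ρ.character t = 8 * n := by
  have hy4 : y ^ 4 = 1 := by
    rw [show y ^ 4 = y * y * (y * y) by simp only [pow_succ, pow_zero, one_mul, mul_assoc], hyt,
      hm.iso.1]
  have h3 : ρ.character (y ^ 3) = ρ.character y := by
    rw [show y ^ 3 = y⁻¹ by rw [eq_inv_iff_mul_eq_one, ← pow_succ, hy4], ← hj, char_conj]
  obtain ⟨n, hn⟩ := _root_.exists_eight_mul ρ hy4 h3.symm
    (hm.hom_eq_one hyt hj ((LinearMap.det : End ℂ V →* ℂ).comp ρ) y)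
  refine ⟨n, ?_⟩
  rw [← hn, h3, sq, hyt]; ring

/-- The permutation representation on the functions on a conjugacy class. -/
noncomputable def classRep (z : G) : Representation ℂ G ({w // IsConj z w} → ℂ) where
  toFun g := 
    { toFun := fun f w => f ⟨g⁻¹ * w * g, w.2.trans (isConj_iff.mpr ⟨g⁻¹, by group⟩)⟩
      map_add' := fun _ _ => rfl
      map_smul' := fun _ _ => rfl }
  map_one' := by ext f w; simp
  map_mul' g h := by ext f w; simp [mul_assoc]

theorem classRep_character (z g : G) :
    (classRep z).character g = ((Finset.univ.filter fun w => IsConj z w ∧ g * w = w * g).card : ℂ) := by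
  rw [character, LinearMap.trace_eq_matrix_trace ℂ (Pi.basisFun ℂ _), Matrix.trace]
  simp only [Matrix.diag_apply, LinearMap.toMatrix_apply, Pi.basisFun_apply, Pi.basisFun_repr]
  rw [← Finset.sum_boole]
  simp only [ite_and]
  rw [← Finset.sum_filter (fun w => IsConj z w), ← Finset.sum_subtype_eq_sum_filter]
  rw [Finset.subtype_univ]
  refine Finset.sum_congr rfl fun w _ => ?_
  simp only [classRep, MonoidHom.coe_mk, OneHom.coe_mk, LinearMap.coe_mk, AddHom.coe_mk,
    Pi.single_apply, Subtype.ext_iff]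
  refine if_congr ?_ rfl rfl
  rw [mul_assoc, inv_mul_eq_iff_eq_mul]
  exact eq_comm

theorem IsMinIso.isConj_of_normalize (hm : IsMinIso t) {y z : G} (hyt : y * y = t) (hzt : z * z = t)
    (hz : z * y * z⁻¹ = y⁻¹) : IsConj y z := by
  by_contra hne
  have hyz : y * z * y⁻¹ = z⁻¹ := by
    have h1 : y * z * y = z := by
      rw [mul_inv_eq_iff_eq_mul] at hz
      rw [mul_assoc, hz]; group
    have h2 : y * z * y⁻¹ = y * z * y * (y * y)⁻¹ := by group
    rw [h2, h1, hyt, ← hzt]; group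
  have hy4 := orderOf_eq_four hyt hm.iso.1 hm.ne_one
  have hz4 := orderOf_eq_four hzt hm.iso.1 hm.ne_one
  obtain ⟨n, hn⟩ := hm.exists_eight_mul hyt hz (classRep z)
  obtain ⟨m, hm'⟩ := hm.exists_eight_mul hzt hyz (classRep z)
  have hcz : (Finset.univ.filter fun w => IsConj z w ∧ z * w = w * z).card = 2 := by
    have : (Finset.univ.filter fun w => IsConj z w ∧ z * w = w * z) = {z, z⁻¹} := by
      ext w
      simp only [Finset.mem_filter, Finset.mem_univ, true_and, Finset.mem_insert,
        Finset.mem_singleton]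
      constructor
      · rintro ⟨h1, h2⟩
        have hw4 : orderOf w = 4 := by
          obtain ⟨c, hc⟩ := isConj_iff.mp h1
          rw [← hz4, ← hc]; exact MulEquiv.orderOf_eq (MulAut.conj c) z
        exact hm.order_four_commute hz4 hw4 h2.symm
      · rintro (rfl | rfl)
        · exact ⟨IsConj.refl _, rfl⟩
        · exact ⟨isConj_iff.mpr ⟨y, hyz⟩, by simp⟩
    rw [this, Finset.card_pair]
    intro h
    have : z * z = 1 := by nth_rw 2 [h]; simp
    exact hm.ne_one (hzt ▸ this)
  have hcy : (Finset.univ.filter fun w => IsConj z w ∧ y * w = w * y).card = 0 := by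
    rw [Finset.card_eq_zero, Finset.filter_eq_empty_iff]
    rintro w - ⟨h1, h2⟩
    have hw4 : orderOf w = 4 := by
      obtain ⟨c, hc⟩ := isConj_iff.mp h1
      rw [← hz4, ← hc]; exact MulEquiv.orderOf_eq (MulAut.conj c) z
    rcases hm.order_four_commute hy4 hw4 h2.symm with rfl | rfl
    · exact hne h1.symm
    · exact hne (h1.trans (isConj_iff.mpr ⟨z, by
        rw [← conj_inv, hz, inv_inv]⟩)).symm
  rw [classRep_character, classRep_character, classRep_character, hcy] at hn
  rw [classRep_character, classRep_character, classRep_character, hcz] at hm'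
  have : (4 : ℂ) = 8 * (n - m) := by push_cast at hn hm'; linear_combination hn - hm'
  have : (4 : ℤ) = 8 * (n - m) := by exact_mod_cast this
  omega

/-- The Sylow subgroups of a minimal counterexample are quaternion of order eight and all elements
of order four are conjugate. -/
theorem IsMinIso.exists_quaternion (hm : IsMinIso t) : ∃ y j : G, y * y = t ∧ j * y * j⁻¹ = y⁻¹ ∧
    j * j = t ∧ (∃ m, Odd m ∧ Nat.card G = 8 * m) ∧ ∀ z : G, orderOf z = 4 → IsConj y z := by
  obtain ⟨S, y, j, htS, hyS, hjS, hyt, hj, hSt, hS⟩ := hm.exists_inverted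
  obtain ⟨O, hO, -⟩ := hm.exists_real_char hyt hj
  have hy4 := orderOf_eq_four hyt hm.iso.1 hm.ne_one
  have : Fact (Nat.Prime 2) := ⟨Nat.prime_two⟩
  have hy4' : y ^ 4 = 1 := by have := pow_orderOf_eq_one y; rwa [hy4] at this
  have hyinv : y⁻¹ ≠ y := fun h => by
    have : y * y = 1 := by nth_rw 2 [← h]; simp
    exact hm.ne_one (hyt ▸ this)
  let C := Subgroup.centralizer {y}
  have hjC : j * y ≠ y * j := fun h => hyinv (by rw [← hj, h]; simp)
  have hidx : (C.subgroupOf S).index = 2 := by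
    rw [Subgroup.index_eq_two_iff]
    refine ⟨⟨j, hjS⟩, fun b => ?_⟩
    simp only [Subgroup.mem_subgroupOf, C, Subgroup.mem_centralizer_singleton_iff,
      Subgroup.coe_mul, ← mul_inv_eq_iff_eq_mul]
    have hbj : (b : G) * j * y * (b * j)⁻¹ = (b * y * (b : G)⁻¹)⁻¹ := by
      rw [mul_inv_rev, mul_assoc, mul_assoc, mul_assoc, ← mul_assoc y, ← mul_assoc j,
        ← mul_assoc j, hj]
      group
    rw [hbj]
    rcases hS b b.2 with h | h
    · exact Or.inr ⟨h, by rw [h]; exact hyinv⟩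
    · exact Or.inl ⟨by rw [h, inv_inv], by rw [h]; exact hyinv⟩
  have hcard : Nat.card (C.subgroupOf S) ∣ 4 := by
    have h1 : Nat.card (C.subgroupOf S) ∣ 4 * Nat.card O := by
      rw [← hO.card_centralizer hy4]
      exact Subgroup.card_comap_dvd_of_injective C (S : Subgroup G).subtype Subtype.val_injective
    have h2 := Subgroup.card_subgroup_dvd_card (C.subgroupOf (S : Subgroup G))
    obtain ⟨k, hk⟩ := IsPGroup.iff_card.mp S.isPGroup'
    refine Nat.Coprime.dvd_of_dvd_mul_right (Nat.Coprime.coprime_dvd_left h2 ?_) h1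
    rw [hk]
    exact Nat.Coprime.pow_left _ (Nat.coprime_two_left.mpr hO.odd)
  have hS8 : Nat.card S = 8 := by
    have h1 := (C.subgroupOf (S : Subgroup G)).card_mul_index
    have h4 : 4 ∣ Nat.card (C.subgroupOf (S : Subgroup G)) := by
      let a : C.subgroupOf (S : Subgroup G) := ⟨⟨y, hyS⟩, by
        rw [Subgroup.mem_subgroupOf, Subgroup.mem_centralizer_singleton_iff]⟩
      have ha : orderOf a = 4 := by
        rw [← Subgroup.orderOf_coe, ← Subgroup.orderOf_coe]; exact hy4
      rw [← ha]; exact orderOf_dvd_natCard a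
    rw [hidx, Nat.dvd_antisymm hcard h4] at h1
    exact h1.symm
  have hfus : ∀ z : G, orderOf z = 4 → IsConj y z := by
    intro z hz
    have hz4 : z ^ 4 = 1 := by have := pow_orderOf_eq_one z; rwa [hz] at this
    obtain ⟨g, hg⟩ : ∃ g, g * z * g⁻¹ ∈ S := by
      obtain ⟨P, hP⟩ := (IsPGroup.of_card (p := 2) (n := 2) (G := Subgroup.zpowers z)
        (by rw [Nat.card_zpowers, hz]; rfl)).exists_le_sylow
      obtain ⟨g, hg⟩ := MulAction.exists_smul_eq G P S
      refine ⟨g, ?_⟩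
      rw [← hg]
      exact Subgroup.smul_mem_pointwise_smul z (MulAut.conj g) (P : Subgroup G)
        (hP (Subgroup.mem_zpowers z))
    set w := g * z * g⁻¹ with hw
    have hzw : IsConj z w := isConj_iff.mpr ⟨g, rfl⟩
    refine IsConj.trans ?_ hzw.symm
    have hw4 : orderOf w = 4 := by rw [← hz]; exact MulEquiv.orderOf_eq (MulAut.conj g) z
    have hwt : w * w = t := by
      refine hm.unique_involution S.2 (S.mul_mem hg hg) htS ?_ ?_ hm.iso.1 hm.ne_one
      · have := pow_orderOf_eq_one w
        rw [hw4] at this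
        rw [← this]; simp only [pow_succ, pow_zero, one_mul, mul_assoc]
      · intro h
        have := orderOf_dvd_of_pow_eq_one (x := w) (n := 2) (by rw [sq, h])
        rw [hw4] at this; omega
    rcases hS w hg with h | h
    · rcases hm.order_four_commute hy4 hw4 (mul_inv_eq_iff_eq_mul.mp h) with h | h
      · rw [h]
      · rw [h]; exact isConj_iff.mpr ⟨j, hj⟩
    · exact hm.isConj_of_normalize hyt hwt h
  refine ⟨y, j, hyt, hj, ?_, ⟨(S : Subgroup G).index, ?_, ?_⟩, hfus⟩
  · have hj8 : j ^ 4 = 1 := by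
      by_contra h
      have h8 : orderOf (⟨j, hjS⟩ : S) = 2 ^ 3 := by
        refine orderOf_eq_prime_pow (fun h' => h ?_) ?_
        · simpa [Subtype.ext_iff] using h'
        · have := pow_card_eq_one' (x := (⟨j, hjS⟩ : S))
          exact (hS8 ▸ this :)
      exact hm.not_isCyclic S (isCyclic_of_orderOf_eq_card _ (by rw [h8, hS8]; rfl))
    refine hm.unique_involution S.2 (S.mul_mem hjS hjS) htS ?_ ?_ hm.iso.1 hm.ne_one
    · rw [← hj8]; simp only [pow_succ, pow_zero, one_mul, mul_assoc]
    · intro h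
      by_cases h1 : j = 1
      · exact hjC (by rw [h1]; simp)
      · have := hm.unique_involution S.2 hjS htS h h1 hm.iso.1 hm.ne_one
        exact hjC (by rw [this, ← hyt, mul_assoc])
  · rw [← Nat.not_even_iff_odd, even_iff_two_dvd]
    exact S.not_dvd_index
  · rw [← hS8]; exact ((S : Subgroup G).card_mul_index).symm

end quaternion

section sections
open Representation Module
open scoped Classical
universe v
variable {G : Type v} [Group G] [Fintype G] {t : G}

/-- The elements `t`, `y`, `j` lie in a quaternion Sylow subgroup, `O` is the odd part of the
centralizer of `y`, and `g ↦ g ^ e` is the projection to the `2`-part. -/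
structure IsQuaternion (t y j : G) (O : Subgroup G) (e : ℕ) : Prop where
  sq_y : y * y = t
  sq_j : j * j = t
  conj : j * y * j⁻¹ = y⁻¹
  orderOf_y : orderOf y = 4
  part : IsOddPart y j O
  card : ∃ m, Odd m ∧ Nat.card G = 8 * m
  mod : e % 8 = 1
  pow_eq_one : ∀ g : G, g ^ e = 1 ↔ Odd (orderOf g)
  pow_pow : ∀ g : G, (g ^ e) ^ e = g ^ e
  cases : ∀ g : G, g ^ e = 1 ∨ IsConj t (g ^ e) ∨ IsConj y (g ^ e)

theorem IsMinIso.exists_isQuaternion (hm : IsMinIso t) : ∃ (y j : G) (O : Subgroup G) (e : ℕ),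
    IsQuaternion t y j O e ∧ ∃ χ, IsIrrChar χ ∧ χ t ≠ χ 1 ∧
      (∀ g, χ g⁻¹ = χ g) ∧ (∃ n : ℕ, Odd n ∧ χ 1 = n) ∧ ∃ ε : ℤ, (ε = 1 ∨ ε = -1) ∧
      (ε : ℂ) = (Nat.card O : ℂ)⁻¹ * ∑ k : O, χ (y * k) := by
  obtain ⟨y, j, hyt, hj, hjj, ⟨m, hmo, hcard⟩, hfus⟩ := hm.exists_quaternion
  obtain ⟨O, hO, hχ⟩ := hm.exists_real_char hyt hj
  have hcop : Nat.Coprime 8 m := Nat.Coprime.pow_left 3 (Nat.coprime_two_left.mpr hmo)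
  let e := Nat.chineseRemainder hcop 1 0
  have he8 : (e : ℕ) % 8 = 1 := e.2.1
  obtain ⟨f, hf⟩ : m ∣ e := (Nat.modEq_zero_iff_dvd).mp e.2.2
  have heo : Odd (e : ℕ) := Nat.odd_iff.mpr (by omega)
  have h8 : ∀ g : G, (g ^ (e : ℕ)) ^ 8 = 1 := fun g => by
    rw [← pow_mul, hf, show m * f * 8 = Nat.card G * f by rw [hcard]; ring, pow_mul, pow_card_eq_one',
      one_pow]
  have : Fact (Nat.Prime 2) := ⟨Nat.prime_two⟩
  have h4 : ∀ g : G, g ^ 8 = 1 → g ^ 4 = 1 := fun g hg => by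
    by_contra h
    have h8 : orderOf g = 2 ^ 3 := orderOf_eq_prime_pow h hg
    obtain ⟨P, hP⟩ := (IsPGroup.of_card (p := 2) (n := 3) (G := Subgroup.zpowers g)
      (by rw [Nat.card_zpowers, h8])).exists_le_sylow
    have hc : Nat.card P ∣ 8 := by
      obtain ⟨k, hk⟩ := IsPGroup.iff_card.mp P.isPGroup'
      have h1 := (P : Subgroup G).card_subgroup_dvd_card
      rw [hcard] at h1
      refine Nat.Coprime.dvd_of_dvd_mul_right ?_ h1
      change Nat.card P = _ at hk
      rw [hk]
      exact Nat.Coprime.pow_left _ (Nat.coprime_two_left.mpr hmo)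
    refine hm.not_isCyclic P (isCyclic_of_orderOf_eq_card (⟨g, hP (Subgroup.mem_zpowers g)⟩ : P)
      (Nat.dvd_antisymm (orderOf_dvd_natCard _) ?_))
    rw [← Subgroup.orderOf_coe, h8]
    exact hc
  refine ⟨y, j, O, e, ⟨hyt, hjj, hj, orderOf_eq_four hyt hm.iso.1 hm.ne_one, hO, ⟨m, hmo, hcard⟩,
    he8, fun g => ⟨fun h => heo.of_dvd_nat (orderOf_dvd_of_pow_eq_one h), fun h => ?_⟩,
    fun g => ?_, fun g => ?_⟩, hχ⟩
  · have h1 : orderOf g ∣ 8 * m := hcard ▸ orderOf_dvd_natCard g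
    have h2 : orderOf g ∣ m := Nat.Coprime.dvd_of_dvd_mul_left
      (Nat.Coprime.pow_right 3 (Nat.coprime_two_right.mpr h)) h1
    exact orderOf_dvd_iff_pow_eq_one.mp (h2.trans ⟨f, hf⟩)
  · have key : ∀ u : G, u ^ 8 = 1 → u ^ (e : ℕ) = u := fun u hu => by
      rw [← Nat.div_add_mod (e : ℕ) 8, he8, pow_add, pow_one, pow_mul, hu, one_pow, one_mul]
    exact key _ (h8 g)
  · by_cases h1 : g ^ (e : ℕ) = 1
    · exact Or.inl h1
    · right
      by_cases h2 : g ^ (e : ℕ) * g ^ (e : ℕ) = 1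
      · exact Or.inl (hm.isConj_of_involution h2 h1)
      · refine Or.inr (hfus _ (orderOf_eq_prime_pow (p := 2) (n := 1) (fun h => h2 ?_) (h4 _ (h8 g))))
        rwa [pow_one, sq] at h

theorem sum_conj_fiber {p : G → G} (hp : ∀ x g, p (x * g * x⁻¹) = x * p g * x⁻¹) {Φ : G → ℂ}
    (hΦ : IsClassFun Φ) (u : G) : (Nat.card (Subgroup.centralizer {u}) : ℂ) *
      ∑ g with IsConj u (p g), Φ g = Nat.card G * ∑ g with p g = u, Φ g := by
  have h1 : ∀ x, ∑ g with p g = x * u * x⁻¹, Φ g = ∑ g with p g = u, Φ g := fun x => by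
    rw [Finset.sum_filter, Finset.sum_filter,
      ← sum_comp_conj (fun g => if p g = x * u * x⁻¹ then Φ g else 0) x]
    refine Finset.sum_congr rfl fun g _ => ?_
    simp only [show Φ (x * g * x⁻¹) = Φ g from hΦ x g, hp, mul_left_inj, mul_right_inj]
  have h2 : ∑ x : G, ∑ g with p g = x * u * x⁻¹, Φ g = Nat.card G * ∑ g with p g = u, Φ g := by
    rw [Finset.sum_congr rfl fun x _ => h1 x, Finset.sum_const, Finset.card_univ, nsmul_eq_mul,
      Nat.card_eq_fintype_card]
  have h3 : ∀ g, IsConj u (p g) → (∑ x : G, if p g = x * u * x⁻¹ then (1 : ℂ) else 0) =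
      Nat.card (Subgroup.centralizer {u}) := fun g hg => by
    obtain ⟨c, hc⟩ := isConj_iff.mp hg
    have h4 := Fintype.sum_equiv (Equiv.mulLeft c)
      (fun x => if x ∈ Subgroup.centralizer {u} then (1 : ℂ) else 0)
      (fun x => if c * u * c⁻¹ = x * u * x⁻¹ then (1 : ℂ) else 0) fun x => if_congr ?_ rfl rfl
    · rw [← hc, Nat.card_eq_fintype_card, Fintype.card_subtype, ← Finset.sum_boole, h4]
    rw [Subgroup.mem_centralizer_singleton_iff, Equiv.coe_mulLeft]
    constructor
    · intro h
      rw [mul_inv_rev, ← mul_assoc, mul_assoc c x u, h]; group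
    · intro h
      have : u = x * u * x⁻¹ := by
        have h' : c * u * c⁻¹ = c * (x * u * x⁻¹) * c⁻¹ := by rw [h]; group
        simpa using h'
      rw [eq_mul_inv_iff_mul_eq] at this
      exact this.symm
  rw [← h2]
  simp only [Finset.sum_filter]
  rw [Finset.sum_comm, Finset.mul_sum]
  refine Finset.sum_congr rfl fun g _ => ?_
  by_cases hg : IsConj u (p g)
  · rw [if_pos hg, ← h3 g hg, Finset.sum_mul]
    simp
  · rw [if_neg hg, mul_zero]
    refine (Finset.sum_eq_zero fun x _ => if_neg fun h => hg (isConj_iff.mpr ⟨x, h.symm⟩)).symm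

/-- Average over the elements of odd order. -/
noncomputable def oddAvg (Φ : G → ℂ) : ℂ := (Nat.card G : ℂ)⁻¹ * ∑ g ∈ oddElts G, Φ g

/-- Average over the elements whose `2`-part is conjugate to `t`. -/
noncomputable def sectionAvg (t : G) (e : ℕ) (Φ : G → ℂ) : ℂ :=
  (Nat.card G : ℂ)⁻¹ * ∑ g with IsConj t (g ^ e), Φ g

/-- Average over the elements of odd order in the centralizer of `t`. -/
noncomputable def localOddAvg (t : G) (Φ : G → ℂ) : ℂ :=
  (Nat.card (Subgroup.centralizer {t}) : ℂ)⁻¹ * ∑ g with g * t = t * g ∧ Odd (orderOf g), Φ g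

/-- Average over a translate of a subgroup. -/
noncomputable def cosetAvg (O : Subgroup G) (u : G) (Φ : G → ℂ) : ℂ :=
  (Nat.card O : ℂ)⁻¹ * ∑ k : O, Φ (u * k)

variable {y j : G} {O : Subgroup G} {e : ℕ}

theorem IsQuaternion.y_pow (h : IsQuaternion t y j O e) : y ^ 4 = 1 := by
  have := pow_orderOf_eq_one y; rwa [h.orderOf_y] at this

theorem IsQuaternion.pow_e (h : IsQuaternion t y j O e) {u : G} (hu : u ^ 4 = 1) : u ^ e = u := by
  have := h.mod
  rw [← Nat.div_add_mod e 4, show e % 4 = 1 by omega, pow_add, pow_one, pow_mul, hu, one_pow,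
    one_mul]

theorem IsQuaternion.pow_mul_odd (h : IsQuaternion t y j O e) {u k : G} (hu : u ^ 4 = 1)
    (hk : Odd (orderOf k)) (hc : k * u = u * k) : (u * k) ^ e = u := by
  rw [(show Commute u k from hc.symm).mul_pow, h.pow_e hu, (h.pow_eq_one k).mpr hk, mul_one]

theorem IsQuaternion.sum_fiber (h : IsQuaternion t y j O e) {u : G} (hu : u ^ 4 = 1) (Φ : G → ℂ) :
    ∑ g with g ^ e = u, Φ g = ∑ k with k * u = u * k ∧ Odd (orderOf k), Φ (u * k) := by
  refine Finset.sum_nbij' (fun g => u⁻¹ * g) (fun k => u * k) ?_ ?_ ?_ ?_ ?_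
  · intro g hg
    simp only [Finset.mem_filter, Finset.mem_univ, true_and] at hg ⊢
    have hgu : g * u = u * g := by rw [← hg, ← pow_succ, ← pow_succ']
    have hc : u⁻¹ * g * u = u * (u⁻¹ * g) := by rw [mul_assoc, hgu]; group
    refine ⟨hc, (h.pow_eq_one _).mp ?_⟩
    have hcomm : Commute u⁻¹ g := (show Commute u g from hgu.symm).inv_left
    rw [hcomm.mul_pow, inv_pow, h.pow_e hu, hg, inv_mul_cancel]
  · intro k hk
    simp only [Finset.mem_filter, Finset.mem_univ, true_and] at hk ⊢
    exact h.pow_mul_odd hu hk.2 hk.1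
  · intro g _; simp
  · intro k _; simp
  · intro g _; simp

theorem IsQuaternion.sum_part (h : IsQuaternion t y j O e) (F : G → ℂ) :
    ∑ k with k * y = y * k ∧ Odd (orderOf k), F k = ∑ k : O, F k := by
  rw [← Finset.sum_subtype (p := fun k => k ∈ O) (F := inferInstance)]
  intro k
  simp only [Finset.mem_filter, Finset.mem_univ, true_and]
  refine ⟨fun hk => mem_of_odd_of_split h.orderOf_y h.part.comm h.part.split hk.1 hk.2 h.part.odd,
    fun hk => ⟨h.part.comm k hk, h.part.odd.of_dvd_nat (Subgroup.orderOf_dvd_natCard O hk)⟩⟩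

theorem IsQuaternion.sum_cases (h : IsQuaternion t y j O e) (ht : t * t = 1) (ht1 : t ≠ 1)
    (F : G → ℂ) : ∑ g, F g = ∑ g ∈ oddElts G, F g + ∑ g with IsConj t (g ^ e), F g +
      ∑ g with IsConj y (g ^ e), F g := by
  rw [show oddElts G = Finset.univ.filter fun g => g ^ e = 1 by
    ext g; simp [mem_oddElts, h.pow_eq_one]]
  simp only [Finset.sum_filter]
  rw [← Finset.sum_add_distrib, ← Finset.sum_add_distrib]
  refine Finset.sum_congr rfl fun g _ => ?_
  have h1 : ¬ IsConj t 1 := fun h' => ht1 (isConj_one_left.mp h')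
  have h2 : ¬ IsConj y 1 := fun h' => ht1 (by rw [← h.sq_y, isConj_one_left.mp h', one_mul])
  have h3 : ¬ IsConj y t := fun h' => by
    obtain ⟨c, hc⟩ := isConj_iff.mp h'
    have : c * (y * y) * c⁻¹ = t * t := by rw [← hc]; group
    rw [ht, conj_eq_one_iff, h.sq_y] at this
    exact ht1 this
  rcases h.cases g with h' | h' | h'
  · rw [if_pos h', if_neg (by rwa [h']), if_neg (by rwa [h'])]; ring
  · have h4 : ¬ IsConj y (g ^ e) := fun h'' => h3 (h''.trans h'.symm)
    have h5 : g ^ e ≠ 1 := fun h'' => h1 (h'' ▸ h')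
    rw [if_pos h', if_neg h4, if_neg h5]; ring
  · have h4 : ¬ IsConj t (g ^ e) := fun h'' => h3 (h'.trans h''.symm)
    have h5 : g ^ e ≠ 1 := fun h'' => h2 (h'' ▸ h')
    rw [if_pos h', if_neg h4, if_neg h5]; ring

theorem IsQuaternion.sum_y (h : IsQuaternion t y j O e) {Φ : G → ℂ} (hΦ : IsClassFun Φ) :
    (Nat.card G : ℂ)⁻¹ * ∑ g with IsConj y (g ^ e), Φ g = 1 / 4 * cosetAvg O y Φ := by
  have h1 := sum_conj_fiber (p := fun g => g ^ e) (fun x g => conj_pow) hΦ y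
  rw [h.sum_fiber h.y_pow, h.sum_part, h.part.card_centralizer h.orderOf_y] at h1
  rw [cosetAvg, inv_mul_eq_iff_eq_mul₀ (cardC_ne_zero G)]
  have hO : (Nat.card O : ℂ) ≠ 0 := cardC_ne_zero O
  field_simp
  rw [← h1]; push_cast; ring

theorem IsQuaternion.sum_all (h : IsQuaternion t y j O e) (ht : t * t = 1) (ht1 : t ≠ 1)
    {Φ : G → ℂ} (hΦ : IsClassFun Φ) :
    (Nat.card G : ℂ)⁻¹ * ∑ g, Φ g = oddAvg Φ + sectionAvg t e Φ + 1 / 4 * cosetAvg O y Φ := by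
  rw [← h.sum_y hΦ, h.sum_cases ht ht1, oddAvg, sectionAvg]; ring

theorem IsQuaternion.sum_odd_sq (h : IsQuaternion t y j O e) (P : Subgroup G) (F : G → ℂ) :
    ∑ g with g ∈ P ∧ Odd (orderOf g), F (g * g) = ∑ g with g ∈ P ∧ Odd (orderOf g), F g := by
  have he : (e + 1) / 2 + (e + 1) / 2 = e + 1 := by have := h.mod; omega
  have hpow : ∀ g : G, Odd (orderOf g) → ∀ n, Odd (orderOf (g ^ n)) := fun g hg n =>
    hg.of_dvd_nat (orderOf_pow_dvd n)
  have key : ∀ g : G, Odd (orderOf g) → g ^ ((e + 1) / 2) * g ^ ((e + 1) / 2) = g :=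
    fun g hg => by rw [← pow_add, he, pow_succ, (h.pow_eq_one g).mpr hg, one_mul]
  refine Finset.sum_nbij' (fun g => g * g) (fun g => g ^ ((e + 1) / 2)) ?_ ?_ ?_ ?_ ?_
  · intro g hg
    simp only [Finset.mem_filter, Finset.mem_univ, true_and] at hg ⊢
    exact ⟨P.mul_mem hg.1 hg.1, sq g ▸ hpow g hg.2 2⟩
  · intro g hg
    simp only [Finset.mem_filter, Finset.mem_univ, true_and] at hg ⊢
    exact ⟨P.pow_mem hg.1 _, hpow g hg.2 _⟩
  · intro g hg
    simp only [Finset.mem_filter, Finset.mem_univ, true_and] at hg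
    rw [(Commute.refl g).mul_pow, key g hg.2]
  · intro g hg
    simp only [Finset.mem_filter, Finset.mem_univ, true_and] at hg
    exact key g hg.2
  · intro g _; rfl

theorem IsQuaternion.sum_t (h : IsQuaternion t y j O e) (ht : t * t = 1) {Φ : G → ℂ}
    (hΦ : IsClassFun Φ) : (Nat.card G : ℂ)⁻¹ * ∑ g with IsConj t (g ^ e), Φ g =
      (Nat.card (Subgroup.centralizer {t}) : ℂ)⁻¹ *
        ∑ k with k * t = t * k ∧ Odd (orderOf k), Φ (t * k) := by
  have h1 := sum_conj_fiber (p := fun g => g ^ e) (fun x g => conj_pow) hΦ t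
  rw [h.sum_fiber (show t ^ 4 = 1 by
    rw [pow_mul t 2 2, sq t, ht, one_pow])] at h1
  have hC : (Nat.card (Subgroup.centralizer {t}) : ℂ) ≠ 0 := cardC_ne_zero _
  have hG := cardC_ne_zero G
  field_simp
  rw [mul_comm, h1]

theorem IsQuaternion.sum_sq (h : IsQuaternion t y j O e) (ht : t * t = 1) (ht1 : t ≠ 1)
    {Φ : G → ℂ} (hΦ : IsClassFun Φ) : (Nat.card G : ℂ)⁻¹ * ∑ g, Φ (g * g) =
      oddAvg Φ + localOddAvg t Φ + 1 / 4 * cosetAvg O t Φ := by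
  have hΦ' : IsClassFun fun g => Φ (g * g) := fun x g => by
    show Φ (x * g * x⁻¹ * (x * g * x⁻¹)) = Φ (g * g)
    rw [conj_mul]; exact hΦ x _
  have hC : ∀ (u : G) (F : G → ℂ), ∑ k with k * u = u * k ∧ Odd (orderOf k), F (k * k) =
      ∑ k with k * u = u * k ∧ Odd (orderOf k), F k := fun u F => by
    simpa only [Subgroup.mem_centralizer_singleton_iff] using
      h.sum_odd_sq (Subgroup.centralizer {u}) F
  rw [h.sum_all ht ht1 hΦ', sectionAvg, h.sum_t ht hΦ', localOddAvg, oddAvg, oddAvg, cosetAvg,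
    cosetAvg,
    ← h.sum_part fun k => Φ (y * k * (y * k)), ← h.sum_part fun k => Φ (t * k),
    ← hC y fun k => Φ (t * k), ← hC t Φ]
  congr 1
  · congr 2
    · rw [show oddElts G = Finset.univ.filter fun g => g ∈ (⊤ : Subgroup G) ∧ Odd (orderOf g) by
        ext g; simp [mem_oddElts]]
      exact h.sum_odd_sq ⊤ Φ
    · refine Finset.sum_congr rfl fun k hk => ?_
      simp only [Finset.mem_filter, Finset.mem_univ, true_and] at hk
      rw [mul_assoc, ← mul_assoc k, hk.1, mul_assoc t k, ← mul_assoc t t, ht, one_mul]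
  · congr 2
    refine Finset.sum_congr rfl fun k hk => ?_
    simp only [Finset.mem_filter, Finset.mem_univ, true_and] at hk
    rw [mul_assoc, ← mul_assoc k, hk.1, mul_assoc y k, ← mul_assoc y y, h.sq_y]

theorem IsQuaternion.sum_centralizer (h : IsQuaternion t y j O e) (ht : IsIsolated t)
    (ht1 : t ≠ 1) {Φ : G → ℂ} (hΦ : IsClassFun Φ) :
    (Nat.card (Subgroup.centralizer {t}) : ℂ)⁻¹ * ∑ g : Subgroup.centralizer {t}, Φ g =
      localOddAvg t Φ + sectionAvg t e Φ + 1 / 4 * cosetAvg O y Φ := by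
  have htt : t * t = 1 := ht.1
  have hC : (Nat.card (Subgroup.centralizer {t}) : ℂ) ≠ 0 := cardC_ne_zero _
  have hG := cardC_ne_zero G
  have hcomm : ∀ {g : G} {n : ℕ}, g ^ n = t → g * t = t * g := fun {g n} hg => by
    rw [← hg, ← pow_succ, ← pow_succ']
  have heq : ∀ {g x : G}, IsConj t x → (∃ n : ℕ, g ^ n = x) → g * t = t * g → x = t := by
    rintro g x hx ⟨n, rfl⟩ hg
    exact ht.eq_of_commute hx (IsConj.refl t) ((show Commute g t from hg).pow_left n)
  have ht2 : ∀ {x : G}, IsConj t x → x * x = 1 := fun {x} hx => by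
    obtain ⟨c, rfl⟩ := isConj_iff.mp hx
    rw [conj_mul, htt, mul_one, mul_inv_cancel]
  have hy2 : ∀ {x : G}, IsConj y x → IsConj t (x * x) := fun {x} hx => by
    obtain ⟨c, rfl⟩ := isConj_iff.mp hx
    rw [conj_mul, h.sq_y]; exact isConj_iff.mpr ⟨c, rfl⟩
  have hcase : ∀ {g : G}, IsConj t (g ^ e * g ^ e) → IsConj y (g ^ e) := fun {g} hg => by
    have h1 : g ^ e * g ^ e ≠ 1 := fun h' => ht1 (isConj_one_left.mp (h' ▸ hg))
    rcases h.cases g with h' | h' | h'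
    · exact absurd (by rw [h', one_mul]) h1
    · exact absurd (ht2 h') h1
    · exact h'
  rw [Finset.sum_subtype (p := fun g => g ∈ Subgroup.centralizer {t}) (F := inferInstance)
    (s := Finset.univ.filter fun g => g * t = t * g) (fun g => by
      simp [Subgroup.mem_centralizer_singleton_iff]) Φ |>.symm, Finset.sum_filter,
    h.sum_cases htt ht1, mul_add, mul_add, ← h.sum_y hΦ]
  congr 1
  · congr 1
    · rw [localOddAvg, oddElts, ← Finset.sum_filter, Finset.filter_filter]
      simp only [and_comm]
    · have h1 := sum_conj_fiber (p := fun g => g ^ e) (fun x g => conj_pow) hΦ t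
      rw [← Finset.sum_filter, Finset.filter_filter, sectionAvg,
        show (Finset.univ.filter fun g : G => IsConj t (g ^ e) ∧ g * t = t * g) =
          Finset.univ.filter fun g => g ^ e = t from Finset.filter_congr fun g _ =>
            ⟨fun hg => heq hg.1 ⟨e, rfl⟩ hg.2, fun hg => ⟨hg ▸ IsConj.refl _, hcomm hg⟩⟩]
      field_simp
      rw [mul_comm, h1]
  · have h1 := sum_conj_fiber (p := fun g => g ^ e * g ^ e)
      (fun x g => by rw [conj_pow, conj_mul]) hΦ t
    rw [← Finset.sum_filter, Finset.filter_filter,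
      show (Finset.univ.filter fun g : G => IsConj y (g ^ e) ∧ g * t = t * g) =
        Finset.univ.filter fun g => g ^ e * g ^ e = t from Finset.filter_congr fun g _ =>
          ⟨fun hg => heq (hy2 hg.1) ⟨e + e, pow_add _ _ _⟩ hg.2,
            fun hg => ⟨hcase (hg ▸ IsConj.refl _), hcomm (n := e + e) (by rw [pow_add, hg])⟩⟩,
      show (Finset.univ.filter fun g : G => IsConj y (g ^ e)) =
        Finset.univ.filter fun g => IsConj t (g ^ e * g ^ e) from Finset.filter_congr fun g _ =>
          ⟨hy2, hcase⟩]
    field_simp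
    rw [mul_comm, h1]

end sections

section eigAverages
open Representation Module
open scoped Classical
universe v
variable {G : Type v} [Group G] [Fintype G] {V : Type*} [AddCommGroup V] [Module ℂ V]
  [FiniteDimensional ℂ V] {t y j : G} {O : Subgroup G} {e : ℕ}

theorem exists_joint_diagonal (ρ : Representation ℂ G V) {y k : G} (hy : y ^ 4 = 1)
    (hk : Odd (orderOf k)) (hc : k * y = y * k) {n : ℕ} (hn : finrank ℂ V = n) :
    ∃ (b : Basis (Fin n) ℂ V) (a c : Fin n → ℂ),
      (∀ i, ρ y (b i) = a i • b i) ∧ (∀ i, ρ k (b i) = c i • b i) ∧ (∀ i, a i ^ 4 = 1) ∧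
      (∀ i, c i ^ orderOf k = 1) ∧ ∀ r : ℕ, ρ.character (y ^ r * k) = ∑ i, a i ^ r * c i := by
  subst hn
  obtain ⟨b, d, hb, hd, -⟩ := exists_diagonal ρ (y * k)
  have hcop : Nat.Coprime 4 (orderOf k) := Nat.Coprime.pow_left 2 (Nat.coprime_two_left.mpr hk)
  obtain ⟨p, hp4, hpk⟩ := Nat.chineseRemainder hcop 1 0
  obtain ⟨q, hq4, hqk⟩ := Nat.chineseRemainder hcop 0 1
  have hmul : ∀ n : ℕ, (y * k) ^ n = y ^ n * k ^ n := fun n =>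
    (show Commute y k from hc.symm).mul_pow n
  have hyn : ∀ m n : ℕ, m ≡ n [MOD 4] → y ^ m = y ^ n := fun m n h =>
    pow_eq_pow_iff_modEq.mpr (h.of_dvd (orderOf_dvd_of_pow_eq_one hy))
  have hp : (y * k) ^ p = y := by
    rw [hmul, hyn _ _ hp4, pow_eq_pow_iff_modEq.mpr hpk, pow_one, pow_zero, mul_one]
  have hq : (y * k) ^ q = k := by
    rw [hmul, hyn _ _ hq4, pow_eq_pow_iff_modEq.mpr hqk, pow_one, pow_zero, one_mul]
  have hd' : ∀ i (n m : ℕ), ((y * k) ^ n) ^ m = 1 → (d i ^ n) ^ m = 1 := fun i n m h => by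
    rw [← pow_mul] at h ⊢
    obtain ⟨l, hl⟩ := orderOf_dvd_of_pow_eq_one h
    rw [hl, pow_mul, hd, one_pow]
  have h1 : ∀ i, ρ y (b i) = d i ^ p • b i := fun i => by rw [← hb i p, hp]
  have h2 : ∀ i, ρ k (b i) = d i ^ q • b i := fun i => by rw [← hb i q, hq]
  refine ⟨b, fun i => d i ^ p, fun i => d i ^ q, h1, h2, fun i => hd' i p 4 (by rw [hp, hy]),
    fun i => hd' i q _ (by rw [hq, pow_orderOf_eq_one]), fun r => ?_⟩
  refine trace_eq_sum (b := b) fun i => ?_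
  rw [map_mul, Module.End.mul_apply, h2, map_smul, map_pow, pow_apply_eigen (h1 i), smul_smul,
    mul_comm]

/-- For `μ ^ 4 = 1`, the trace of `k` on the `μ⁻¹`-eigenspace of `y`. -/
noncomputable def eigPart (y : G) (χ : G → ℂ) (μ : ℂ) (k : G) : ℂ :=
  1 / 4 * (χ k + μ * χ (y * k) + μ ^ 2 * χ (y ^ 2 * k) + μ ^ 3 * χ (y ^ 3 * k))

theorem sum_geom_four {μ a : ℂ} (h : (μ * a) ^ 4 = 1) :
    1 / 4 * (1 + μ * a + μ ^ 2 * a ^ 2 + μ ^ 3 * a ^ 3) = if μ * a = 1 then 1 else 0 := by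
  split_ifs with h1
  · linear_combination (1 / 4 * (1 + (μ * a + 1) + (μ ^ 2 * a ^ 2 + μ * a + 1))) * h1
  · have h2 : μ * a - 1 ≠ 0 := sub_ne_zero.mpr h1
    apply mul_left_cancel₀ h2
    linear_combination 1 / 4 * h

theorem eigPart_eq_sum (ρ : Representation ℂ G V) {k : G} {n : ℕ} {a c : Fin n → ℂ}
    (ha : ∀ i, a i ^ 4 = 1) (h : ∀ r : ℕ, ρ.character (y ^ r * k) = ∑ i, a i ^ r * c i)
    {μ : ℂ} (hμ : μ ^ 4 = 1) :
    eigPart y ρ.character μ k = ∑ i with μ * a i = 1, c i := by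
  have h0 := h 0
  have h1 := h 1
  rw [pow_zero, one_mul] at h0
  rw [pow_one] at h1
  rw [eigPart, h0, h1, h 2, h 3, Finset.sum_filter, Finset.mul_sum, Finset.mul_sum, Finset.mul_sum,
    ← Finset.sum_add_distrib, ← Finset.sum_add_distrib, ← Finset.sum_add_distrib, Finset.mul_sum]
  refine Finset.sum_congr rfl fun i _ => ?_
  have := sum_geom_four (μ := μ) (a := a i) (by rw [mul_pow, hμ, ha, one_mul])
  rw [show (if μ * a i = 1 then c i else 0) = (if μ * a i = 1 then 1 else 0) * c i by
    split_ifs <;> simp, ← this]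
  ring

theorem eigPart_isIntegral (ρ : Representation ℂ G V) {k : G} (hy : y ^ 4 = 1)
    (hk : Odd (orderOf k)) (hc : k * y = y * k) {μ : ℂ} (hμ : μ ^ 4 = 1) :
    IsIntegral ℤ (eigPart y ρ.character μ k) := by
  obtain ⟨b, a, c, -, -, ha, hc1, h⟩ := exists_joint_diagonal ρ hy hk hc rfl
  rw [eigPart_eq_sum ρ ha h hμ]
  exact IsIntegral.sum _ fun i _ => IsIntegral.of_pow hk.pos (by rw [hc1]; exact isIntegral_one)

/-- The homomorphism from the cyclic group of order four given by an element of order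
dividing four. -/
noncomputable def zmodFourHom {M : Type*} [Monoid M] (x : M) (hx : x ^ 4 = 1) :
    Multiplicative (ZMod 4) →* M where
  toFun r := x ^ (ZMod.val r.toAdd)
  map_one' := by simp
  map_mul' a b := by
    rw [toAdd_mul, ZMod.val_add, ← pow_add, ← pow_mod_orderOf x, ← pow_mod_orderOf x (_ + _)]
    congr 1
    exact Nat.mod_mod_of_dvd _ (orderOf_dvd_of_pow_eq_one hx)

theorem exists_sum_eigPart (ρ : Representation ℂ G V) (hreal : ∀ g, ρ.character g⁻¹ = ρ.character g)
    (hy : y ^ 4 = 1) (hO : ∀ k ∈ O, k * y = y * k) {μ : ℂ} (hμ : μ ^ 4 = 1) :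
    ∃ n : ℕ, (Nat.card O : ℂ)⁻¹ * ∑ k : O, eigPart y ρ.character μ k = n := by
  let f : Multiplicative (ZMod 4) × O →* G := (zmodFourHom y hy).noncommCoprod O.subtype fun r k =>
    ((show Commute (k : G) y from hO k k.2).pow_right _).symm
  let ξ : Multiplicative (ZMod 4) × O →* ℂ := (zmodFourHom μ hμ).comp (MonoidHom.fst _ _)
  have h := charPair_character (ρ.comp f) (linearRep ξ)
  rw [linearRep_character] at h
  refine ⟨_, Eq.trans ?_ h⟩
  have hsum : ∀ F : Multiplicative (ZMod 4) → ℂ, ∑ x, F x = F (Multiplicative.ofAdd 0) +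
      F (Multiplicative.ofAdd 1) + F (Multiplicative.ofAdd 2) + F (Multiplicative.ofAdd 3) :=
    fun F => Fin.sum_univ_four fun x : Fin 4 => F (Multiplicative.ofAdd (x : ZMod 4))
  have hval : ∀ (r : ZMod 4) (k : O), ξ (Multiplicative.ofAdd r, k) *
      character (MonoidHom.comp ρ f) (Multiplicative.ofAdd r, k)⁻¹ =
      μ ^ r.val * ρ.character (y ^ r.val * k) := fun r k => by
    rw [← hreal]
    congr 1
    show LinearMap.trace ℂ V (ρ (f (Multiplicative.ofAdd r, k)⁻¹)) = LinearMap.trace ℂ V (ρ _)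
    rw [map_inv]; rfl
  have h4 : (Nat.card (Multiplicative (ZMod 4)) : ℂ) = 4 := by
    rw [show Nat.card (Multiplicative (ZMod 4)) = Nat.card (ZMod 4) from rfl, Nat.card_zmod]
    norm_num
  rw [charPair, Nat.card_prod, Fintype.sum_prod_type_right, Nat.cast_mul, mul_inv,
    mul_comm (_⁻¹ : ℂ) (_⁻¹), mul_assoc, Finset.mul_sum, Finset.mul_sum, Finset.mul_sum, h4]
  refine Finset.sum_congr rfl fun k _ => ?_
  rw [hsum, hval, hval, hval, hval, eigPart, show ZMod.val (0 : ZMod 4) = 0 from rfl,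
    show ZMod.val (1 : ZMod 4) = 1 from rfl, show ZMod.val (2 : ZMod 4) = 2 from rfl,
    show ZMod.val (3 : ZMod 4) = 3 from rfl]
  simp only [pow_zero, pow_one, one_mul]
  ring

end eigAverages

section eigParity
open Representation Module
open scoped Classical
universe v
variable {G : Type v} [Group G] [Fintype G] {V : Type*} [AddCommGroup V] [Module ℂ V]
  [FiniteDimensional ℂ V] {t y j : G} {O : Subgroup G} {e : ℕ}

/-- Twice the algebraic integers. -/
def twoIntegral : AddSubgroup ℂ where
  carrier := {x | IsIntegral ℤ (x / 2)}
  zero_mem' := by simp [isIntegral_zero]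
  add_mem' {a b} ha hb := by
    have := IsIntegral.add ha hb
    rwa [← add_div] at this
  neg_mem' {a} ha := by
    have := IsIntegral.neg ha
    rwa [← neg_div] at this

theorem mem_twoIntegral {x : ℂ} : x ∈ twoIntegral ↔ IsIntegral ℤ (x / 2) := Iff.rfl

theorem two_mul_mem_twoIntegral {x : ℂ} (hx : IsIntegral ℤ x) : 2 * x ∈ twoIntegral := by
  rw [mem_twoIntegral, mul_div_cancel_left₀ x two_ne_zero]; exact hx

theorem mul_mem_twoIntegral {x z : ℂ} (hx : IsIntegral ℤ x) (hz : z ∈ twoIntegral) :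
    x * z ∈ twoIntegral := by
  rw [mem_twoIntegral, mul_div_assoc]; exact hx.mul hz

theorem int_even_of_mem_twoIntegral {n : ℤ} (h : (n : ℂ) ∈ twoIntegral) : Even n := by
  by_contra ho
  exact not_isIntegral_half (Int.not_even_iff_odd.mp ho) (n / 2) (by ring) h

theorem eigPart_inv {χ : G → ℂ} (hreal : ∀ g, χ g⁻¹ = χ g) {k : G} (hy : y ^ 4 = 1)
    (hc : k * y = y * k) {μ : ℂ} (hμ : μ ^ 4 = 1) :
    eigPart y χ μ k⁻¹ = eigPart y χ (μ ^ 3) k := by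
  have hcomm : Commute k y := hc
  have h : ∀ r s, r + s = 4 → χ (y ^ r * k⁻¹) = χ (y ^ s * k) := fun r s hrs => by
    rw [← hreal, mul_inv_rev, inv_inv, (hcomm.pow_right r).inv_right.eq]
    congr 2
    rw [inv_eq_iff_mul_eq_one, ← pow_add, hrs, hy]
  have h1 := h 1 3 rfl
  have h3 := h 3 1 rfl
  rw [pow_one] at h1 h3
  rw [eigPart, eigPart, h1, h 2 2 rfl, h3, hreal]
  linear_combination (-1 / 4 * μ ^ 2 * χ (y ^ 2 * k) - 1 / 4 * (μ ^ 5 + μ) * χ (y ^ 3 * k)) * hμ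

theorem eigPart_conj_inv {χ : G → ℂ} (hχ : IsClassFun χ) (hreal : ∀ g, χ g⁻¹ = χ g) {k : G}
    (hj : j * y * j⁻¹ = y⁻¹) (hc : k * y = y * k) (μ : ℂ) :
    eigPart y χ μ (j * k⁻¹ * j⁻¹) = eigPart y χ μ k := by
  have hcomm : Commute k y := hc
  have h : ∀ r : ℕ, χ (y ^ r * (j * k⁻¹ * j⁻¹)) = χ (y ^ r * k) := fun r => by
    have h1 : y ^ r = j * (y ^ r)⁻¹ * j⁻¹ := by
      rw [← conj_inv, ← conj_pow, hj, inv_pow, inv_inv]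
    have h2 : y ^ r * (j * k⁻¹ * j⁻¹) = j * ((y ^ r)⁻¹ * k⁻¹) * j⁻¹ := by
      conv_lhs => rw [h1]
      rw [conj_mul]
    rw [h2, hχ, ← mul_inv_rev, hreal, (hcomm.pow_right r).eq]
  have h0 := h 0
  have h1 := h 1
  rw [pow_zero, one_mul, one_mul] at h0
  rw [pow_one] at h1
  rw [eigPart, eigPart, h0, h1, h 2, h 3]

theorem sum_eigPart_neg_one (ρ : Representation ℂ G V)
    (hreal : ∀ g, ρ.character g⁻¹ = ρ.character g) (hy : y ^ 4 = 1) (hO : Odd (Nat.card O))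
    (hOy : ∀ k ∈ O, k * y = y * k) :
    ∑ k : O, eigPart y ρ.character (-1) k - eigPart y ρ.character (-1) 1 ∈ twoIntegral := by
  have h1 : ((-1 : ℂ)) ^ 4 = 1 := by norm_num
  have hinv : ∀ k : O, eigPart y ρ.character (-1) (k : G)⁻¹ = eigPart y ρ.character (-1) k :=
    fun k => by
      rw [eigPart_inv hreal hy (hOy k k.2) h1]; norm_num
  have hodd : ∀ k : O, Odd (orderOf (k : G)) := fun k =>
    hO.of_dvd_nat (Subgroup.orderOf_dvd_natCard O k.2)
  have h := sum_sub_sum_fixed_mem twoIntegral (Finset.univ : Finset O)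
    (fun k => eigPart y ρ.character (-1) (k : G)) (fun k => k⁻¹) (fun _ _ => Finset.mem_univ _)
    (fun k _ => inv_inv k) fun k _ _ => by
      rw [Subgroup.coe_inv, hinv, ← two_mul]
      exact two_mul_mem_twoIntegral (eigPart_isIntegral ρ hy (hodd k) (hOy k k.2) h1)
  have hfix : (Finset.univ.filter fun k : O => k⁻¹ = k) = {1} := by
    ext k
    simp only [Finset.mem_filter, Finset.mem_univ, true_and, Finset.mem_singleton]
    refine ⟨fun hk => ?_, fun hk => by rw [hk, inv_one]⟩
    have h2 : (k : G) ^ 2 = 1 := by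
      rw [sq, ← inv_mul_cancel (k : G)]
      exact congrArg (fun x : O => (x : G) * k) hk.symm
    have h3 := Nat.Coprime.eq_one_of_dvd (Nat.coprime_two_right.mpr (hodd k))
      (orderOf_dvd_of_pow_eq_one h2)
    exact Subtype.ext (orderOf_eq_one_iff.mp h3)
  convert h using 2
  have h5 := Finset.sum_singleton (fun k : O => eigPart y ρ.character (-1) (k : G)) 1
  rw [← hfix] at h5
  refine h5.symm.trans ?_
  congr

theorem IsOddPart.sum_eigPart_I (hp : IsOddPart y j O) (ρ : Representation ℂ G V)
    (hreal : ∀ g, ρ.character g⁻¹ = ρ.character g) (hy : y ^ 4 = 1) (hj : j * y * j⁻¹ = y⁻¹)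
    (hjj : j * j = y * y) :
    ∑ k : O, eigPart y ρ.character Complex.I k -
      ∑ k ∈ Finset.univ.filter (fun k : O => j * (k : G)⁻¹ * j⁻¹ = k), eigPart y ρ.character Complex.I (k : G) ∈
        twoIntegral := by
  let σ : O → O := fun k => ⟨j * (k : G)⁻¹ * j⁻¹, hp.conj _ (inv_mem k.2)⟩
  have h := sum_sub_sum_fixed_mem twoIntegral (Finset.univ : Finset O)
    (fun k => eigPart y ρ.character Complex.I (k : G)) σ (fun _ _ => Finset.mem_univ _)
    (fun k _ => Subtype.ext ?_) fun k _ _ => by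
      show eigPart y _ _ (k : G) + eigPart y _ _ (j * (k : G)⁻¹ * j⁻¹) ∈ _
      rw [eigPart_conj_inv (character_isClassFun ρ) hreal hj (hp.comm k k.2), ← two_mul]
      exact two_mul_mem_twoIntegral (eigPart_isIntegral ρ hy
        (hp.odd.of_dvd_nat (Subgroup.orderOf_dvd_natCard O k.2)) (hp.comm k k.2) Complex.I_pow_four)
  · convert h using 2
    refine Finset.sum_congr (Finset.ext fun k => ?_) fun _ _ => rfl
    simp only [Finset.mem_filter, Subtype.ext_iff, σ]
  · have hcomm : Commute (k : G) (y * y) :=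
      (show Commute (k : G) y from hp.comm k k.2).mul_right (hp.comm k k.2)
    show j * (j * (k : G)⁻¹ * j⁻¹)⁻¹ * j⁻¹ = k
    rw [conj_inv, inv_inv, show j * (j * (k : G) * j⁻¹) * j⁻¹ = (j * j) * k * (j * j)⁻¹ by group,
      hjj, ← hcomm.eq, mul_inv_cancel_right]

end eigParity

section skewBlocks
open Representation Module
open scoped Classical
universe v
variable {G : Type v} [Group G] [Fintype G] {n : ℕ} {t y j : G} {O : Subgroup G} {e : ℕ}

theorem even_card_of_skew_block {W : Matrix (Fin n) (Fin n) ℂ} (hW : IsUnit W) (p : Fin n → Prop)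
    [DecidablePred p] (h0 : ∀ i, ¬ p i → ∀ j, p j → W i j = 0) (hs : ∀ i j, p i → p j → W j i = -W i j) :
    Even (Finset.univ.filter p).card := by
  have hdet : (W.toSquareBlockProp p).det ≠ 0 := fun h => by
    have h1 := (Matrix.isUnit_iff_isUnit_det W).mp hW
    rw [Matrix.twoBlockTriangular_det W p h0, h, zero_mul] at h1
    exact not_isUnit_zero h1
  have hT : (W.toSquareBlockProp p).transpose = -W.toSquareBlockProp p := by
    ext i j
    exact hs i j i.2 j.2
  have h2 := Matrix.det_transpose (W.toSquareBlockProp p)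
  rw [hT, Matrix.det_neg, Fintype.card_subtype] at h2
  by_contra ho
  rw [(Nat.not_even_iff_odd.mp ho).neg_one_pow] at h2
  exact hdet (by linear_combination -1 / 2 * h2)

theorem mul_eigen_comm {B J D D' : Matrix (Fin n) (Fin n) ℂ} (hB : D * B * D = B)
    (hJ : J * D = D' * J) (hD : D * D' = 1) : B * J * D = D * (B * J) := by
  have hBD : B * D' = D * B := by
    conv_lhs => rw [← hB]
    rw [mul_assoc, hD, mul_one]
  rw [mul_assoc, hJ, ← mul_assoc, hBD, mul_assoc]

theorem matrixHom_eq_diagonal {ρ : Representation ℂ G (Fin n → ℂ)} {b : Basis (Fin n) ℂ (Fin n → ℂ)}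
    {a : Fin n → ℂ} {g : G} (h : ∀ i, ρ g (b i) = a i • b i) :
    matrixHom ρ b g = Matrix.diagonal a := toMatrix_eq_diagonal h

theorem eigPart_mem_twoIntegral {ρ : Representation ℂ G (Fin n → ℂ)} (hρ : ρ.IsIrreducible)
    (hreal : ∀ g, ρ.character g⁻¹ = ρ.character g) (hn : Odd n) (hy : y ^ 4 = 1)
    (hj : j * y * j⁻¹ = y⁻¹) (hjj : j * j = y * y) {k : G} (hk : Odd (orderOf k))
    (hc : k * y = y * k) (hjk : j * k * j⁻¹ = k⁻¹) {μ : ℂ} (hμ : μ ^ 2 = -1) :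
    eigPart y ρ.character μ k ∈ twoIntegral := by
  obtain ⟨b, a, c, hya, hkc, ha, hc1, h⟩ := exists_joint_diagonal ρ hy hk hc
    (by simp : finrank ℂ (Fin n → ℂ) = n)
  rw [eigPart_eq_sum ρ ha h (by rw [show 4 = 2 * 2 from rfl, pow_mul, hμ]; norm_num)]
  obtain ⟨B, hB, hBT, hBg⟩ := exists_symm_form hρ hreal hn b
  let M := matrixHom ρ b
  have hcomm : ∀ {g : G} {d : Fin n → ℂ}, M g = Matrix.diagonal d → j * g * j⁻¹ = g⁻¹ →
      ∀ i l, (B * M j) i l * d l = d i * (B * M j) i l := by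
    intro g d hg hjg i l
    have h1 := hBg g
    rw [show matrixHom ρ b g = Matrix.diagonal d from hg, Matrix.diagonal_transpose] at h1
    have h2 := mul_eigen_comm (J := M j) (D' := M g⁻¹) h1 (by
      rw [← hg, ← map_mul, ← map_mul, ← hjg, inv_mul_cancel_right]) (by
      rw [← hg, ← map_mul, mul_inv_cancel, map_one])
    have h3 := congrFun (congrFun h2 i) l
    rwa [Matrix.mul_diagonal, Matrix.diagonal_mul] at h3
  have hWy := hcomm (matrixHom_eq_diagonal hya) hj
  have hWk := hcomm (matrixHom_eq_diagonal hkc) hjk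
  have hinv : j⁻¹ = j * (y * y) := by
    rw [inv_eq_iff_mul_eq_one, ← hjj, ← mul_assoc, ← mul_assoc, mul_assoc (j * j), hjj, ← hy]
    simp only [pow_succ, pow_zero, one_mul, mul_assoc]
  have hskew : ∀ i l, (B * M j) l i = (B * M j) i l * a l * a l := fun i l => by
    have h1 : (B * M j).transpose = B * M j * M y * M y := by
      have h2 : M j * M j⁻¹ = 1 := by rw [← map_mul, mul_inv_cancel, map_one]
      rw [Matrix.transpose_mul, hBT, mul_assoc, mul_assoc, ← map_mul, ← map_mul, ← hinv]
      conv_rhs => rw [← hBg j]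
      rw [mul_assoc _ (matrixHom ρ b j), h2, mul_one]
    rw [show M y = Matrix.diagonal a from matrixHom_eq_diagonal hya] at h1
    have h3 := congrFun (congrFun h1 i) l
    rwa [Matrix.mul_diagonal, Matrix.mul_diagonal, Matrix.transpose_apply] at h3
  have hW : IsUnit (B * M j) := hB.mul (IsUnit.of_mul_eq_one (M j⁻¹) (by
    rw [← map_mul, mul_inv_cancel, map_one]))
  have ha2 : ∀ i, μ * a i = 1 → a i * a i = -1 := fun i hi => by
    linear_combination (-(μ * a i) - 1) * hi + a i ^ 2 * hμ
  have heven : ∀ z, Even (Finset.univ.filter fun i => μ * a i = 1 ∧ c i = z).card := fun z => by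
    refine even_card_of_skew_block hW (fun i => μ * a i = 1 ∧ c i = z) (fun i hi l hl => ?_) fun i l _ hl => ?_
    · by_contra hil
      have h1 : a l = a i := mul_left_cancel₀ hil (by rw [hWy i l, mul_comm])
      have h2 : c l = c i := mul_left_cancel₀ hil (by rw [hWk i l, mul_comm])
      exact hi (by rw [← h1, ← h2]; exact hl)
    · rw [hskew, mul_assoc, ha2 l hl.1, mul_neg_one]
  rw [← Finset.sum_fiberwise_of_maps_to (t := Finset.univ.image c)
    fun i _ => Finset.mem_image_of_mem c (Finset.mem_univ i)]
  refine sum_mem fun z hz => ?_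
  obtain ⟨i, -, rfl⟩ := Finset.mem_image.mp hz
  obtain ⟨m, hm⟩ := heven (c i)
  rw [Finset.sum_congr rfl fun l hl => (Finset.mem_filter.mp hl).2, Finset.sum_const,
    Finset.filter_filter, nsmul_eq_mul, hm, Nat.cast_add, ← two_mul, mul_assoc]
  refine two_mul_mem_twoIntegral (IsIntegral.mul ?_ ?_)
  · exact_mod_cast isIntegral_algebraMap (R := ℤ) (A := ℂ) (x := m)
  · exact IsIntegral.of_pow hk.pos (by rw [hc1]; exact isIntegral_one)

end skewBlocks

section parity
open Representation Module
open scoped Classical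
universe v
variable {G : Type v} [Group G] [Fintype G] {V : Type*} [AddCommGroup V] [Module ℂ V]
  [FiniteDimensional ℂ V] {n : ℕ} {t y j : G} {O : Subgroup G} {e : ℕ}

theorem even_of_card_mul (hO : Odd (Nat.card O)) {z : ℤ}
    (h : (Nat.card O : ℂ) * z ∈ twoIntegral) : Even z := by
  have h1 : Even ((Nat.card O : ℤ) * z) := int_even_of_mem_twoIntegral (by push_cast; exact h)
  rcases Int.even_mul.mp h1 with h2 | h2
  · exact absurd (by exact_mod_cast h2) (Nat.not_even_iff_odd.mpr hO)
  · exact h2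

theorem IsQuaternion.four_avg (h : IsQuaternion t y j O e) {χ : G → ℂ}
    (hreal : ∀ g, χ g⁻¹ = χ g) : 1 / 4 * cosetAvg O y χ - 1 / 4 * cosetAvg O t χ =
      1 / 2 * ((Nat.card O : ℂ)⁻¹ * ∑ k : O, eigPart y χ Complex.I k -
        (Nat.card O : ℂ)⁻¹ * ∑ k : O, eigPart y χ (-1) k) := by
  have h3 : ∑ k : O, χ (y ^ 3 * k) = ∑ k : O, χ (y * k) := by
    rw [← Equiv.sum_comp (Equiv.inv O) fun k : O => χ (y * k)]
    refine Finset.sum_congr rfl fun k _ => ?_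
    have hcomm : Commute (k : G) y := h.part.comm k k.2
    rw [← hreal, mul_inv_rev, ((hcomm.pow_right 3).inv_inv).eq]
    congr 2
    rw [inv_eq_iff_mul_eq_one, ← pow_succ, h.y_pow]
  have hsum : ∀ μ : ℂ, ∑ k : O, eigPart y χ μ k = 1 / 4 * (∑ k : O, χ k + μ * ∑ k : O, χ (y * k) +
      μ ^ 2 * ∑ k : O, χ (t * k) + μ ^ 3 * ∑ k : O, χ (y * k)) := fun μ => by
    simp only [eigPart, ← Finset.mul_sum, Finset.sum_add_distrib, h3, sq y, h.sq_y]
  rw [hsum, hsum, cosetAvg, cosetAvg, Complex.I_pow_three, Complex.I_sq]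
  ring

theorem IsQuaternion.even_neg_one (h : IsQuaternion t y j O e) (hm : IsMinIso t)
    (ρ : Representation ℂ G V) (hreal : ∀ g, ρ.character g⁻¹ = ρ.character g) :
    ∃ m : ℤ, (Nat.card O : ℂ)⁻¹ * ∑ k : O, eigPart y ρ.character (-1) k = 2 * m := by
  obtain ⟨z, hz⟩ := exists_sum_eigPart ρ hreal h.y_pow h.part.comm (μ := -1) (by norm_num)
  obtain ⟨q, hq⟩ := hm.exists_eight_mul h.sq_y h.conj ρ
  have h1 := sum_eigPart_neg_one ρ hreal h.y_pow h.part.odd h.part.comm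
  have h3 : ρ.character (y ^ 3) = ρ.character y := by
    rw [← hreal]; congr 1
    rw [inv_eq_iff_mul_eq_one, ← pow_succ, h.y_pow]
  have h2 : eigPart y ρ.character (-1) 1 = 2 * (q : ℂ) := by
    rw [eigPart, mul_one, mul_one, mul_one, h3, sq y, h.sq_y]
    linear_combination 1 / 4 * hq
  have hz' : (Nat.card O : ℂ) * (z : ℤ) = ∑ k : O, eigPart y ρ.character (-1) k := by
    rw [Int.cast_natCast, ← hz, mul_inv_cancel_left₀ (cardC_ne_zero O)]
  have h4 := add_mem h1 (h2 ▸ two_mul_mem_twoIntegral (isIntegral_algebraMap (R := ℤ) (x := q)))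
  rw [sub_add_cancel, ← hz'] at h4
  obtain ⟨m, hm'⟩ := even_of_card_mul h.part.odd h4
  refine ⟨m, ?_⟩
  rw [hz, ← Int.cast_natCast (R := ℂ), hm']; push_cast; ring

theorem eigPart_mul (χ ψ : G → ℂ) (k : G) : eigPart y (χ * ψ) Complex.I k =
    eigPart y χ 1 k * eigPart y ψ Complex.I k + eigPart y χ Complex.I k * eigPart y ψ 1 k +
    eigPart y χ (-1) k * eigPart y ψ (-Complex.I) k +
    eigPart y χ (-Complex.I) k * eigPart y ψ (-1) k := by
  have h2 := Complex.I_sq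
  have h3 := Complex.I_pow_three
  have h2' : (-Complex.I) ^ 2 = -1 := by rw [neg_sq, h2]
  have h3' : (-Complex.I) ^ 3 = Complex.I := by rw [Odd.neg_pow (by decide), h3, neg_neg]
  simp only [eigPart, h2, h3, h2', h3', Pi.mul_apply]
  ring_nf

theorem IsQuaternion.even_tensor (h : IsQuaternion t y j O e)
    {ρ₁ : Representation ℂ G (Fin n → ℂ)} (hρ₁ : ρ₁.IsIrreducible)
    (hreal₁ : ∀ g, ρ₁.character g⁻¹ = ρ₁.character g) (hn : Odd n) {ε : ℤ} (hε : ε = 1 ∨ ε = -1)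
    (hc : ∀ k ∈ O, ρ₁.character (y * k) + ρ₁.character (y ^ 3 * k) = 2 * ε)
    (ρ : Representation ℂ G V) (hreal : ∀ g, ρ.character g⁻¹ = ρ.character g) :
    ∃ m : ℤ, (Nat.card O : ℂ)⁻¹ * ∑ k : O, eigPart y ρ.character Complex.I k + ε *
      ((Nat.card O : ℂ)⁻¹ * ∑ k : O, eigPart y (ρ₁.character * ρ.character) Complex.I k) = 2 * m := by
  have hI : (-Complex.I) ^ 4 = 1 := by rw [Even.neg_pow (by decide), Complex.I_pow_four]
  have hI2 : (-Complex.I) ^ 2 = -1 := by rw [neg_sq, Complex.I_sq]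
  have hI3 : (-Complex.I) ^ 3 = Complex.I := by
    rw [Odd.neg_pow (by decide), Complex.I_pow_three, neg_neg]
  have hT : (ρ₁.tprod ρ).character = ρ₁.character * ρ.character := char_tensor _ _
  have hrealT : ∀ g, (ρ₁.tprod ρ).character g⁻¹ = (ρ₁.tprod ρ).character g := fun g => by
    rw [hT, Pi.mul_apply, Pi.mul_apply, hreal, hreal₁]
  have hodd : ∀ k : O, Odd (orderOf (k : G)) := fun k =>
    h.part.odd.of_dvd_nat (Subgroup.orderOf_dvd_natCard O k.2)
  have hjj : j * j = y * y := by rw [h.sq_j, h.sq_y]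
  let F : Finset O := Finset.univ.filter fun k : O => j * (k : G)⁻¹ * j⁻¹ = k
  have hF : ∀ k ∈ F, j * (k : G) * j⁻¹ = (k : G)⁻¹ := fun k hk => by
    have := (Finset.mem_filter.mp hk).2
    rw [← inv_inj, conj_inv, this, inv_inv]
  have hFinv : ∀ k ∈ F, k⁻¹ ∈ F := fun k hk => by
    refine Finset.mem_filter.mpr ⟨Finset.mem_univ _, ?_⟩
    rw [Subgroup.coe_inv, inv_inv]; exact hF k hk
  have hisInt : ∀ (k : O) (μ : ℂ), μ ^ 4 = 1 → IsIntegral ℤ (eigPart y ρ.character μ (k : G)) :=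
    fun k μ hμ => eigPart_isIntegral ρ h.y_pow (hodd k) (h.part.comm k k.2) hμ
  have hisInt₁ : ∀ (k : O) (μ : ℂ), μ ^ 4 = 1 → IsIntegral ℤ (eigPart y ρ₁.character μ (k : G)) :=
    fun k μ hμ => eigPart_isIntegral ρ₁ h.y_pow (hodd k) (h.part.comm k k.2) hμ
  have heven : ∀ k ∈ F, ∀ μ : ℂ, μ ^ 2 = -1 → eigPart y ρ₁.character μ (k : G) ∈ twoIntegral :=
    fun k hk μ hμ => eigPart_mem_twoIntegral hρ₁ hreal₁ hn h.y_pow h.conj hjj (hodd k)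
      (h.part.comm k k.2) (hF k hk) hμ
  have hswap : ∑ k ∈ F, eigPart y ρ₁.character (-1) (k : G) *
      eigPart y ρ.character (-Complex.I) (k : G) =
      ∑ k ∈ F, eigPart y ρ₁.character (-1) (k : G) * eigPart y ρ.character Complex.I (k : G) := by
    refine Finset.sum_nbij' (fun k => k⁻¹) (fun k => k⁻¹) hFinv hFinv (fun k _ => inv_inv k)
      (fun k _ => inv_inv k) fun k _ => ?_
    rw [Subgroup.coe_inv, eigPart_inv hreal₁ h.y_pow (h.part.comm k k.2) (by norm_num),
      eigPart_inv hreal h.y_pow (h.part.comm k k.2) Complex.I_pow_four, Complex.I_pow_three]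
    norm_num
  have hdiff : ∀ k : O, eigPart y ρ₁.character 1 (k : G) - eigPart y ρ₁.character (-1) (k : G) = ε :=
    fun k => by
      have := hc k k.2
      simp only [eigPart]
      linear_combination 1 / 2 * this
  have hS1 := h.part.sum_eigPart_I ρ hreal h.y_pow h.conj hjj
  have hS2 := h.part.sum_eigPart_I (ρ₁.tprod ρ) hrealT h.y_pow h.conj hjj
  rw [hT] at hS2
  have hS3 : ∑ k ∈ F, eigPart y (ρ₁.character * ρ.character) Complex.I (k : G) -
      ε * ∑ k ∈ F, eigPart y ρ.character Complex.I (k : G) ∈ twoIntegral := by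
    have h1 : ∑ k ∈ F, eigPart y (ρ₁.character * ρ.character) Complex.I (k : G) -
      ε * ∑ k ∈ F, eigPart y ρ.character Complex.I (k : G) = ∑ k ∈ F,
        (2 * (eigPart y ρ₁.character (-1) (k : G) * eigPart y ρ.character Complex.I (k : G)) +
        eigPart y ρ.character 1 (k : G) * eigPart y ρ₁.character Complex.I (k : G) +
        eigPart y ρ.character (-1) (k : G) * eigPart y ρ₁.character (-Complex.I) (k : G)) := by
      have h2 : ∀ k : O, eigPart y (ρ₁.character * ρ.character) Complex.I (k : G) =
        ε * eigPart y ρ.character Complex.I (k : G) +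
        eigPart y ρ₁.character (-1) (k : G) * eigPart y ρ.character Complex.I (k : G) +
        eigPart y ρ₁.character (-1) (k : G) * eigPart y ρ.character (-Complex.I) (k : G) +
        eigPart y ρ.character 1 (k : G) * eigPart y ρ₁.character Complex.I (k : G) +
        eigPart y ρ.character (-1) (k : G) * eigPart y ρ₁.character (-Complex.I) (k : G) :=
        fun k => by rw [eigPart_mul, ← hdiff k]; ring
      simp only [h2, Finset.sum_add_distrib, hswap, ← Finset.mul_sum]
      ring
    rw [h1]
    refine sum_mem fun k hk => add_mem (add_mem (two_mul_mem_twoIntegral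
      ((hisInt₁ k _ (by norm_num)).mul (hisInt k _ Complex.I_pow_four))) ?_) ?_
    · exact mul_mem_twoIntegral (hisInt k _ (one_pow 4)) (heven k hk _ Complex.I_sq)
    · exact mul_mem_twoIntegral (hisInt k _ (by norm_num)) (heven k hk _ hI2)
  obtain ⟨z₁, hz₁⟩ := exists_sum_eigPart ρ hreal h.y_pow h.part.comm Complex.I_pow_four
  obtain ⟨z₂, hz₂⟩ := exists_sum_eigPart (ρ₁.tprod ρ) hrealT h.y_pow h.part.comm Complex.I_pow_four
  rw [hT] at hz₂
  have hO := cardC_ne_zero O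
  have hεint : IsIntegral ℤ (ε : ℂ) := isIntegral_algebraMap (R := ℤ) (x := ε)
  have hε2 : (ε : ℂ) * ε = 1 := by rcases hε with rfl | rfl <;> norm_num
  have hSint : IsIntegral ℤ (∑ k ∈ F, eigPart y ρ.character Complex.I (k : G)) :=
    IsIntegral.sum _ fun k _ => hisInt k _ Complex.I_pow_four
  have hfin := add_mem (add_mem hS1 (mul_mem_twoIntegral hεint (add_mem hS2 hS3)))
    (two_mul_mem_twoIntegral hSint)
  obtain ⟨m, hm⟩ := even_of_card_mul h.part.odd (z := z₁ + ε * z₂) (by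
    convert hfin using 1
    rw [inv_mul_eq_iff_eq_mul₀ hO] at hz₁ hz₂
    push_cast
    linear_combination -hz₁ - ε * hz₂ +
      (∑ k ∈ F, eigPart y ρ.character Complex.I (k : G)) * hε2)
  refine ⟨m, ?_⟩
  rw [hz₁, hz₂]
  have : ((z₁ + ε * z₂ : ℤ) : ℂ) = 2 * m := by rw [hm]; push_cast; ring
  rw [← this]; push_cast; ring

end parity

section integrality
open Representation Module
open scoped Classical
universe v
variable {G : Type v} [Group G] [Fintype G] {V : Type*} [AddCommGroup V] [Module ℂ V]
  [FiniteDimensional ℂ V] {n : ℕ} {t y j : G} {O : Subgroup G} {e : ℕ}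

theorem IsQuaternion.oddAvg_sub_sectionAvg (h : IsQuaternion t y j O e) (ht : IsIsolated t)
    (ht1 : t ≠ 1) (ρ : Representation ℂ G V) (hreal : ∀ g, ρ.character g⁻¹ = ρ.character g) :
    ∃ z : ℤ, oddAvg ρ.character - sectionAvg t e ρ.character =
      z + 1 / 2 * ((Nat.card O : ℂ)⁻¹ * ∑ k : O, eigPart y ρ.character Complex.I k -
        (Nat.card O : ℂ)⁻¹ * ∑ k : O, eigPart y ρ.character (-1) k) := by
  have h1 := h.sum_sq ht.1 ht1 (character_isClassFun ρ)
  have h2 := h.sum_centralizer ht ht1 (character_isClassFun ρ)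
  have h3 := h.four_avg hreal
  obtain ⟨k, hk⟩ := exists_int_sum_sq ρ
  have h4 : (Nat.card (Subgroup.centralizer {t}) : ℂ)⁻¹ *
      ∑ g : Subgroup.centralizer {t}, ρ.character (g : G) =
      finrank ℂ (invariants (ρ.comp (Subgroup.centralizer {t}).subtype)) :=
    card_inv_sum_character (ρ.comp (Subgroup.centralizer {t}).subtype)
  refine ⟨k - (finrank ℂ (invariants (ρ.comp (Subgroup.centralizer {t}).subtype)) : ℕ), ?_⟩
  push_cast
  rw [hk] at h1
  rw [h4] at h2
  linear_combination h2 - h1 + h3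

theorem IsQuaternion.odd_scalar (h : IsQuaternion t y j O e) (ht : IsIsolated t) (ht1 : t ≠ 1)
    {ρ : Representation ℂ G V} (hreal : ∀ g, ρ.character g⁻¹ = ρ.character g)
    (hsum : ∑ g, ρ.character g = 0) {ε : ℤ} (hε : ε = 1 ∨ ε = -1)
    (hε' : (ε : ℂ) = cosetAvg O y ρ.character) {c : ℤ}
    (hc : (c : ℂ) * finrank ℂ V = ∑ g ∈ oddElts G, ρ.character g) : Odd c := by
  obtain ⟨z, hz⟩ := h.oddAvg_sub_sectionAvg ht ht1 ρ hreal
  obtain ⟨a, ha⟩ := exists_sum_eigPart ρ hreal h.y_pow h.part.comm Complex.I_pow_four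
  obtain ⟨b, hb⟩ := exists_sum_eigPart ρ hreal h.y_pow h.part.comm (μ := -1) (by norm_num)
  have h1 := h.sum_all ht.1 ht1 (character_isClassFun ρ)
  rw [hsum, mul_zero, ← hε'] at h1
  rw [ha, hb] at hz
  obtain ⟨m, hm, hcard⟩ := h.card
  have hG := cardC_ne_zero G
  have h2 : (Nat.card G : ℂ) * oddAvg ρ.character = ∑ g ∈ oddElts G, ρ.character g := by
    rw [oddAvg, mul_inv_cancel_left₀ hG]
  rw [← hc, hcard] at h2
  push_cast at h2
  have h3 : ((c * finrank ℂ V : ℤ) : ℂ) = ((m * (4 * z + 2 * (a - b) - ε) : ℤ) : ℂ) := by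
    push_cast
    linear_combination -h2 + 4 * m * hz - 4 * m * h1
  have h4 : c * finrank ℂ V = m * (4 * z + 2 * (a - b) - ε) := by exact_mod_cast h3
  have h5 : Odd (c * (finrank ℂ V : ℤ)) := by
    rw [h4]
    refine Odd.mul (by exact_mod_cast hm) ?_
    rcases hε with rfl | rfl
    · exact ⟨2 * z + (a - b) - 1, by ring⟩
    · exact ⟨2 * z + (a - b), by ring⟩
  exact (Int.odd_mul.mp h5).1

theorem IsQuaternion.section_sum (h : IsQuaternion t y j O e) (ht : IsIsolated t) (ht1 : t ≠ 1)
    {ρ : Representation ℂ G V} (hρ : ρ.IsIrreducible)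
    (hreal : ∀ g, ρ.character g⁻¹ = ρ.character g)
    (hsum : ∑ g, ρ.character g = 0) {ε : ℤ} (hε : ε = 1 ∨ ε = -1)
    (hε' : (ε : ℂ) = cosetAvg O y ρ.character) {k : G} (hk : k ∈ O) :
    ρ.character (y * k) + ρ.character (y ^ 3 * k) = 2 * ε := by
  obtain ⟨c, hc, hcf⟩ := sum_oddElts_scalar ρ hρ
  have hodd := h.odd_scalar ht ht1 hreal hsum hε hε' hcf
  have hOn : ∀ g, g * y = y * g → ∀ k ∈ O, g * k * g⁻¹ ∈ O := fun g hg k hk => by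
    obtain ⟨r, -, l, hl, rfl⟩ := h.part.split g hg
    have hcomm : Commute (y ^ r) (l * k * l⁻¹) :=
      (show Commute y _ from (h.part.comm _ (O.mul_mem (O.mul_mem hl hk) (O.inv_mem hl))).symm).pow_left r
    rw [show y ^ r * l * k * (y ^ r * l)⁻¹ = y ^ r * (l * k * l⁻¹) * (y ^ r)⁻¹ by group, hcomm.eq,
      mul_inv_cancel_right]
    exact O.mul_mem (O.mul_mem hl hk) (O.inv_mem hl)
  have hsec : ∀ k ∈ O, ρ.character (y * k) + ρ.character (y ^ 3 * k) =
      ρ.character y + ρ.character (y ^ 3) := fun k hk =>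
    character_section hodd hc h.y_pow h.part.odd h.part.comm hOn hk
  have h3 : ∑ k : O, ρ.character (y ^ 3 * k) = ∑ k : O, ρ.character (y * k) := by
    rw [← Equiv.sum_comp (Equiv.inv O) fun k : O => ρ.character (y * k)]
    refine Finset.sum_congr rfl fun k _ => ?_
    have hcomm : Commute (k : G) y := h.part.comm k k.2
    rw [← hreal, mul_inv_rev, ((hcomm.pow_right 3).inv_inv).eq]
    congr 2
    rw [inv_eq_iff_mul_eq_one, ← pow_succ, h.y_pow]
  have h4 : ∑ k : O, (ρ.character (y * k) + ρ.character (y ^ 3 * k)) =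
      Nat.card O * (ρ.character y + ρ.character (y ^ 3)) := by
    rw [Finset.sum_congr rfl fun (k : O) _ => hsec k k.2, Finset.sum_const, Finset.card_univ,
      nsmul_eq_mul, Nat.card_eq_fintype_card]
  rw [Finset.sum_add_distrib, h3] at h4
  rw [hsec k hk, hε', cosetAvg]
  have hO := cardC_ne_zero O
  field_simp
  linear_combination -h4

theorem IsQuaternion.exists_int_pair (h : IsQuaternion t y j O e) (hm : IsMinIso t)
    {ρ₁ : Representation ℂ G (Fin n → ℂ)} (hρ₁ : ρ₁.IsIrreducible)
    (hreal₁ : ∀ g, ρ₁.character g⁻¹ = ρ₁.character g) (hn : Odd n) {ε : ℤ} (hε : ε = 1 ∨ ε = -1)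
    (hc : ∀ k ∈ O, ρ₁.character (y * k) + ρ₁.character (y ^ 3 * k) = 2 * ε)
    (ρ : Representation ℂ G V) (hreal : ∀ g, ρ.character g⁻¹ = ρ.character g) :
    ∃ z : ℤ, oddAvg (fun g => (1 + ε * ρ₁.character g) * ρ.character g) -
      sectionAvg t e (fun g => (1 + ε * ρ₁.character g) * ρ.character g) = z := by
  have hT : (ρ₁.tprod ρ).character = ρ₁.character * ρ.character := char_tensor _ _
  have hrealT : ∀ g, (ρ₁.tprod ρ).character g⁻¹ = (ρ₁.tprod ρ).character g := fun g => by
    rw [hT, Pi.mul_apply, Pi.mul_apply, hreal, hreal₁]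
  obtain ⟨z₁, hz₁⟩ := h.oddAvg_sub_sectionAvg hm.iso hm.ne_one ρ hreal
  obtain ⟨z₂, hz₂⟩ := h.oddAvg_sub_sectionAvg hm.iso hm.ne_one (ρ₁.tprod ρ) hrealT
  obtain ⟨m₁, hm₁⟩ := h.even_neg_one hm ρ hreal
  obtain ⟨m₂, hm₂⟩ := h.even_neg_one hm (ρ₁.tprod ρ) hrealT
  obtain ⟨m₃, hm₃⟩ := h.even_tensor hρ₁ hreal₁ hn hε hc ρ hreal
  rw [hT] at hz₂ hm₂
  have hsum : ∀ s : Finset G, ∑ g ∈ s, (1 + ε * ρ₁.character g) * ρ.character g =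
      ∑ g ∈ s, ρ.character g + ε * ∑ g ∈ s, (ρ₁.character * ρ.character) g := fun s => by
    rw [Finset.mul_sum, ← Finset.sum_add_distrib]
    exact Finset.sum_congr rfl fun g _ => by rw [Pi.mul_apply]; ring
  refine ⟨z₁ + ε * z₂ + m₃ - m₁ - ε * m₂, ?_⟩
  simp only [oddAvg, sectionAvg] at hz₁ hz₂ ⊢
  rw [hsum, hsum]
  push_cast
  linear_combination hz₁ + ε * hz₂ + 1 / 2 * hm₃ - 1 / 2 * hm₁ - 1 / 2 * ε * hm₂

end integrality

section signed
open Representation Module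
open scoped Classical
universe v
variable {G : Type v} [Group G] [Fintype G] {n : ℕ} {t y j : G} {O : Subgroup G} {e : ℕ}
  {Ψ : G → ℂ}

/-- The function equal to `Ψ` on elements of odd order, to `-Ψ` on the section of `t`, and zero
elsewhere. -/
noncomputable def signedFun (t : G) (e : ℕ) (Ψ : G → ℂ) (g : G) : ℂ :=
  if g ^ e = 1 then Ψ g else if IsConj t (g ^ e) then -Ψ g else 0

theorem signedFun_odd {g : G} (hg : g ^ e = 1) : signedFun t e Ψ g = Ψ g := if_pos hg

theorem signedFun_section (ht1 : t ≠ 1) {g : G} (hg : IsConj t (g ^ e)) :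
    signedFun t e Ψ g = -Ψ g := by
  rw [signedFun, if_neg, if_pos hg]
  intro h
  rw [h] at hg
  exact ht1 (isConj_one_left.mp hg)

theorem IsQuaternion.signedFun_eq_zero (h : IsQuaternion t y j O e) (ht : t * t = 1) (ht1 : t ≠ 1)
    {g : G} (hg : IsConj y (g ^ e)) : signedFun t e Ψ g = 0 := by
  have h2 : g ^ e ≠ 1 := fun h' => ht1 (by
    rw [h'] at hg
    rw [← h.sq_y, isConj_one_left.mp hg, one_mul])
  have h3 : ¬ IsConj t (g ^ e) := fun h' => by
    obtain ⟨c, hc⟩ := isConj_iff.mp (h'.trans hg.symm)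
    apply ht1
    rw [← h.sq_y, ← hc, conj_mul, ht, mul_one, mul_inv_cancel]
  rw [signedFun, if_neg h2, if_neg h3]

theorem signedFun_isClassFun (hΨ : IsClassFun Ψ) : IsClassFun (signedFun t e Ψ) := fun x g => by
  have h1 : (x * g * x⁻¹) ^ e = 1 ↔ g ^ e = 1 := by
    rw [conj_pow, conj_eq_one_iff]
  have h2 : IsConj t ((x * g * x⁻¹) ^ e) ↔ IsConj t (g ^ e) := by
    rw [conj_pow]
    have h3 : IsConj (g ^ e) (x * g ^ e * x⁻¹) := isConj_iff.mpr ⟨x, rfl⟩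
    exact ⟨fun h => h.trans h3.symm, fun h => h.trans h3⟩
  have h3 : Ψ (x * g * x⁻¹) = Ψ g := hΨ x g
  simp only [signedFun]
  rw [h3]
  congr 1
  · exact propext h1
  · congr 1
    exact propext h2

theorem signedFun_inv (ht : t * t = 1) (hΨ : ∀ g, Ψ g⁻¹ = Ψ g) (g : G) :
    signedFun t e Ψ g⁻¹ = signedFun t e Ψ g := by
  have hinv : ∀ u : G, IsConj t u → IsConj t u⁻¹ := fun u hu => by
    obtain ⟨c, rfl⟩ := isConj_iff.mp hu
    rw [conj_inv, inv_eq_of_mul_eq_one_left ht]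
    exact hu
  have h2 : IsConj t (g⁻¹ ^ e) ↔ IsConj t (g ^ e) := by
    rw [inv_pow]
    exact ⟨fun h => inv_inv (g ^ e) ▸ hinv _ h, hinv _⟩
  simp only [signedFun]
  rw [hΨ]
  congr 1
  · rw [inv_pow, inv_eq_one]
  · congr 1
    exact propext h2

theorem IsQuaternion.charPair_signedFun (h : IsQuaternion t y j O e) (ht : t * t = 1) (ht1 : t ≠ 1)
    {f : G → ℂ} (hf : ∀ g, f g⁻¹ = f g) : charPair (signedFun t e Ψ) f =
      oddAvg (fun g => Ψ g * f g) - sectionAvg t e (fun g => Ψ g * f g) := by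
  rw [charPair, h.sum_cases ht ht1, oddAvg, sectionAvg, ← mul_sub,
    Finset.sum_eq_zero (s := Finset.univ.filter fun g => IsConj y (g ^ e)), add_zero,
    sub_eq_add_neg, ← Finset.sum_neg_distrib]
  · congr 2
    · refine Finset.sum_congr rfl fun g hg => ?_
      rw [signedFun_odd ((h.pow_eq_one g).mpr (mem_oddElts.mp hg)), hf]
    · refine Finset.sum_congr rfl fun g hg => ?_
      rw [signedFun_section ht1 (Finset.mem_filter.mp hg).2, hf, neg_mul]
  · intro g hg
    rw [h.signedFun_eq_zero ht ht1 (Finset.mem_filter.mp hg).2, zero_mul]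

theorem IsQuaternion.charPair_signedFun_self (h : IsQuaternion t y j O e) (ht : t * t = 1)
    (ht1 : t ≠ 1) (hΨ : IsClassFun Ψ) (hinv : ∀ g, Ψ g⁻¹ = Ψ g) :
    charPair (signedFun t e Ψ) (signedFun t e Ψ) =
      (Nat.card G : ℂ)⁻¹ * ∑ g, Ψ g * Ψ g - 1 / 4 * cosetAvg O y fun g => Ψ g * Ψ g := by
  have hΨ2 : IsClassFun fun g => Ψ g * Ψ g := fun x g => by
    show Ψ (x * g * x⁻¹) * Ψ (x * g * x⁻¹) = Ψ g * Ψ g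
    rw [hΨ x g]
  rw [h.sum_all ht ht1 hΨ2, h.charPair_signedFun ht ht1 (signedFun_inv ht hinv), add_sub_cancel_right,
    sub_eq_add_neg]
  congr 1
  · simp only [oddAvg]
    congr 1
    refine Finset.sum_congr rfl fun g hg => ?_
    rw [signedFun_odd ((h.pow_eq_one g).mpr (mem_oddElts.mp hg))]
  · simp only [sectionAvg]
    rw [← mul_neg, ← Finset.sum_neg_distrib]
    congr 1
    refine Finset.sum_congr rfl fun g hg => ?_
    rw [signedFun_section ht1 (Finset.mem_filter.mp hg).2, mul_neg, neg_neg]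

theorem IsQuaternion.sum_signedFun_sq (h : IsQuaternion t y j O e) (ht : t * t = 1) (ht1 : t ≠ 1)
    (hΨ : IsClassFun Ψ) : (Nat.card G : ℂ)⁻¹ * ∑ g, signedFun t e Ψ (g * g) =
      (Nat.card G : ℂ)⁻¹ * ∑ g, Ψ (g * g) - 1 / 2 * cosetAvg O t Ψ := by
  have hsq : ∀ g : G, (g * g) ^ e = g ^ e * g ^ e := fun g => (Commute.refl g).mul_pow e
  have hΨ2 : IsClassFun fun g => Ψ (g * g) := fun x g => by
    show Ψ (x * g * x⁻¹ * (x * g * x⁻¹)) = Ψ (g * g)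
    rw [conj_mul]; exact hΨ x _
  have hy : cosetAvg O y (fun g => Ψ (g * g)) = cosetAvg O t Ψ := by
    simp only [cosetAvg]
    congr 1
    have h1 := h.sum_odd_sq (Subgroup.centralizer {y}) fun k => Ψ (t * k)
    simp only [Subgroup.mem_centralizer_singleton_iff] at h1
    rw [h.sum_part fun k => Ψ (t * (k * k)), h.sum_part fun k => Ψ (t * k)] at h1
    rw [← h1]
    refine Finset.sum_congr rfl fun k _ => ?_
    have hc : Commute (k : G) y := h.part.comm k k.2
    show Ψ (y * k * (y * k)) = _
    rw [hc.mul_mul_mul_comm, h.sq_y]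
  have hsum := h.sum_y hΨ2
  rw [hy] at hsum
  rw [h.sum_cases ht ht1, h.sum_cases ht ht1 fun g => Ψ (g * g),
    Finset.sum_congr (s₁ := oddElts G) (g := fun g => Ψ (g * g)) rfl,
    Finset.sum_congr (s₁ := Finset.univ.filter fun g => IsConj t (g ^ e))
      (g := fun g => Ψ (g * g)) rfl,
    Finset.sum_congr (s₁ := Finset.univ.filter fun g => IsConj y (g ^ e))
      (f := fun g => signedFun t e Ψ (g * g)) (g := fun g => -Ψ (g * g)) rfl,
    Finset.sum_neg_distrib]
  · linear_combination -2 * hsum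
  · intro g hg
    obtain ⟨c, hc⟩ := isConj_iff.mp (Finset.mem_filter.mp hg).2
    refine signedFun_section ht1 (isConj_iff.mpr ⟨c, ?_⟩)
    rw [hsq, ← hc, conj_mul, h.sq_y]
  · intro g hg
    obtain ⟨c, hc⟩ := isConj_iff.mp (Finset.mem_filter.mp hg).2
    refine signedFun_odd ?_
    rw [hsq, ← hc, conj_mul, ht, mul_one, mul_inv_cancel]
  · intro g hg
    refine signedFun_odd ?_
    rw [hsq, (h.pow_eq_one g).mpr (mem_oddElts.mp hg), one_mul]

end signed

section contradiction
open Representation Module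
open scoped Classical
universe v
variable {G : Type v} [Group G] [Fintype G] {n : ℕ} {t y j : G} {O : Subgroup G} {e : ℕ}

theorem conj_charPair {f χ : G → ℂ} (hf : ∀ g, starRingEnd ℂ (f g) = f g)
    (hinv : ∀ g, f g⁻¹ = f g) (hχ : IsIrrChar χ) :
    starRingEnd ℂ (charPair f χ) = charPair f χ := by
  obtain ⟨n, ρ, -, rfl⟩ := hχ
  rw [charPair, map_mul, map_inv₀, Complex.conj_natCast, map_sum]
  congr 1
  rw [← Equiv.sum_comp (Equiv.inv G) fun x => f x * ρ.character x⁻¹]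
  refine Finset.sum_congr rfl fun x _ => ?_
  rw [map_mul, hf, conj_character, Equiv.inv_apply, hinv]

theorem sum_sq_expand {f : G → ℂ} (hf : IsClassFun f) : (Nat.card G : ℂ)⁻¹ * ∑ g, f (g * g) =
    ∑ χ ∈ irr G, charPair f χ * ((Nat.card G : ℂ)⁻¹ * ∑ g, χ (g * g)) := by
  simp only [Finset.mul_sum]
  rw [Finset.sum_comm]
  refine Finset.sum_congr rfl fun g _ => ?_
  rw [classFun_expand hf (g * g), Finset.mul_sum]
  exact Finset.sum_congr rfl fun χ _ => by ring

/-- A real class function of norm at most one with integral coefficients at the real characters and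
nonzero average over squares is an irreducible character up to sign. -/
theorem exists_irr_of_norm_le_one {f : G → ℂ} (hf : IsClassFun f)
    (hconj : ∀ g, starRingEnd ℂ (f g) = f g) (hinv : ∀ g, f g⁻¹ = f g)
    (hisInt : ∀ χ, IsIrrChar χ → (∀ g, χ g⁻¹ = χ g) → ∃ z : ℤ, charPair f χ = z)
    (hnorm : (charPair f f).re ≤ 1) (hsq : (Nat.card G : ℂ)⁻¹ * ∑ g, f (g * g) ≠ 0) :
    ∃ (χ : G → ℂ) (s : ℂ), IsIrrChar χ ∧ s * s = 1 ∧ ∀ g, f g = s * χ g := by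
  have hre : ∀ χ ∈ irr G, charPair f χ = ((charPair f χ).re : ℂ) := fun χ hχ =>
    (Complex.conj_eq_iff_re.mp (conj_charPair hconj hinv (mem_irr.mp hχ))).symm
  have hsum : ∑ χ ∈ irr G, (charPair f χ).re ^ 2 ≤ 1 := by
    rw [parseval hf f, Complex.re_sum] at hnorm
    convert hnorm using 2 with χ hχ
    rw [hre χ hχ, ← Complex.ofReal_mul, Complex.ofReal_re, Complex.ofReal_re, sq]
  rw [sum_sq_expand hf] at hsq
  obtain ⟨χ, hχ, hne⟩ := Finset.exists_ne_zero_of_sum_ne_zero hsq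
  have hχ' := mem_irr.mp hχ
  have hreal : ∀ g, χ g⁻¹ = χ g := by
    by_contra hr
    push Not at hr
    exact hne (by rw [hχ'.sum_sq_eq_zero hr, mul_zero])
  obtain ⟨z, hz⟩ := hisInt χ hχ' hreal
  have hz0 : z ≠ 0 := by
    rintro rfl
    exact hne (by rw [hz, Int.cast_zero, zero_mul])
  have hzre : (charPair f χ).re = z := by rw [hz, Complex.intCast_re]
  rw [← Finset.add_sum_erase _ _ hχ, hzre] at hsum
  have hz1 : (1 : ℝ) ≤ (z : ℝ) ^ 2 := by
    have : (1 : ℤ) ≤ z ^ 2 := by have := sq_nonneg z; have := pow_ne_zero 2 hz0; omega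
    exact_mod_cast this
  have hrest : ∑ ψ ∈ (irr G).erase χ, (charPair f ψ).re ^ 2 = 0 :=
    le_antisymm (by linarith) (Finset.sum_nonneg fun _ _ => sq_nonneg _)
  have hzero : ∀ ψ ∈ (irr G).erase χ, charPair f ψ = 0 := fun ψ hψ => by
    rw [hre ψ (Finset.mem_of_mem_erase hψ), sq_eq_zero_iff.mp
      ((Finset.sum_eq_zero_iff_of_nonneg fun _ _ => sq_nonneg _).mp hrest ψ hψ), Complex.ofReal_zero]
  have hz2 : (z : ℝ) ^ 2 = 1 := by rw [hrest] at hsum; linarith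
  refine ⟨χ, z, hχ', ?_, fun g => ?_⟩
  · have : z ^ 2 = 1 := by exact_mod_cast hz2
    rw [← sq]; exact_mod_cast this
  · rw [classFun_expand hf g, ← Finset.add_sum_erase _ _ hχ, hz, Finset.sum_eq_zero, add_zero]
    intro ψ hψ
    rw [hzero ψ hψ, zero_mul]

theorem IsMinIso.false_of_exists (hm : IsMinIso t) (h : IsQuaternion t y j O e)
    {ρ : Representation ℂ G (Fin n → ℂ)} (hρ : ρ.IsIrreducible)
    (hreal : ∀ g, ρ.character g⁻¹ = ρ.character g) (hn : Odd n) (hne : ρ.character t ≠ ρ.character 1)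
    {ε : ℤ} (hε : ε = 1 ∨ ε = -1) (hε' : (ε : ℂ) = cosetAvg O y ρ.character) : False := by
  have ht := hm.iso.1
  have ht1 := hm.ne_one
  have hG := cardC_ne_zero G
  have hO := cardC_ne_zero O
  have hε2 : (ε : ℂ) * ε = 1 := by rcases hε with rfl | rfl <;> norm_num
  have hirr : IsIrrChar ρ.character := ⟨n, ρ, hρ, rfl⟩
  have hne1 : ρ.character ≠ fun _ => 1 := fun h' => hne (by rw [h'])
  have hsum : (Nat.card G : ℂ)⁻¹ * ∑ g, ρ.character g = 0 := by
    have := charPair_irr hirr (isIrrChar_one (G := G))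
    rw [if_neg hne1] at this
    simpa [charPair] using this
  have hsum0 : ∑ g, ρ.character g = 0 := by
    rcases mul_eq_zero.mp hsum with h' | h'
    · exact absurd h' (inv_ne_zero hG)
    · exact h'
  have hsumsq : (Nat.card G : ℂ)⁻¹ * ∑ g, ρ.character g * ρ.character g = 1 := by
    have := charPair_irr hirr hirr
    rw [if_pos rfl, charPair] at this
    rw [← this]
    simp only [hreal]
  have hconst : (Nat.card G : ℂ)⁻¹ * ∑ _g : G, (1 : ℂ) = 1 := by
    rw [Finset.sum_const, Finset.card_univ, nsmul_one, ← Nat.card_eq_fintype_card,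
      inv_mul_cancel₀ hG]
  have hc := fun k (hk : k ∈ O) => h.section_sum hm.iso ht1 hρ hreal hsum0 hε hε' hk
  set Ψ : G → ℂ := fun g => 1 + ε * ρ.character g with hΨdef
  have hΨ : IsClassFun Ψ := fun x g => by
    show 1 + ε * ρ.character (x * g * x⁻¹) = 1 + ε * ρ.character g
    rw [character_isClassFun ρ x g]
  have hΨinv : ∀ g, Ψ g⁻¹ = Ψ g := fun g => by
    show 1 + ε * ρ.character g⁻¹ = 1 + ε * ρ.character g
    rw [hreal]
  have hΨconj : ∀ g, starRingEnd ℂ (Ψ g) = Ψ g := fun g => by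
    show starRingEnd ℂ (1 + ε * ρ.character g) = 1 + ε * ρ.character g
    rw [map_add, map_one, map_mul, map_intCast, conj_character, hreal]
  have hΨre : ∀ g, Ψ g = ((Ψ g).re : ℂ) := fun g => (Complex.conj_eq_iff_re.mp (hΨconj g)).symm
  have hYconj : ∀ g, starRingEnd ℂ (signedFun t e Ψ g) = signedFun t e Ψ g := fun g => by
    rw [signedFun]
    split_ifs
    · exact hΨconj g
    · rw [map_neg, hΨconj]
    · exact map_zero _
  have hnorm : (charPair (signedFun t e Ψ) (signedFun t e Ψ)).re ≤ 1 := by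
    rw [h.charPair_signedFun_self ht ht1 hΨ hΨinv]
    have h1 : (Nat.card G : ℂ)⁻¹ * ∑ g, Ψ g * Ψ g = 2 := by
      have h2 : ∀ g, Ψ g * Ψ g = 1 + 2 * ε * ρ.character g + ρ.character g * ρ.character g :=
        fun g => by linear_combination (ρ.character g * ρ.character g) * hε2
      simp only [h2, Finset.sum_add_distrib, ← Finset.mul_sum, hsum0]
      linear_combination hconst + hsumsq
    have h2 : ∑ k : O, Ψ (y * k) = 2 * Nat.card O := by
      have h3 : ∑ k : O, ρ.character (y * k) = Nat.card O * ε := by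
        rw [hε', cosetAvg, mul_inv_cancel_left₀ hO]
      simp only [hΨdef, Finset.sum_add_distrib, ← Finset.mul_sum, h3, Finset.sum_const,
        Finset.card_univ, nsmul_one, ← Nat.card_eq_fintype_card]
      linear_combination (Nat.card O : ℂ) * hε2
    have h2' : ∑ k : O, (Ψ (y * k)).re = 2 * Nat.card O := by
      have := congrArg Complex.re h2
      rw [Complex.re_sum] at this
      rw [this]; simp
    have h4 : cosetAvg O y (fun g => Ψ g * Ψ g) =
        (((Nat.card O : ℝ)⁻¹ * ∑ k : O, (Ψ (y * k)).re ^ 2 : ℝ) : ℂ) := by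
      rw [cosetAvg]
      push_cast
      congr 1
      refine Finset.sum_congr rfl fun k _ => ?_
      rw [← hΨre, sq]
    have h5 : (4 : ℝ) ≤ (Nat.card O : ℝ)⁻¹ * ∑ k : O, (Ψ (y * k)).re ^ 2 := by
      have hOpos : (0 : ℝ) < Nat.card O := by exact_mod_cast Nat.card_pos
      have h6 : 0 ≤ ∑ k : O, ((Ψ (y * k)).re - 2) ^ 2 := Finset.sum_nonneg fun _ _ => sq_nonneg _
      have h7 : ∑ k : O, ((Ψ (y * k)).re - 2) ^ 2 =
          ∑ k : O, (Ψ (y * k)).re ^ 2 - 4 * ∑ k : O, (Ψ (y * k)).re + 4 * Nat.card O := by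
        have h8 : (4 * Nat.card O : ℝ) = ∑ _k : O, (4 : ℝ) := by
          rw [Finset.sum_const, Finset.card_univ, nsmul_eq_mul, ← Nat.card_eq_fintype_card, mul_comm]
        rw [h8, Finset.mul_sum, ← Finset.sum_sub_distrib, ← Finset.sum_add_distrib]
        exact Finset.sum_congr rfl fun _ _ => by ring
      rw [le_inv_mul_iff₀ hOpos]
      linarith
    rw [h1, h4, show (2 : ℂ) - 1 / 4 * (((Nat.card O : ℝ)⁻¹ * ∑ k : O, (Ψ (y * k)).re ^ 2 : ℝ) : ℂ) =
      ((2 - 1 / 4 * ((Nat.card O : ℝ)⁻¹ * ∑ k : O, (Ψ (y * k)).re ^ 2) : ℝ) : ℂ) by push_cast; ring,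
      Complex.ofReal_re]
    linarith
  have hsq : (Nat.card G : ℂ)⁻¹ * ∑ g, signedFun t e Ψ (g * g) ≠ 0 := by
    obtain ⟨ν, hν, hν'⟩ := exists_sum_sq_odd hρ hreal
    obtain ⟨a, ha⟩ := h.even_neg_one hm ρ hreal
    obtain ⟨b, hb⟩ := h.even_tensor hρ hreal hn hε hc (Representation.trivial ℂ G ℂ) fun g => by
      simp [Representation.character]
    have htriv : (Representation.trivial ℂ G ℂ).character = 1 := by
      funext g; simp [Representation.character]
    have hA : ∀ k : G, eigPart y (1 : G → ℂ) Complex.I k = 0 := fun k => by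
      simp only [eigPart, Pi.one_apply, Complex.I_pow_three, Complex.I_sq]; ring
    rw [htriv, mul_one] at hb
    simp only [hA, Finset.sum_const_zero, mul_zero, zero_add] at hb
    have h4 := h.four_avg hreal
    rw [← hε', ha] at h4
    have h5 : (Nat.card G : ℂ)⁻¹ * ∑ g, Ψ (g * g) = 1 + ε * ν := by
      simp only [hΨdef, Finset.sum_add_distrib, ← Finset.mul_sum]
      rw [mul_add, hconst, ← hν']; ring
    have h6 : cosetAvg O t Ψ = 1 + ε * cosetAvg O t ρ.character := by
      have h7 : (Nat.card O : ℂ)⁻¹ * ∑ _k : O, (1 : ℂ) = 1 := by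
        rw [Finset.sum_const, Finset.card_univ, nsmul_one, ← Nat.card_eq_fintype_card,
          inv_mul_cancel₀ hO]
      simp only [cosetAvg, hΨdef, Finset.sum_add_distrib, ← Finset.mul_sum]
      rw [mul_add, h7]; ring
    have h7 : (Nat.card G : ℂ)⁻¹ * ∑ g, signedFun t e Ψ (g * g) =
        ((2 * b + ε * ν - 2 * ε * a : ℤ) : ℂ) := by
      rw [h.sum_signedFun_sq ht ht1 hΨ, h5, h6]
      push_cast
      linear_combination 2 * ε * h4 + hb - 1 / 2 * hε2
    rw [h7, Int.cast_ne_zero]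
    intro h8
    have h9 : Odd (ε * ν) := Odd.mul (by rcases hε with rfl | rfl <;> decide) hν
    exact Int.not_even_iff_odd.mpr h9 ⟨ε * a - b, by linear_combination h8⟩
  obtain ⟨χ, s, hχ, hs, hY⟩ := exists_irr_of_norm_le_one (signedFun_isClassFun hΨ) hYconj
    (signedFun_inv ht hΨinv) (fun χ hχ hr => by
      obtain ⟨m, σ, -, rfl⟩ := hχ
      rw [h.charPair_signedFun ht ht1 hr]
      exact h.exists_int_pair hm hρ hreal hn hε hc σ hr) hnorm hsq
  have hχY : ∀ g, χ g = s * signedFun t e Ψ g := fun g => by rw [hY, ← mul_assoc, hs, one_mul]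
  have hY1 : signedFun t e Ψ 1 = Ψ 1 := signedFun_odd (one_pow e)
  have hYt : signedFun t e Ψ t = -Ψ t := signedFun_section ht1 (by
    rw [h.pow_e (show t ^ 4 = 1 by rw [pow_mul t 2 2, sq t, ht, one_pow])])
  have hYg : ∀ g ∈ Finset.univ.filter (IsConj t), signedFun t e Ψ (g * t) = Ψ (g * t) :=
    fun g hg => signedFun_odd ((h.pow_eq_one _).mpr
      (hm.iso.odd_mul (Finset.mem_filter.mp hg).2 (IsConj.refl t)))
  have e1 := irr_conj_sum hirr t t
  have e2 := irr_conj_sum hχ t t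
  have hN : ((Finset.univ.filter (IsConj t)).card : ℂ) ≠ 0 := by
    refine Nat.cast_ne_zero.mpr (Finset.card_ne_zero.mpr ⟨t, ?_⟩)
    exact Finset.mem_filter.mpr ⟨Finset.mem_univ _, IsConj.refl t⟩
  have hsumχ : ∑ g ∈ Finset.univ.filter (IsConj t), χ (g * t) =
      s * ((Finset.univ.filter (IsConj t)).card +
        ε * ∑ g ∈ Finset.univ.filter (IsConj t), ρ.character (g * t)) := by
    rw [Finset.sum_congr rfl fun g hg => (hχY _).trans (by rw [hYg g hg]), ← Finset.mul_sum]
    simp only [hΨdef, Finset.sum_add_distrib, ← Finset.mul_sum, Finset.sum_const, nsmul_one]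
  rw [hsumχ, hχY 1, hχY t, hY1, hYt] at e2
  simp only [hΨdef] at e2
  set N : ℂ := ((Finset.univ.filter (IsConj t)).card : ℂ)
  set S := ∑ g ∈ Finset.univ.filter (IsConj t), ρ.character (g * t)
  set f := ρ.character 1
  set p := ρ.character t
  have e3 : (1 + ε * f) * (N + ε * S) = N * (1 + ε * p) ^ 2 := by
    linear_combination e2 - ((1 + ε * f) * (N + ε * S) - N * (1 + ε * p) ^ 2) * hs
  have e4 : ε * N * (p - f) ^ 2 = 0 := by
    linear_combination f * e3 - (1 + ε * f) * ε * e1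
  have hε0 : (ε : ℂ) ≠ 0 := left_ne_zero_of_mul (by rw [hε2]; exact one_ne_zero)
  rcases mul_eq_zero.mp e4 with h' | h'
  · exact mul_ne_zero hε0 hN h'
  · exact hne (sub_eq_zero.mp (pow_eq_zero_iff two_ne_zero |>.mp h'))

end contradiction

theorem IsMinIso.elim {G : Type*} [Group G] [Finite G] {t : G} (hm : IsMinIso t) : False := by
  classical
  have : Fintype G := Fintype.ofFinite G
  obtain ⟨y, j, O, e, h, χ, ⟨n, ρ, hρ, rfl⟩, hne, hreal, ⟨m, hm', hχ1⟩, ε, hε, hε'⟩ :=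
    hm.exists_isQuaternion
  have hn : n = m := by
    rw [Representation.char_one, Module.finrank_fin_fun] at hχ1
    exact_mod_cast hχ1
  exact hm.false_of_exists h hρ hreal (hn ▸ hm') hne hε hε'

theorem odd_card_isoKernel_JA (L : Type*) [RightBruckLoop L] [Fintype L]
    (h : Odd (Fintype.card L)) : Odd (Nat.card (isoKernel (JA L))) :=
  isolated_of_min (fun _ _ _ _ hm => hm.elim) _ _ _ le_rfl (JA_isolated h)

/-- For `i ∈ {1,2}` let `Q_i` be a right Bruck loop of odd order and
`A_i = Mlt_ρ(Q_i) ⋊ ⟨J_i⟩`. If `A₁ ≅ A₂` as groups, then `Q₁ ≅ Q₂`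
as loops. -/
theorem stmt9 (Q₁ Q₂ : Type*) [RightBruckLoop Q₁] [RightBruckLoop Q₂]
    [Fintype Q₁] [Fintype Q₂]
    (h1 : Odd (Fintype.card Q₁)) (h2 : Odd (Fintype.card Q₂))
    (hiso : Nonempty (↥(Agrp Q₁) ≃* ↥(Agrp Q₂))) :
    ∃ f : Q₁ ≃ Q₂, ∀ a b : Q₁, f (a * b) = f a * f b := by
  obtain ⟨φ⟩ := hiso
  exact loop_iso_of_odd_kernel Q₁ Q₂ h1 h2 (odd_card_isoKernel_JA Q₁ h1)
    (odd_card_isoKernel_JA Q₂ h2) φ
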